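/- arXiv:1508.01565 — 2 statements merged into one kernel-verified Lean document; each statement's English description precedes it below -/
import Mathlib

section
/- Let f ∈ ℬ and suppose (P) admits a unique nondecreasing viscosity solution u. Suppose {𝒫_{tf}}_{t>0} is a family of Poisson point processes defined on a common probability space, where 𝒫_{tf} has intensity tf, and suppose 𝒫_{sf} ⊆ 𝒫_{tf} whenever 0 < s ≤ t. Define U_t(x) = ℓ(𝒫_{tf} ∩ [0,x]). Then with probability one, t^{-1/d} U_t → u locally uniformly on [0,∞)^d as t → ∞ along the continuous parameter t. -/
open MeasureTheory Filter Set Topology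

noncomputable section

/-- `ℓ(A)`: the maximal cardinality of a chain (finite subset totally ordered by the
coordinatewise partial order `≤`) contained in `A ⊆ ℝ^d`. -/
def chainLength (d : ℕ) (A : Set (Fin d → ℝ)) : ℕ :=
  sSup {n : ℕ | ∃ C : Finset (Fin d → ℝ),
    ↑C ⊆ A ∧ IsChain (· ≤ ·) (C : Set (Fin d → ℝ)) ∧ C.card = n}

/-- The class `ℬ` of nonnegative, locally bounded, Lebesgue-measurable functions. -/
def MemB (d : ℕ) (f : (Fin d → ℝ) → ℝ) : Prop :=
  Measurable f ∧ (∀ x, 0 ≤ f x) ∧ ∀ x : Fin d → ℝ, ∃ U ∈ 𝓝 x, BddAbove (f '' U)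

/-- The Euclidean norm on `ℝ^d` (modelled as `Fin d → ℝ`). -/
def euclNorm (d : ℕ) (x : Fin d → ℝ) : ℝ := Real.sqrt (∑ i, (x i) ^ 2)

/-- The expectation `E[ℓ_n]` of the length of a longest chain among `n` i.i.d. points
uniformly distributed in the unit cube `[0,1]^d`. -/
def BWexpect (d n : ℕ) : ℝ :=
  ∫ X : Fin n → Fin d → ℝ, (chainLength d (Set.range X) : ℝ)
    ∂(Measure.pi fun _ => volume.restrict (Set.Icc (0 : Fin d → ℝ) 1))

/-- `c` is the Bollobás–Winkler constant `c_d`: `c > 0` and `n^{-1/d} E[ℓ_n] → c`. -/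
def IsBWConstant (d : ℕ) (c : ℝ) : Prop :=
  0 < c ∧ Tendsto (fun n : ℕ => (n : ℝ) ^ (-(1 : ℝ) / d) * BWexpect d n) atTop (nhds c)

/-- A Poisson point process on `ℝ^d` with intensity function `g`, on a probability space
`(Ω, P)`: a random at-most-countable subset of `ℝ^d` such that for every bounded Borel set `A`
the count `#(pts ω ∩ A)` is measurable with Poisson distribution of mean `∫_A g`, and counts of
pairwise disjoint Borel sets are independent. -/
structure PoissonPP (d : ℕ) {Ω : Type*} [MeasurableSpace Ω] (P : Measure Ω)
    (g : (Fin d → ℝ) → ℝ) where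
  pts : Ω → Set (Fin d → ℝ)
  countable : ∀ ω, (pts ω).Countable
  measur : ∀ A : Set (Fin d → ℝ), MeasurableSet A → Bornology.IsBounded A →
    ∀ k : ℕ, MeasurableSet {ω | (pts ω ∩ A).encard = k}
  poisson : ∀ A : Set (Fin d → ℝ), MeasurableSet A → Bornology.IsBounded A →
    ∀ k : ℕ, P {ω | (pts ω ∩ A).encard = k}
      = ENNReal.ofReal (Real.exp (-(∫ x in A, g x)) * (∫ x in A, g x) ^ k / k.factorial)
  indep : ∀ (n : ℕ) (A : Fin n → Set (Fin d → ℝ)),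
    (∀ i, MeasurableSet (A i)) → (∀ i, Bornology.IsBounded (A i)) →
    (Pairwise fun i j => Disjoint (A i) (A j)) →
    ∀ k : Fin n → ℕ,
      P (⋂ i, {ω | (pts ω ∩ A i).encard = k i})
        = ∏ i, P {ω | (pts ω ∩ A i).encard = k i}

/-- Upper semicontinuous envelope `f*`. -/
def upperEnv (d : ℕ) (f : (Fin d → ℝ) → ℝ) (x : Fin d → ℝ) : ℝ := limsup f (𝓝 x)

/-- Lower semicontinuous envelope `f_*`. -/
def lowerEnv (d : ℕ) (f : (Fin d → ℝ) → ℝ) (x : Fin d → ℝ) : ℝ := liminf f (𝓝 x)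

/-- The simplex `S_{x,v} = {z : z ≤ x, ⟨x-z,v⟩ ≤ 1}`. -/
def simplexS (d : ℕ) (x v : Fin d → ℝ) : Set (Fin d → ℝ) :=
  {z | z ≤ x ∧ ∑ i, (x i - z i) * v i ≤ 1}

/-- `u` is a nondecreasing viscosity solution of the problem (P):
`u_{x_1} ⋯ u_{x_d} = (c_d/d)^d f` in `(0,∞)^d`, `u = 0` on `∂ℝ^d_+`. -/
def IsNDViscSol (d : ℕ) (c : ℝ) (f u : (Fin d → ℝ) → ℝ) : Prop :=
  ContinuousOn u (Set.Ici 0) ∧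
  (∀ x y : Fin d → ℝ, 0 ≤ x → x ≤ y → u x ≤ u y) ∧
  (∀ x : Fin d → ℝ, 0 ≤ x → (∃ i, x i = 0) → u x = 0) ∧
  (∀ x₀ : Fin d → ℝ, (∀ i, 0 < x₀ i) →
    ∀ φ : (Fin d → ℝ) → ℝ, ContDiff ℝ ((⊤ : ℕ∞) : WithTop ℕ∞) φ →
      IsLocalMaxOn (fun y => u y - φ y) (Set.Ici 0) x₀ →
      ∏ i, fderiv ℝ φ x₀ (Pi.single i 1) ≤ (c / d) ^ d * upperEnv d f x₀) ∧
  (∀ x₀ : Fin d → ℝ, (∀ i, 0 < x₀ i) →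
    ∀ φ : (Fin d → ℝ) → ℝ, ContDiff ℝ ((⊤ : ℕ∞) : WithTop ℕ∞) φ →
      IsLocalMinOn (fun y => u y - φ y) (Set.Ici 0) x₀ →
      (c / d) ^ d * lowerEnv d f x₀ ≤ ∏ i, fderiv ℝ φ x₀ (Pi.single i 1))

/-! ### Expectations over random subsets with independent inclusions -/

section RandomSubset

variable {ι : Type*} [DecidableEq ι]

/-- The probability that the random subset of `s` containing each `i` independently with
probability `p i` equals `S`. -/
def subsetWeight (p : ι → ℝ) (s S : Finset ι) : ℝ :=
  (∏ i ∈ S, p i) * ∏ i ∈ s \ S, (1 - p i)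

/-- The expectation of `F` over the random subset of `s` containing each `i` independently with
probability `p i`. -/
def subsetExp (p : ι → ℝ) (s : Finset ι) (F : Finset ι → ℝ) : ℝ :=
  ∑ S ∈ s.powerset, subsetWeight p s S * F S

variable {p q : ι → ℝ} {s : Finset ι} {F G : Finset ι → ℝ}

theorem subsetWeight_nonneg (h0 : ∀ i, 0 ≤ p i) (h1 : ∀ i, p i ≤ 1) (S : Finset ι) :
    0 ≤ subsetWeight p s S :=
  mul_nonneg (Finset.prod_nonneg fun i _ => h0 i)
    (Finset.prod_nonneg fun i _ => sub_nonneg.2 (h1 i))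

theorem subsetExp_empty : subsetExp p ∅ F = F ∅ := by
  simp [subsetExp, subsetWeight]

theorem subsetExp_insert {a : ι} (ha : a ∉ s) :
    subsetExp p (insert a s) F
      = (1 - p a) * subsetExp p s F + p a * subsetExp p s (fun S => F (insert a S)) := by
  unfold subsetExp
  rw [Finset.sum_powerset_insert ha, Finset.mul_sum, Finset.mul_sum]
  congr 1
  · refine Finset.sum_congr rfl fun S hS => ?_
    have hS' := Finset.mem_powerset.1 hS
    have haS : a ∉ S := fun h => ha (hS' h)
    have : insert a s \ S = insert a (s \ S) := Finset.insert_sdiff_of_notMem s haS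
    rw [subsetWeight, subsetWeight, this, Finset.prod_insert (by simp [ha])]
    ring
  · refine Finset.sum_congr rfl fun S hS => ?_
    have hS' := Finset.mem_powerset.1 hS
    have haS : a ∉ S := fun h => ha (hS' h)
    have : insert a s \ insert a S = s \ S := by
      ext i
      simp only [Finset.mem_sdiff, Finset.mem_insert]
      by_cases h : i = a
      · subst h; simp [ha]
      · simp [h]
    rw [subsetWeight, subsetWeight, this, Finset.prod_insert haS]
    ring

theorem subsetExp_add :
    subsetExp p s (fun S => F S + G S) = subsetExp p s F + subsetExp p s G := by
  simp [subsetExp, mul_add, Finset.sum_add_distrib]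

theorem subsetExp_const_mul (a : ℝ) :
    subsetExp p s (fun S => a * F S) = a * subsetExp p s F := by
  unfold subsetExp
  rw [Finset.mul_sum]
  exact Finset.sum_congr rfl fun _ _ => by ring

theorem subsetExp_sum {κ : Type*} (t : Finset κ) (H : κ → Finset ι → ℝ) :
    subsetExp p s (fun S => ∑ k ∈ t, H k S) = ∑ k ∈ t, subsetExp p s (H k) := by
  unfold subsetExp
  rw [Finset.sum_comm]
  exact Finset.sum_congr rfl fun _ _ => Finset.mul_sum _ _ _

theorem subsetExp_mono (h0 : ∀ i, 0 ≤ p i) (h1 : ∀ i, p i ≤ 1) (h : ∀ S, F S ≤ G S) :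
    subsetExp p s F ≤ subsetExp p s G :=
  Finset.sum_le_sum fun S _ => mul_le_mul_of_nonneg_left (h S) (subsetWeight_nonneg h0 h1 S)

theorem subsetExp_const (a : ℝ) : subsetExp p s (fun _ => a) = a := by
  induction s using Finset.induction_on with
  | empty => simp [subsetExp_empty]
  | insert b s hb ih => rw [subsetExp_insert hb, ih]; ring

/-- Increasing the inclusion probabilities increases the expectation of a monotone function. -/
theorem subsetExp_le_of_monotone (hp0 : ∀ i, 0 ≤ p i) (hp1 : ∀ i, p i ≤ 1)
    (hq0 : ∀ i, 0 ≤ q i) (hq1 : ∀ i, q i ≤ 1) (hpq : ∀ i, p i ≤ q i) (hF : Monotone F) :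
    subsetExp p s F ≤ subsetExp q s F := by
  induction s using Finset.induction_on generalizing F with
  | empty => simp [subsetExp_empty]
  | insert a s ha ih =>
    have hF' : Monotone fun S => F (insert a S) :=
      fun S T h => hF (Finset.insert_subset_insert a h)
    have e0 := ih hF
    have e1 := ih hF'
    have e2 : subsetExp p s F ≤ subsetExp p s (fun S => F (insert a S)) :=
      subsetExp_mono hp0 hp1 fun S => hF (Finset.subset_insert a S)
    rw [subsetExp_insert ha, subsetExp_insert ha]
    have := hpq a
    have := hq0 a
    have := hq1 a
    nlinarith [mul_nonneg (sub_nonneg.2 (hpq a)) (sub_nonneg.2 e2),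
      mul_nonneg (sub_nonneg.2 (hq1 a)) (sub_nonneg.2 e0),
      mul_nonneg (hq0 a) (sub_nonneg.2 e1)]

theorem subsetExp_sq_sub (a : ℝ) :
    subsetExp p s (fun S => (F S - a) ^ 2)
      = subsetExp p s (fun S => F S ^ 2) - 2 * a * subsetExp p s F + a ^ 2 := by
  have : (fun S => (F S - a) ^ 2)
      = fun S => (F S ^ 2 + (-(2 * a)) * F S) + a ^ 2 := by
    funext S; ring
  rw [this, subsetExp_add, subsetExp_add, subsetExp_const_mul, subsetExp_const]
  ring

theorem sq_subsetExp_le (h0 : ∀ i, 0 ≤ p i) (h1 : ∀ i, p i ≤ 1) :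
    subsetExp p s F ^ 2 ≤ subsetExp p s (fun S => F S ^ 2) := by
  have h := subsetExp_sq_sub (p := p) (s := s) (F := F) (subsetExp p s F)
  have h2 : subsetExp p s (fun _ => (0 : ℝ))
      ≤ subsetExp p s (fun S => (F S - subsetExp p s F) ^ 2) :=
    subsetExp_mono h0 h1 fun S => sq_nonneg _
  rw [subsetExp_const] at h2
  nlinarith

/-- The Efron–Stein inequality. -/
theorem subsetExp_efron_stein (h0 : ∀ i, 0 ≤ p i) (h1 : ∀ i, p i ≤ 1) :
    subsetExp p s (fun S => F S ^ 2) - subsetExp p s F ^ 2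
      ≤ ∑ i ∈ s, subsetExp p s (fun S => (F S - F (S.erase i)) ^ 2) := by
  induction s using Finset.induction_on generalizing F with
  | empty => simp [subsetExp_empty]
  | insert a s ha ih =>
    have e0 := ih (F := F)
    have e1 := ih (F := fun S => F (insert a S))
    rw [Finset.sum_insert ha]
    have hsum : ∑ i ∈ s, subsetExp p (insert a s) (fun S => (F S - F (S.erase i)) ^ 2)
        = (1 - p a) * ∑ i ∈ s, subsetExp p s (fun S => (F S - F (S.erase i)) ^ 2)
          + p a * ∑ i ∈ s, subsetExp p s
              (fun S => (F (insert a S) - F (insert a (S.erase i))) ^ 2) := by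
      rw [Finset.mul_sum, Finset.mul_sum, ← Finset.sum_add_distrib]
      refine Finset.sum_congr rfl fun i hi => ?_
      have hia : a ≠ i := fun h => ha (h ▸ hi)
      rw [subsetExp_insert ha]
      simp only [Finset.erase_insert_of_ne hia]
    have hlast : p a * subsetExp p s (fun S => (F (insert a S) - F S) ^ 2)
        ≤ subsetExp p (insert a s) (fun S => (F S - F (S.erase a)) ^ 2) := by
      rw [subsetExp_insert ha]
      have h3 : subsetExp p s (fun _ => (0 : ℝ))
          ≤ subsetExp p s (fun S => (F S - F (S.erase a)) ^ 2) :=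
        subsetExp_mono h0 h1 fun S => sq_nonneg _
      rw [subsetExp_const] at h3
      have h4 : subsetExp p s (fun S => (F (insert a S) - F S) ^ 2)
          = subsetExp p s (fun S => (F (insert a S) - F ((insert a S).erase a)) ^ 2) := by
        refine Finset.sum_congr rfl fun S hS => ?_
        have haS : a ∉ S := fun h => ha (Finset.mem_powerset.1 hS h)
        dsimp only
        rw [Finset.erase_insert haS]
      rw [h4]
      have := mul_nonneg (sub_nonneg.2 (h1 a)) h3
      linarith
    have hJ := sq_subsetExp_le (s := s) (F := fun S => F (insert a S) - F S) h0 h1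
    have hsub : subsetExp p s (fun S => F (insert a S) - F S)
        = subsetExp p s (fun S => F (insert a S)) - subsetExp p s F := by
      have := subsetExp_add (p := p) (s := s) (F := fun S => F (insert a S) - F S) (G := F)
      simp only [sub_add_cancel] at this
      linarith
    rw [hsub] at hJ
    rw [hsum, subsetExp_insert ha, subsetExp_insert ha]
    set A := subsetExp p s (fun S => F (insert a S))
    set B := subsetExp p s F
    have hp := h0 a
    have hp1 := h1 a
    nlinarith [mul_le_mul_of_nonneg_left e0 (sub_nonneg.2 hp1), mul_le_mul_of_nonneg_left e1 hp,
      mul_le_mul_of_nonneg_left hJ hp, mul_nonneg (mul_nonneg hp hp) (sq_nonneg (A - B))]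

theorem subsetExp_chebyshev (h0 : ∀ i, 0 ≤ p i) (h1 : ∀ i, p i ≤ 1) {a : ℝ} (ha : 0 < a)
    (Q : Finset ι → Prop) [DecidablePred Q] (hQ : ∀ S, Q S → a ≤ |F S - subsetExp p s F|) :
    subsetExp p s (fun S => if Q S then 1 else 0)
      ≤ (subsetExp p s (fun S => F S ^ 2) - subsetExp p s F ^ 2) / a ^ 2 := by
  have h := subsetExp_sq_sub (p := p) (s := s) (F := F) (subsetExp p s F)
  rw [le_div_iff₀ (by positivity), mul_comm, ← subsetExp_const_mul]
  calc _ ≤ subsetExp p s (fun S => (F S - subsetExp p s F) ^ 2) := by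
        refine subsetExp_mono h0 h1 fun S => ?_
        split_ifs with hS
        · rw [mul_one, ← sq_abs (F S - _)]
          exact pow_le_pow_left₀ ha.le (hQ S hS) 2
        · simpa using sq_nonneg _
    _ ≤ _ := by rw [h]; nlinarith

theorem sum_powerset_subsetWeight {U : Finset ι} (hU : U ⊆ s) :
    ∑ S ∈ U.powerset, subsetWeight p s S = ∏ i ∈ s \ U, (1 - p i) := by
  have h := Finset.prod_add p (fun i => 1 - p i) U
  simp only [add_sub_cancel, Finset.prod_const_one] at h
  calc _ = ∑ S ∈ U.powerset, (∏ i ∈ s \ U, (1 - p i)) *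
        ((∏ i ∈ S, p i) * ∏ i ∈ U \ S, (1 - p i)) := by
        refine Finset.sum_congr rfl fun S hS => ?_
        have hS' := Finset.mem_powerset.1 hS
        have hd : s \ S = (s \ U) ∪ (U \ S) := by
          ext i
          simp only [Finset.mem_sdiff, Finset.mem_union]
          constructor
          · rintro ⟨a, b⟩
            by_cases hi : i ∈ U
            · exact Or.inr ⟨hi, b⟩
            · exact Or.inl ⟨a, hi⟩
          · rintro (⟨a, b⟩ | ⟨a, b⟩)
            · exact ⟨a, fun h => b (hS' h)⟩
            · exact ⟨hU a, b⟩
        have hdis : Disjoint (s \ U) (U \ S) :=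
          Finset.disjoint_left.2 fun i h1 h2 =>
            (Finset.mem_sdiff.1 h1).2 (Finset.mem_sdiff.1 h2).1
        rw [subsetWeight, hd, Finset.prod_union hdis]
        ring
    _ = _ := by rw [← Finset.mul_sum, ← h, mul_one]

/-- A function on finite sets is determined by its sums over down-sets. -/
theorem eq_of_sum_powerset_eq {w w' : Finset ι → ℝ}
    (h : ∀ U : Finset ι, ∑ S ∈ U.powerset, w S = ∑ S ∈ U.powerset, w' S)
    (U : Finset ι) : w U = w' U := by
  induction U using Finset.strongInduction with
  | H U ih =>
    have hU := h U
    rw [← Finset.insert_erase (Finset.mem_powerset_self U),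
      Finset.sum_insert (Finset.notMem_erase _ _), Finset.sum_insert (Finset.notMem_erase _ _),
      Finset.sum_congr rfl (fun S hS => ih S ?_)] at hU
    · linarith
    · have := Finset.mem_erase.1 hS
      exact (Finset.mem_powerset.1 this.2).ssubset_of_ne this.1

end RandomSubset

/-! ### Longest chains of a relation on a finite type -/

section ChainNumber

variable {ι : Type*}

open Classical in
/-- The maximal cardinality of an `r`-chain contained in `S`. -/
def chainNumber (r : ι → ι → Prop) (S : Finset ι) : ℕ :=
  (S.powerset.filter fun C : Finset ι => IsChain r (C : Set ι)).sup Finset.card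

variable {r : ι → ι → Prop}

theorem card_le_chainNumber {S C : Finset ι} (hCS : C ⊆ S) (hC : IsChain r (C : Set ι)) :
    C.card ≤ chainNumber r S := by
  classical
  exact Finset.le_sup (f := Finset.card)
    (Finset.mem_filter.2 ⟨Finset.mem_powerset.2 hCS, hC⟩)

theorem exists_card_eq_chainNumber (r : ι → ι → Prop) (S : Finset ι) :
    ∃ C ⊆ S, IsChain r (C : Set ι) ∧ C.card = chainNumber r S := by
  classical
  have hne : (S.powerset.filter fun C : Finset ι => IsChain r (C : Set ι)).Nonempty :=
    ⟨∅, by simp⟩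
  obtain ⟨C, hC, h⟩ := Finset.exists_mem_eq_sup _ hne Finset.card
  rw [Finset.mem_filter, Finset.mem_powerset] at hC
  refine ⟨C, hC.1, hC.2, ?_⟩
  unfold chainNumber
  convert h.symm

theorem chainNumber_mono : Monotone (chainNumber r) := fun S T h => by
  obtain ⟨C, hCS, hC, hcard⟩ := exists_card_eq_chainNumber r S
  exact hcard ▸ card_le_chainNumber (hCS.trans h) hC

theorem sum_sq_chainNumber_sub_erase_le [DecidableEq ι] (s S : Finset ι) :
    ∑ i ∈ s, ((chainNumber r S : ℝ) - chainNumber r (S.erase i)) ^ 2 ≤ chainNumber r S := by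
  obtain ⟨C, hCS, hC, hcard⟩ := exists_card_eq_chainNumber r S
  calc _ ≤ ∑ i ∈ s, if i ∈ C then (1 : ℝ) else 0 := by
        refine Finset.sum_le_sum fun i _ => ?_
        have hle : (chainNumber r (S.erase i) : ℝ) ≤ chainNumber r S := by
          exact_mod_cast chainNumber_mono (Finset.erase_subset i S)
        have hge : ((C.erase i).card : ℝ) ≤ chainNumber r (S.erase i) := by
          exact_mod_cast card_le_chainNumber (Finset.erase_subset_erase i hCS)
            (hC.mono (Finset.coe_subset.2 (Finset.erase_subset i C)))
        have hcard' : (C.card : ℝ) = chainNumber r S := by exact_mod_cast hcard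
        split_ifs with hi
        · have h1 : ((C.erase i).card : ℝ) + 1 = C.card := by
            exact_mod_cast Finset.card_erase_add_one hi
          have h2 : (chainNumber r S : ℝ) - chainNumber r (S.erase i) ≤ 1 := by linarith
          nlinarith
        · rw [Finset.erase_eq_of_notMem hi] at hge
          have : (chainNumber r S : ℝ) - chainNumber r (S.erase i) = 0 := by linarith
          simp [this]
    _ = ((s.filter (· ∈ C)).card : ℝ) := by rw [Finset.sum_boole]
    _ ≤ C.card := by
        exact_mod_cast Finset.card_le_card fun i hi => (Finset.mem_filter.1 hi).2
    _ = _ := by exact_mod_cast hcard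

theorem subsetExp_chainNumber_variance_le [DecidableEq ι] {p : ι → ℝ}
    (h0 : ∀ i, 0 ≤ p i) (h1 : ∀ i, p i ≤ 1)
    (s : Finset ι) :
    subsetExp p s (fun S => (chainNumber r S : ℝ) ^ 2)
        - subsetExp p s (fun S => chainNumber r S) ^ 2
      ≤ subsetExp p s (fun S => chainNumber r S) := by
  refine (subsetExp_efron_stein h0 h1).trans ?_
  rw [← subsetExp_sum]
  exact subsetExp_mono h0 h1 fun S => sum_sq_chainNumber_sub_erase_le s S

end ChainNumber

/-! ### Basic properties of `chainLength` -/

section ChainLength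

variable {d : ℕ} {A B : Set (Fin d → ℝ)}

theorem card_le_chainLength (hA : A.Finite) {C : Finset (Fin d → ℝ)} (hCA : ↑C ⊆ A)
    (hC : IsChain (· ≤ ·) (C : Set (Fin d → ℝ))) : C.card ≤ chainLength d A := by
  refine le_csSup ⟨hA.toFinset.card, ?_⟩ ⟨C, hCA, hC, rfl⟩
  rintro n ⟨C, hC, -, rfl⟩
  exact Finset.card_le_card fun x hx => hA.mem_toFinset.2 (hC hx)

theorem exists_card_eq_chainLength (hA : A.Finite) :
    ∃ C : Finset (Fin d → ℝ), ↑C ⊆ A ∧ IsChain (· ≤ ·) (C : Set (Fin d → ℝ)) ∧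
      C.card = chainLength d A := by
  have hne : {n : ℕ | ∃ C : Finset (Fin d → ℝ),
    ↑C ⊆ A ∧ IsChain (· ≤ ·) (C : Set (Fin d → ℝ)) ∧ C.card = n}.Nonempty :=
    ⟨0, ∅, by simp, by simp, rfl⟩
  refine Nat.sSup_mem hne ⟨hA.toFinset.card, ?_⟩
  rintro n ⟨C, hC, -, rfl⟩
  exact Finset.card_le_card fun x hx => hA.mem_toFinset.2 (hC hx)

theorem chainLength_mono (hB : B.Finite) (h : A ⊆ B) : chainLength d A ≤ chainLength d B := by
  obtain ⟨C, hCA, hC, hcard⟩ := exists_card_eq_chainLength (hB.subset h)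
  exact hcard ▸ card_le_chainLength hB (hCA.trans h) hC

theorem chainLength_empty : chainLength d (∅ : Set (Fin d → ℝ)) = 0 := by
  obtain ⟨C, hCA, hC, hcard⟩ := exists_card_eq_chainLength (d := d) Set.finite_empty
  rw [← hcard, Finset.card_eq_zero, ← Finset.coe_eq_empty]
  exact Set.subset_empty_iff.1 hCA

theorem chainLength_le_add (hA : A.Finite) (hB : B.Finite) {D : Set (Fin d → ℝ)}
    (hD : D ⊆ A ∪ B) : chainLength d D ≤ chainLength d A + chainLength d B := by
  classical
  obtain ⟨C, hCA, hC, hcard⟩ := exists_card_eq_chainLength ((hA.union hB).subset hD)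
  have h1 := card_le_chainLength (C := C.filter (· ∈ A)) hA (fun x hx => by simp_all)
    (hC.mono fun x hx => by simp_all)
  have h2 := card_le_chainLength (C := C.filter (· ∉ A)) hB
    (fun x hx => by
      have hx' := Finset.mem_filter.1 (Finset.mem_coe.1 hx)
      exact (hD (hCA hx'.1)).resolve_left hx'.2)
    (hC.mono fun x hx => by simp_all)
  have h3 := Finset.card_filter_add_card_filter_not (s := C) (· ∈ A)
  omega

theorem chainLength_le_add_sum {κ : Type*} (t : Finset κ) (E : κ → Set (Fin d → ℝ))
    (hA : A.Finite) (hE : ∀ k ∈ t, (E k).Finite) {D : Set (Fin d → ℝ)}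
    (hD : D ⊆ A ∪ ⋃ k ∈ t, E k) :
    chainLength d D ≤ chainLength d A + ∑ k ∈ t, chainLength d (E k) := by
  classical
  induction t using Finset.induction_on generalizing D with
  | empty => simpa using chainLength_mono hA (by simpa using hD)
  | insert b t hb ih =>
    have hfin : (A ∪ ⋃ k ∈ t, E k).Finite :=
      hA.union (Set.Finite.biUnion t.finite_toSet
        fun k hk => hE k (Finset.mem_insert_of_mem hk))
    have h1 := ih (fun k hk => hE k (Finset.mem_insert_of_mem hk)) subset_rfl
    have h2 := chainLength_le_add hfin (hE b (Finset.mem_insert_self b t)) (D := D)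
      (by
        intro x hx
        rcases hD hx with h | h
        · exact Or.inl (Or.inl h)
        · rw [Set.mem_iUnion₂] at h
          obtain ⟨k, hk, hxk⟩ := h
          rcases Finset.mem_insert.1 hk with rfl | hk
          · exact Or.inr hxk
          · exact Or.inl (Or.inr (Set.mem_biUnion hk hxk)))
    rw [Finset.sum_insert hb]
    omega

theorem chainLength_range_le {n : ℕ} (X : Fin n → Fin d → ℝ) :
    chainLength d (Set.range X) ≤ n := by
  classical
  obtain ⟨C, hCA, hC, hcard⟩ := exists_card_eq_chainLength (Set.finite_range X)
  rw [← hcard]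
  calc C.card ≤ (Finset.univ.image X).card :=
        Finset.card_le_card fun x hx => by simpa using hCA hx
    _ ≤ n := by simpa using Finset.card_image_le (s := Finset.univ) (f := X)

end ChainLength

/-! ### Subdivision of a box into a grid -/

/-- The index of the cell containing `x` when `[0,1]` is divided into `N + 1` equal cells. -/
def cellIdx (N : ℕ) (x : ℝ) : Fin (N + 1) := ⟨min ⌊(N + 1) * x⌋₊ N, by omega⟩

theorem cellIdx_mono (N : ℕ) : Monotone (cellIdx N) := fun x y h => by
  have : ⌊((N : ℝ) + 1) * x⌋₊ ≤ ⌊((N : ℝ) + 1) * y⌋₊ := Nat.floor_mono (by gcongr)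
  simp only [cellIdx, Fin.mk_le_mk]
  omega

theorem measurable_cellIdx (N : ℕ) : Measurable (cellIdx N) := by
  refine measurable_to_countable' fun j => ?_
  have h : Measurable fun x : ℝ => min ⌊((N : ℝ) + 1) * x⌋₊ N := by fun_prop
  have : cellIdx N ⁻¹' {j} = (fun x : ℝ => min ⌊((N : ℝ) + 1) * x⌋₊ N) ⁻¹' {j.val} := by
    ext x; simp [cellIdx, Fin.ext_iff]
  rw [this]
  exact h (measurableSet_singleton _)

theorem volume_cellIdx_fiber (N : ℕ) {a b : ℝ} (hab : a < b) (j : Fin (N + 1)) :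
    volume (Icc a b ∩ {x | cellIdx N ((x - a) / (b - a)) = j})
      = ENNReal.ofReal ((b - a) / (N + 1)) := by
  have hba : 0 < b - a := sub_pos.2 hab
  have hN : (0 : ℝ) < N + 1 := by positivity
  have hj : (j : ℝ) + 1 ≤ N + 1 := by
    have := j.isLt
    exact_mod_cast this
  set h := (b - a) / (N + 1) with hh
  have hh0 : 0 < h := by positivity
  have hbh : b = a + (N + 1) * h := by rw [hh]; field_simp; ring
  have hdiv : ∀ x, ((N : ℝ) + 1) * ((x - a) / (b - a)) = (x - a) / h := fun x => by
    rw [hh]; field_simp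
  apply le_antisymm
  · calc _ ≤ volume (Icc (a + j * h) (a + (j + 1) * h)) := by
          refine measure_mono ?_
          rintro x ⟨⟨hx1, hx2⟩, hx⟩
          simp only [cellIdx, mem_ofPred_eq, Fin.ext_iff, hdiv] at hx
          have hx0 : 0 ≤ (x - a) / h := div_nonneg (by linarith) hh0.le
          constructor
          · have h1 : (j : ℕ) ≤ ⌊(x - a) / h⌋₊ := by omega
            have h2 := (Nat.le_floor_iff hx0).1 h1
            rw [le_div_iff₀ hh0] at h2
            linarith
          · by_cases hjN : (j : ℕ) = N
            · have : (j : ℝ) = N := by exact_mod_cast hjN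
              rw [this]; linarith
            · have h1 : ⌊(x - a) / h⌋₊ = j := by omega
              have h2 := Nat.lt_floor_add_one ((x - a) / h)
              rw [h1, div_lt_iff₀ hh0] at h2
              linarith
      _ = _ := by rw [Real.volume_Icc]; congr 1; ring
  · calc _ = volume (Ico (a + j * h) (a + (j + 1) * h)) := by
          rw [Real.volume_Ico]; congr 1; ring
      _ ≤ _ := by
          refine measure_mono ?_
          rintro x ⟨hx1, hx2⟩
          have hj0 : (0 : ℝ) ≤ j := by positivity
          refine ⟨⟨by nlinarith, by nlinarith⟩, ?_⟩
          simp only [cellIdx, mem_ofPred_eq, Fin.ext_iff, hdiv]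
          have h1 : ⌊(x - a) / h⌋₊ = j := by
            rw [Nat.floor_eq_iff (div_nonneg (by nlinarith) hh0.le), le_div_iff₀ hh0,
              div_lt_iff₀ hh0]
            constructor <;> linarith
          have := j.isLt
          omega

section Grid

variable {d : ℕ}

/-- The multi-index of the cell containing `z` in the subdivision of `[a, b]` into
`(N + 1) ^ d` congruent cells. -/
def gridIdx (a b : Fin d → ℝ) (N : ℕ) (z : Fin d → ℝ) : Fin d → Fin (N + 1) :=
  fun k => cellIdx N ((z k - a k) / (b k - a k))

variable {a b : Fin d → ℝ} {N : ℕ}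

theorem gridIdx_mono (hab : ∀ k, a k < b k) (k : Fin d) {x y : Fin d → ℝ} (h : x k ≤ y k) :
    gridIdx a b N x k ≤ gridIdx a b N y k :=
  cellIdx_mono N (div_le_div_of_nonneg_right (by linarith) (sub_pos.2 (hab k)).le)

theorem measurable_gridIdx : Measurable (gridIdx a b N) :=
  measurable_pi_lambda _ fun k => (measurable_cellIdx N).comp (by fun_prop)

theorem volume_grid_cell (hab : ∀ k, a k < b k) (i : Fin d → Fin (N + 1)) :
    volume (Icc a b ∩ {z | gridIdx a b N z = i})
      = ENNReal.ofReal ((∏ k, (b k - a k)) / (N + 1) ^ d) := by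
  have h : Icc a b ∩ {z | gridIdx a b N z = i} = Set.pi univ fun k =>
      Icc (a k) (b k) ∩ {x | cellIdx N ((x - a k) / (b k - a k)) = i k} := by
    ext z
    simp only [mem_inter_iff, mem_Icc, Pi.le_def, mem_ofPred_eq, funext_iff, gridIdx, Set.mem_pi,
      mem_univ, true_imp_iff, forall_and]
  rw [h, volume_pi_pi]
  simp_rw [volume_cellIdx_fiber N (hab _)]
  rw [← ENNReal.ofReal_prod_of_nonneg fun k _ =>
    div_nonneg (sub_pos.2 (hab k)).le (by positivity), Finset.prod_div_distrib]
  simp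

theorem volume_grid_slab (hab : ∀ k, a k < b k) (k : Fin d) (j : Fin (N + 1)) :
    volume (Icc a b ∩ {z | gridIdx a b N z k = j})
      = ENNReal.ofReal ((∏ k, (b k - a k)) / (N + 1)) := by
  have h : Icc a b ∩ {z | gridIdx a b N z k = j} = Set.pi univ fun l =>
      if l = k then Icc (a l) (b l) ∩ {x | cellIdx N ((x - a l) / (b l - a l)) = j}
      else Icc (a l) (b l) := by
    ext z
    simp only [mem_inter_iff, mem_Icc, Pi.le_def, mem_ofPred_eq, gridIdx, Set.mem_pi, mem_univ,
      true_imp_iff]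
    constructor
    · rintro ⟨⟨h1, h2⟩, h3⟩ l
      split_ifs with hl
      · subst hl; exact ⟨⟨h1 l, h2 l⟩, h3⟩
      · exact ⟨h1 l, h2 l⟩
    · intro h
      have hz : ∀ l, z l ∈ Icc (a l) (b l) := fun l => by
        have := h l
        split_ifs at this with hl
        · exact this.1
        · exact this
      have hk := h k
      rw [if_pos rfl] at hk
      exact ⟨⟨fun l => (hz l).1, fun l => (hz l).2⟩, hk.2⟩
  rw [h, volume_pi_pi]
  have h2 : ∀ l, volume (if l = k then
      Icc (a l) (b l) ∩ {x | cellIdx N ((x - a l) / (b l - a l)) = j} else Icc (a l) (b l))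
      = ENNReal.ofReal ((b l - a l) * if l = k then ((N : ℝ) + 1)⁻¹ else 1) := fun l => by
    split_ifs
    · rw [volume_cellIdx_fiber N (hab l), div_eq_mul_inv]
    · rw [Real.volume_Icc, mul_one]
  simp_rw [h2]
  rw [← ENNReal.ofReal_prod_of_nonneg fun l _ =>
    mul_nonneg (sub_pos.2 (hab l)).le (by split_ifs <;> positivity), Finset.prod_mul_distrib]
  simp [div_eq_mul_inv]

open Classical in
/-- The set of grid cells occupied by points of `A`. -/
def occupied (a b : Fin d → ℝ) (N : ℕ) (A : Set (Fin d → ℝ)) : Finset (Fin d → Fin (N + 1)) :=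
  Finset.univ.filter (· ∈ gridIdx a b N '' A)

theorem mem_occupied {A : Set (Fin d → ℝ)} {i : Fin d → Fin (N + 1)} :
    i ∈ occupied a b N A ↔ ∃ z ∈ A, gridIdx a b N z = i := by
  simp [occupied]

theorem chainNumber_occupied_le (hab : ∀ k, a k < b k) {A : Set (Fin d → ℝ)} (hA : A.Finite) :
    chainNumber StrongLT (occupied a b N A) ≤ chainLength d A := by
  classical
  obtain ⟨C, hCS, hC, hcard⟩ := exists_card_eq_chainNumber StrongLT (occupied a b N A)
  choose! z hzA hz using fun i (hi : i ∈ C) => mem_occupied.1 (hCS hi)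
  have hinj : Set.InjOn z C := fun i hi j hj h => by rw [← hz i hi, ← hz j hj, h]
  rw [← hcard, ← Finset.card_image_of_injOn hinj]
  refine card_le_chainLength hA (by simpa [Set.subset_def] using hzA) ?_
  have key : ∀ i ∈ C, ∀ j ∈ C, StrongLT i j → z i ≤ z j := fun i hi j hj hij k => by
    by_contra hlt
    have := gridIdx_mono (N := N) hab k (not_le.1 hlt).le
    rw [hz i hi, hz j hj] at this
    exact absurd (hij k) (not_lt.2 this)
  rintro x hx y hy hxy
  rw [Finset.coe_image] at hx hy
  obtain ⟨i, hi, rfl⟩ := hx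
  obtain ⟨j, hj, rfl⟩ := hy
  have hij : i ≠ j := fun h => hxy (h ▸ rfl)
  exact (hC hi hj hij).imp (key i hi j hj) (key j hj i hi)

theorem chainLength_le_chainNumber_occupied (hab : ∀ k, a k < b k) (hd : 0 < d)
    {A : Set (Fin d → ℝ)} (hA : A.Finite)
    (hinj : ∀ x ∈ A, ∀ y ∈ A, ∀ k, gridIdx a b N x k = gridIdx a b N y k → x = y) :
    chainLength d A ≤ chainNumber StrongLT (occupied a b N A) := by
  classical
  obtain ⟨C, hCA, hC, hcard⟩ := exists_card_eq_chainLength hA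
  have hinj' : Set.InjOn (gridIdx a b N) C := fun x hx y hy h =>
    hinj x (hCA hx) y (hCA hy) ⟨0, hd⟩ (congrFun h _)
  rw [← hcard, ← Finset.card_image_of_injOn hinj']
  refine card_le_chainNumber (fun i hi => ?_) ?_
  · obtain ⟨x, hx, rfl⟩ := Finset.mem_image.1 hi
    exact mem_occupied.2 ⟨x, hCA hx, rfl⟩
  · have key : ∀ x ∈ C, ∀ y ∈ C, x ≠ y → x ≤ y →
        StrongLT (gridIdx a b N x) (gridIdx a b N y) := fun x hx y hy hne hxy k =>
      lt_of_le_of_ne (gridIdx_mono hab k (hxy k))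
        fun h => hne (hinj x (hCA hx) y (hCA hy) k h)
    rintro i hi j hj hij
    rw [Finset.coe_image] at hi hj
    obtain ⟨x, hx, rfl⟩ := hi
    obtain ⟨y, hy, rfl⟩ := hj
    have hxy : x ≠ y := fun h => hij (h ▸ rfl)
    exact (hC hx hy hxy).imp (key x hx y hy hxy) (key y hy x hx hxy.symm)

end Grid

/-! ### Independent uniform samples in the unit cube -/

section Sample

variable {d : ℕ}

/-- The uniform distribution on `[0,1]^d`. -/
abbrev cubeMeasure (d : ℕ) : Measure (Fin d → ℝ) := volume.restrict (Icc (0 : Fin d → ℝ) 1)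

instance : IsProbabilityMeasure (cubeMeasure d) :=
  ⟨by rw [Measure.restrict_apply_univ, Real.volume_Icc_pi]; simp⟩

/-- The law of `n` independent uniform points of `[0,1]^d`. -/
abbrev sampleMeasure (d n : ℕ) : Measure (Fin n → Fin d → ℝ) :=
  Measure.pi fun _ => cubeMeasure d

theorem cubeMeasure_real_gridIdx_mem (N : ℕ) (U : Finset (Fin d → Fin (N + 1))) :
    (cubeMeasure d).real {z | gridIdx 0 1 N z ∈ U} = U.card / ((N : ℝ) + 1) ^ d := by
  have h := sum_measureReal_preimage_singleton (μ := cubeMeasure d) U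
    (f := gridIdx 0 1 N) fun y _ => measurable_gridIdx (measurableSet_singleton y)
  have h2 : ∀ i : Fin d → Fin (N + 1), (cubeMeasure d).real (gridIdx 0 1 N ⁻¹' {i})
      = 1 / ((N : ℝ) + 1) ^ d := fun i => by
    rw [measureReal_def, Measure.restrict_apply (measurable_gridIdx (measurableSet_singleton i)),
      inter_comm]
    have := volume_grid_cell (a := (0 : Fin d → ℝ)) (b := 1) (N := N) (by simp) i
    have h3 : gridIdx (0 : Fin d → ℝ) 1 N ⁻¹' {i} = {z | gridIdx 0 1 N z = i} := by
      ext; simp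
    rw [h3, this, ENNReal.toReal_ofReal (by simp; positivity)]
    simp
  simp_rw [h2] at h
  simp only [Finset.sum_const, nsmul_eq_mul] at h
  rw [show {z | gridIdx 0 1 N z ∈ U} = gridIdx 0 1 N ⁻¹' (U : Set (Fin d → Fin (N + 1))) by
    ext; simp, ← h]
  ring

theorem cubeMeasure_gridIdx_eq (N : ℕ) (k : Fin d) (j : Fin (N + 1)) :
    cubeMeasure d {z | gridIdx 0 1 N z k = j} = ENNReal.ofReal (1 / ((N : ℝ) + 1)) := by
  have hm : MeasurableSet {z : Fin d → ℝ | gridIdx 0 1 N z k = j} :=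
    ((measurable_pi_apply k).comp measurable_gridIdx) (measurableSet_singleton j)
  rw [Measure.restrict_apply hm, inter_comm,
    volume_grid_slab (a := (0 : Fin d → ℝ)) (b := 1) (N := N) (by simp) k j]
  simp

theorem measurable_gridIdx_sample (N n : ℕ) :
    Measurable fun (X : Fin n → Fin d → ℝ) (j : Fin n) => gridIdx 0 1 N (X j) :=
  measurable_pi_lambda _ fun j => measurable_gridIdx.comp (measurable_pi_apply j)

theorem measurableSet_occupied_sample (N n : ℕ) (S : Finset (Fin d → Fin (N + 1))) :
    MeasurableSet {X : Fin n → Fin d → ℝ | occupied 0 1 N (range X) = S} := by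
  classical
  have : {X : Fin n → Fin d → ℝ | occupied 0 1 N (range X) = S}
      = (fun (X : Fin n → Fin d → ℝ) (j : Fin n) => gridIdx 0 1 N (X j)) ⁻¹'
        {g | Finset.univ.image g = S} := by
    ext X
    have h : occupied 0 1 N (range X) = Finset.univ.image fun j => gridIdx 0 1 N (X j) := by
      ext i; simp [mem_occupied]
    simp [h]
  rw [this]
  exact measurable_gridIdx_sample N n (Set.toFinite _).measurableSet

/-- The probability that the cells occupied by `n` independent uniform points are exactly `S`. -/
def occupiedProb (N n : ℕ) (S : Finset (Fin d → Fin (N + 1))) : ℝ :=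
  (sampleMeasure d n).real {X | occupied 0 1 N (range X) = S}

theorem sum_powerset_occupiedProb (N n : ℕ) (U : Finset (Fin d → Fin (N + 1))) :
    ∑ S ∈ U.powerset, occupiedProb N n S = (U.card / ((N : ℝ) + 1) ^ d) ^ n := by
  have h := sum_measureReal_preimage_singleton (μ := sampleMeasure d n) U.powerset
    (f := fun X => occupied 0 1 N (range X)) fun S _ => measurableSet_occupied_sample N n S
  have h1 : ∀ S, (fun X : Fin n → Fin d → ℝ => occupied 0 1 N (range X)) ⁻¹' {S}
      = {X | occupied 0 1 N (range X) = S} := fun S => by ext; simp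
  simp only [h1] at h
  unfold occupiedProb
  rw [h]
  have h2 : (fun X : Fin n → Fin d → ℝ => occupied 0 1 N (range X)) ⁻¹' (U.powerset : Set _)
      = Set.pi univ fun _ => {z | gridIdx 0 1 N z ∈ U} := by
    ext X
    simp only [mem_preimage, Finset.mem_coe, Finset.mem_powerset, Set.mem_pi, mem_univ,
      true_imp_iff, Finset.subset_iff, mem_occupied, mem_range, mem_ofPred_eq]
    constructor
    · exact fun h j => h ⟨X j, ⟨j, rfl⟩, rfl⟩
    · rintro h _ ⟨_, ⟨j, rfl⟩, rfl⟩
      exact h j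
  rw [h2, measureReal_def, Measure.pi_pi, ENNReal.toReal_prod, ← cubeMeasure_real_gridIdx_mem]
  simp [measureReal_def]

theorem integral_occupied_sample (N n : ℕ) (F : Finset (Fin d → Fin (N + 1)) → ℝ) :
    ∫ X, F (occupied 0 1 N (range X)) ∂(sampleMeasure d n) = ∑ S, occupiedProb N n S * F S := by
  have h : ∀ X : Fin n → Fin d → ℝ, F (occupied 0 1 N (range X))
      = ∑ S, {X | occupied 0 1 N (range X) = S}.indicator (fun _ => F S) X := fun X => by
    simp [Set.indicator_apply]
  simp_rw [h]
  rw [integral_finsetSum _ fun S _ =>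
    (integrable_const (F S)).indicator (measurableSet_occupied_sample N n S)]
  refine Finset.sum_congr rfl fun S _ => ?_
  rw [integral_indicator_const _ (measurableSet_occupied_sample N n S), smul_eq_mul]
  rfl

theorem measurable_chainLength_range (n : ℕ) :
    Measurable fun X : Fin n → Fin d → ℝ => chainLength d (range X) := by
  classical
  have h : ∀ X : Fin n → Fin d → ℝ, chainLength d (range X)
      = Finset.univ.sup fun J : Finset (Fin n) =>
        if ∀ i ∈ J, ∀ j ∈ J, i ≠ j → X i ≠ X j ∧ (X i ≤ X j ∨ X j ≤ X i) then J.card else 0 := by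
    intro X
    apply le_antisymm
    · obtain ⟨C, hCA, hC, hcard⟩ := exists_card_eq_chainLength (Set.finite_range X)
      rcases isEmpty_or_nonempty (Fin n) with hn | hn
      · rw [Set.range_eq_empty, chainLength_empty]
        exact Nat.zero_le _
      choose! g hg using fun x (hx : x ∈ C) => hCA hx
      have hinj : Set.InjOn g C := fun x hx y hy h => by rw [← hg x hx, ← hg y hy, h]
      rw [← hcard, ← Finset.card_image_of_injOn hinj]
      refine le_trans (le_of_eq ?_) (Finset.le_sup (Finset.mem_univ (C.image g)))
      rw [if_pos]
      simp only [Finset.mem_image]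
      rintro _ ⟨x, hx, rfl⟩ _ ⟨y, hy, rfl⟩ hxy
      have hne : x ≠ y := fun h => hxy (h ▸ rfl)
      rw [hg x hx, hg y hy]
      exact ⟨hne, hC hx hy hne⟩
    · refine Finset.sup_le fun J _ => ?_
      split_ifs with hJ
      · have hinj : Set.InjOn X J := fun i hi j hj h => by
          by_contra hne
          exact (hJ i hi j hj hne).1 h
        rw [← Finset.card_image_of_injOn hinj]
        refine card_le_chainLength (Set.finite_range X) (by simp [Set.subset_def]) ?_
        rintro x hx y hy hxy
        rw [Finset.coe_image] at hx hy
        obtain ⟨i, hi, rfl⟩ := hx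
        obtain ⟨j, hj, rfl⟩ := hy
        exact (hJ i hi j hj fun h => hxy (h ▸ rfl)).2
      · exact Nat.zero_le _
  simp_rw [h]
  have hle : ∀ i j : Fin n, MeasurableSet {X : Fin n → Fin d → ℝ | X i ≤ X j} := fun i j =>
    measurableSet_le (measurable_pi_apply i) (measurable_pi_apply j)
  have heq : ∀ i j : Fin n, MeasurableSet {X : Fin n → Fin d → ℝ | X i = X j} := fun i j =>
    measurableSet_eq_fun (measurable_pi_apply i) (measurable_pi_apply j)
  have hsup : ∀ (T : Finset (Finset (Fin n))) (g : Finset (Fin n) → (Fin n → Fin d → ℝ) → ℕ),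
      (∀ J, Measurable (g J)) → Measurable fun X => T.sup fun J => g J X := by
    intro T g hg
    induction T using Finset.induction_on with
    | empty => exact measurable_const
    | insert J T _ ih =>
      simp only [Finset.sup_insert]
      exact (hg J).sup ih
  refine hsup _ _ fun J => Measurable.ite ?_ measurable_const measurable_const
  have : {X : Fin n → Fin d → ℝ | ∀ i ∈ J, ∀ j ∈ J, i ≠ j →
      X i ≠ X j ∧ (X i ≤ X j ∨ X j ≤ X i)} = ⋂ i ∈ J, ⋂ j ∈ J, ⋂ (_ : i ≠ j),
      ({X | X i = X j}ᶜ ∩ ({X | X i ≤ X j} ∪ {X | X j ≤ X i})) := by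
    ext X; simp
  rw [this]
  exact J.measurableSet_biInter fun i _ => J.measurableSet_biInter fun j _ =>
    MeasurableSet.iInter fun _ => (heq i j).compl.inter ((hle i j).union (hle j i))

theorem integrable_chainLength_range (n : ℕ) :
    Integrable (fun X : Fin n → Fin d → ℝ => (chainLength d (range X) : ℝ))
      (sampleMeasure d n) := by
  refine Integrable.of_bound (C := n)
    ((measurable_from_top.comp (measurable_chainLength_range n)).aestronglyMeasurable)
    (ae_of_all _ fun X => ?_)
  simpa using chainLength_range_le X

theorem sampleMeasure_gridIdx_coincide_le (N n : ℕ) {i j : Fin n} (hij : i ≠ j) (k : Fin d) :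
    sampleMeasure d n {X | gridIdx 0 1 N (X i) k = gridIdx 0 1 N (X j) k}
      ≤ ENNReal.ofReal (1 / ((N : ℝ) + 1)) := by
  classical
  have hsub : {X : Fin n → Fin d → ℝ | gridIdx 0 1 N (X i) k = gridIdx 0 1 N (X j) k}
      ⊆ ⋃ a : Fin (N + 1), Set.pi univ fun l =>
        if l ∈ ({i, j} : Finset (Fin n)) then {z | gridIdx 0 1 N z k = a} else univ := by
    intro X hX
    refine mem_iUnion.2 ⟨gridIdx 0 1 N (X i) k, fun l _ => ?_⟩
    dsimp only
    split_ifs with hl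
    · rcases Finset.mem_insert.1 hl with rfl | hl
      · rfl
      · rw [Finset.mem_singleton.1 hl]
        exact (Eq.symm hX : gridIdx 0 1 N (X j) k = gridIdx 0 1 N (X i) k)
    · trivial
  refine (measure_mono hsub).trans ((measure_iUnion_fintype_le _ _).trans ?_)
  have hx : ∀ a : Fin (N + 1), sampleMeasure d n (Set.pi univ fun l =>
        if l ∈ ({i, j} : Finset (Fin n)) then {z | gridIdx 0 1 N z k = a} else univ)
      = ENNReal.ofReal (1 / ((N : ℝ) + 1)) ^ 2 := fun a => by
    rw [Measure.pi_pi]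
    have : ∀ l, cubeMeasure d (if l ∈ ({i, j} : Finset (Fin n)) then
        {z | gridIdx 0 1 N z k = a} else univ)
        = if l ∈ ({i, j} : Finset (Fin n)) then ENNReal.ofReal (1 / ((N : ℝ) + 1)) else 1 :=
      fun l => by
        split_ifs
        · exact cubeMeasure_gridIdx_eq N k a
        · exact measure_univ
    simp_rw [this]
    rw [Finset.prod_ite_mem, Finset.univ_inter, Finset.prod_const, Finset.card_pair hij]
  simp_rw [hx]
  rw [Finset.sum_const, Finset.card_univ, Fintype.card_fin, nsmul_eq_mul, ← ENNReal.ofReal_natCast,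
    ← ENNReal.ofReal_pow (by positivity), ← ENNReal.ofReal_mul (by positivity)]
  refine ENNReal.ofReal_le_ofReal (le_of_eq ?_)
  push_cast
  field_simp

theorem abs_integral_chainNumber_sub_BWexpect_le (hd : 0 < d) (N n : ℕ) :
    |∫ X, (chainNumber StrongLT (occupied 0 1 N (range X)) : ℝ) ∂(sampleMeasure d n)
      - BWexpect d n| ≤ d * n ^ 3 / ((N : ℝ) + 1) := by
  set ν := sampleMeasure d n
  set bad : Set (Fin n → Fin d → ℝ) := {X | ∃ i j, i ≠ j ∧ ∃ k,
    gridIdx 0 1 N (X i) k = gridIdx 0 1 N (X j) k}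
  have hbadeq : bad = ⋃ q ∈ (Finset.univ.filter fun q : (Fin n × Fin n) × Fin d =>
      q.1.1 ≠ q.1.2), {X | gridIdx 0 1 N (X q.1.1) q.2 = gridIdx 0 1 N (X q.1.2) q.2} := by
    ext X
    simp only [bad, mem_ofPred_eq, mem_iUnion, Finset.mem_filter, Finset.mem_univ, true_and,
      exists_prop, Prod.exists]
    constructor
    · rintro ⟨i, j, hij, k, h⟩; exact ⟨i, j, k, hij, h⟩
    · rintro ⟨i, j, k, hij, h⟩; exact ⟨i, j, hij, k, h⟩
  have hbadm : MeasurableSet bad := by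
    rw [hbadeq]
    refine Finset.measurableSet_biUnion _ fun q _ => ?_
    exact measurableSet_eq_fun
      ((measurable_pi_apply q.2).comp (measurable_gridIdx.comp (measurable_pi_apply q.1.1)))
      ((measurable_pi_apply q.2).comp (measurable_gridIdx.comp (measurable_pi_apply q.1.2)))
  have hbad : ν.real bad ≤ d * n ^ 2 / ((N : ℝ) + 1) := by
    refine ENNReal.toReal_le_of_le_ofReal (by positivity) ?_
    rw [hbadeq]
    refine (measure_biUnion_finset_le _ _).trans ?_
    refine (Finset.sum_le_sum fun q hq => sampleMeasure_gridIdx_coincide_le N n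
      (Finset.mem_filter.1 hq).2 q.2).trans ?_
    rw [Finset.sum_const, nsmul_eq_mul, ← ENNReal.ofReal_natCast,
      ← ENNReal.ofReal_mul (by positivity)]
    refine ENNReal.ofReal_le_ofReal ?_
    rw [mul_one_div]
    refine div_le_div_of_nonneg_right ?_ (by positivity)
    have : (Finset.univ.filter fun q : (Fin n × Fin n) × Fin d => q.1.1 ≠ q.1.2).card
        ≤ n * n * d := by
      simpa using Finset.card_filter_le (Finset.univ : Finset ((Fin n × Fin n) × Fin d))
        fun q => q.1.1 ≠ q.1.2
    have : ((Finset.univ.filter fun q : (Fin n × Fin n) × Fin d => q.1.1 ≠ q.1.2).card : ℝ)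
        ≤ n * n * d := by exact_mod_cast this
    linarith
  have hle : ∀ X : Fin n → Fin d → ℝ,
      (chainNumber StrongLT (occupied 0 1 N (range X)) : ℝ) ≤ chainLength d (range X) := fun X => by
    exact_mod_cast chainNumber_occupied_le (by simp) (Set.finite_range X)
  have hInt : Integrable (fun X : Fin n → Fin d → ℝ =>
      (chainNumber StrongLT (occupied 0 1 N (range X)) : ℝ)) ν := by
    refine Integrable.of_bound (C := n) ?_ (ae_of_all _ fun X => ?_)
    · refine Measurable.aestronglyMeasurable ?_
      have : Measurable fun X : Fin n → Fin d → ℝ =>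
          chainNumber StrongLT (occupied 0 1 N (range X)) := by
        refine measurable_to_countable' fun m => ?_
        have : (fun X : Fin n → Fin d → ℝ =>
            chainNumber StrongLT (occupied 0 1 N (range X))) ⁻¹' {m}
            = ⋃ S ∈ (Set.ofPred fun S => chainNumber StrongLT S = m),
              {X | occupied 0 1 N (range X) = S} := by
          ext X; simp
        rw [this]
        exact (Set.toFinite _).measurableSet_biUnion
          fun S _ => measurableSet_occupied_sample N n S
      exact measurable_from_top.comp this
    · have h1 := hle X
      have h2 : (chainLength d (range X) : ℝ) ≤ n := by exact_mod_cast chainLength_range_le X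
      simpa using h1.trans h2
  have hIntRange := integrable_chainLength_range (d := d) n
  rw [abs_sub_comm, BWexpect, ← integral_sub hIntRange hInt, abs_of_nonneg
    (integral_nonneg fun X => sub_nonneg.2 (hle X))]
  calc _ ≤ ∫ X, bad.indicator (fun _ => (n : ℝ)) X ∂ν := by
        refine integral_mono (hIntRange.sub hInt) ((integrable_const _).indicator hbadm) fun X => ?_
        dsimp only
        by_cases hX : X ∈ bad
        · rw [Set.indicator_of_mem hX]
          have h2 : (chainLength d (range X) : ℝ) ≤ n := by exact_mod_cast chainLength_range_le X
          have h3 : (0 : ℝ) ≤ chainNumber StrongLT (occupied 0 1 N (range X)) := by positivity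
          linarith
        · rw [Set.indicator_of_notMem hX, sub_nonpos]
          refine Nat.cast_le.2 (chainLength_le_chainNumber_occupied (by simp) hd
            (Set.finite_range X) ?_)
          rintro _ ⟨i, rfl⟩ _ ⟨j, rfl⟩ k h
          by_contra hne
          exact hX ⟨i, j, fun h => hne (h ▸ rfl), k, h⟩
    _ = ν.real bad * n := by rw [integral_indicator_const _ hbadm, smul_eq_mul]
    _ ≤ d * n ^ 2 / ((N : ℝ) + 1) * n := by gcongr
    _ = _ := by ring

end Sample

/-! ### Poissonized chain lengths -/

/-- The mass at `n` of the Poisson distribution with mean `m`. -/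
def poissonWeight (m : ℝ) (n : ℕ) : ℝ := Real.exp (-m) * m ^ n / n.factorial

theorem poissonWeight_nonneg {m : ℝ} (hm : 0 ≤ m) (n : ℕ) : 0 ≤ poissonWeight m n := by
  unfold poissonWeight; positivity

theorem hasSum_poissonWeight_mul_pow (m x : ℝ) :
    HasSum (fun n => poissonWeight m n * x ^ n) (Real.exp (-m) * Real.exp (m * x)) := by
  have h := (NormedSpace.expSeries_div_hasSum_exp (m * x)).mul_left (Real.exp (-m))
  rw [← Real.exp_eq_exp_ℝ] at h
  refine h.congr_fun fun n => ?_
  simp only [poissonWeight, mul_pow]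
  ring

theorem hasSum_poissonWeight (m : ℝ) : HasSum (poissonWeight m) 1 := by
  have h := hasSum_poissonWeight_mul_pow m 1
  simpa [← Real.exp_add] using h

theorem poissonWeight_succ (m : ℝ) (n : ℕ) :
    poissonWeight m (n + 1) * ((n + 1 : ℕ) : ℝ) = m * poissonWeight m n := by
  unfold poissonWeight
  rw [Nat.factorial_succ]
  push_cast
  field_simp
  ring

theorem hasSum_poissonWeight_mul_natCast (m : ℝ) :
    HasSum (fun n => poissonWeight m n * (n : ℝ)) m := by
  rw [← hasSum_nat_add_iff' 1]
  simp only [poissonWeight_succ]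
  simpa using (hasSum_poissonWeight m).mul_left m

theorem hasSum_poissonWeight_mul_natCast_sq (m : ℝ) :
    HasSum (fun n => poissonWeight m n * (n : ℝ) ^ 2) (m ^ 2 + m) := by
  rw [← hasSum_nat_add_iff' 1]
  have h := ((hasSum_poissonWeight_mul_natCast m).add (hasSum_poissonWeight m)).mul_left m
  have h2 : ∀ n : ℕ, poissonWeight m (n + 1) * ((n + 1 : ℕ) : ℝ) ^ 2
      = m * (poissonWeight m n * n + poissonWeight m n) := fun n => by
    rw [sq, ← mul_assoc, poissonWeight_succ]; push_cast; ring
  simp only [h2]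
  have h3 : m ^ 2 + m - ∑ i ∈ Finset.range 1, poissonWeight m i * (i : ℝ) ^ 2 = m * (m + 1) := by
    simp only [Finset.range_one, Finset.sum_singleton, Nat.cast_zero]
    ring
  rw [h3]
  exact h

theorem hasSum_poissonWeight_mul_sub_sq (m : ℝ) :
    HasSum (fun n => poissonWeight m n * ((n : ℝ) - m) ^ 2) m := by
  have h := ((hasSum_poissonWeight_mul_natCast_sq m).sub
    ((hasSum_poissonWeight_mul_natCast m).mul_left (2 * m))).add
    ((hasSum_poissonWeight m).mul_left (m ^ 2))
  have h2 : m ^ 2 + m - 2 * m * m + m ^ 2 * 1 = m := by ring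
  rw [h2] at h
  refine h.congr_fun fun n => ?_
  ring

theorem summable_poissonWeight_mul_cube {m : ℝ} (hm : 0 ≤ m) :
    Summable fun n => poissonWeight m n * (n : ℝ) ^ 3 := by
  refine Summable.of_nonneg_of_le (fun n => mul_nonneg (poissonWeight_nonneg hm n) (by positivity))
    (fun n => ?_) ((hasSum_poissonWeight_mul_pow m (Real.exp 1)).summable.mul_left 6)
  have h := Real.pow_div_factorial_le_exp (n : ℝ) (by positivity) 3
  have h2 : (n : ℝ) ^ 3 ≤ 6 * Real.exp 1 ^ n := by
    rw [← Real.exp_nat_mul, mul_one]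
    have : ((3 : ℕ).factorial : ℝ) = 6 := by norm_num [Nat.factorial]
    rw [this, div_le_iff₀ (by norm_num)] at h
    linarith
  calc poissonWeight m n * (n : ℝ) ^ 3 ≤ poissonWeight m n * (6 * Real.exp 1 ^ n) :=
        mul_le_mul_of_nonneg_left h2 (poissonWeight_nonneg hm n)
    _ = _ := by ring

variable {d : ℕ}

/-- Occupation probability of a cell of the `N`-th grid for a homogeneous Poisson process with
total mass `m`. -/
def cellProb (d N : ℕ) (m : ℝ) : ℝ := 1 - Real.exp (-(m / ((N : ℝ) + 1) ^ d))

theorem cellProb_nonneg {m : ℝ} (hm : 0 ≤ m) (N : ℕ) : 0 ≤ cellProb d N m := by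
  unfold cellProb
  have : Real.exp (-(m / ((N : ℝ) + 1) ^ d)) ≤ 1 := Real.exp_le_one_iff.2 (by
    have : 0 ≤ m / ((N : ℝ) + 1) ^ d := by positivity
    linarith)
  linarith

theorem cellProb_le_one (m : ℝ) (N : ℕ) : cellProb d N m ≤ 1 := by
  unfold cellProb
  have := Real.exp_pos (-(m / ((N : ℝ) + 1) ^ d))
  linarith

theorem hasSum_poissonWeight_mul_occupiedProb (m : ℝ) (hm : 0 ≤ m) (N : ℕ)
    (S : Finset (Fin d → Fin (N + 1))) :
    HasSum (fun n => poissonWeight m n * occupiedProb N n S)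
      (subsetWeight (fun _ => cellProb d N m) Finset.univ S) := by
  have hnn : ∀ n (S : Finset (Fin d → Fin (N + 1))), 0 ≤ occupiedProb N n S := fun n S =>
    measureReal_nonneg
  have hsum : ∀ S : Finset (Fin d → Fin (N + 1)),
      Summable fun n => poissonWeight m n * occupiedProb N n S := fun S => by
    refine Summable.of_nonneg_of_le
      (fun n => mul_nonneg (poissonWeight_nonneg hm n) (hnn n S)) (fun n => ?_)
      (hasSum_poissonWeight m).summable
    exact mul_le_of_le_one_right (poissonWeight_nonneg hm n) measureReal_le_one
  suffices h : ∑' n, poissonWeight m n * occupiedProb N n S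
      = subsetWeight (fun _ => cellProb d N m) Finset.univ S by
    rw [← h]; exact (hsum S).hasSum
  revert S
  refine eq_of_sum_powerset_eq fun U => ?_
  rw [← Summable.tsum_finsetSum fun S _ => hsum S]
  simp_rw [← Finset.mul_sum]
  rw [sum_powerset_subsetWeight (Finset.subset_univ U)]
  simp_rw [sum_powerset_occupiedProb]
  rw [(hasSum_poissonWeight_mul_pow m _).tsum_eq]
  have hM : (0 : ℝ) < ((N : ℝ) + 1) ^ d := by positivity
  simp only [cellProb, sub_sub_cancel, Finset.prod_const]
  rw [← Real.exp_nat_mul, ← Real.exp_add, Finset.card_sdiff_of_subset (Finset.subset_univ U),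
    Nat.cast_sub (Finset.card_le_card (Finset.subset_univ U))]
  congr 1
  simp
  field_simp
  ring

theorem hasSum_poissonWeight_mul_integral_chainNumber {m : ℝ} (hm : 0 ≤ m) (N : ℕ) :
    HasSum (fun n => poissonWeight m n *
        ∫ X, (chainNumber StrongLT (occupied 0 1 N (range X)) : ℝ) ∂(sampleMeasure d n))
      (subsetExp (fun _ => cellProb d N m) Finset.univ
        fun S : Finset (Fin d → Fin (N + 1)) => (chainNumber StrongLT S : ℝ)) := by
  have h := hasSum_sum (s := (Finset.univ : Finset (Fin d → Fin (N + 1))).powerset) fun S _ =>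
    (hasSum_poissonWeight_mul_occupiedProb m hm N S).mul_right (chainNumber StrongLT S : ℝ)
  refine h.congr_fun fun n => ?_
  rw [integral_occupied_sample N n fun S => (chainNumber StrongLT S : ℝ), Finset.mul_sum,
    Finset.powerset_univ]
  exact Finset.sum_congr rfl fun S _ => by ring

theorem summable_poissonWeight_mul_BWexpect (hd : 0 < d) {m : ℝ} (hm : 0 ≤ m) :
    Summable fun n => poissonWeight m n * BWexpect d n := by
  have h := (hasSum_poissonWeight_mul_integral_chainNumber (d := d) hm 0).summable
  have h2 : Summable fun n => poissonWeight m n *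
      (∫ X, (chainNumber StrongLT (occupied 0 1 0 (range X)) : ℝ) ∂(sampleMeasure d n)
        - BWexpect d n) := by
    refine Summable.of_norm_bounded ((summable_poissonWeight_mul_cube hm).mul_left (d : ℝ))
      fun n => ?_
    rw [Real.norm_eq_abs, abs_mul, abs_of_nonneg (poissonWeight_nonneg hm n)]
    have := abs_integral_chainNumber_sub_BWexpect_le hd 0 n
    simp only [CharP.cast_eq_zero, zero_add, div_one] at this
    calc _ ≤ poissonWeight m n * (d * n ^ 3) :=
          mul_le_mul_of_nonneg_left this (poissonWeight_nonneg hm n)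
      _ = _ := by ring
  refine (h.sub h2).congr fun n => ?_
  ring

theorem tendsto_subsetExp_chainNumber (hd : 0 < d) {m : ℝ} (hm : 0 ≤ m) :
    Tendsto (fun N : ℕ => subsetExp (fun _ => cellProb d N m) Finset.univ
        fun S : Finset (Fin d → Fin (N + 1)) => (chainNumber StrongLT S : ℝ)) atTop
      (𝓝 (∑' n, poissonWeight m n * BWexpect d n)) := by
  rw [tendsto_iff_dist_tendsto_zero]
  refine squeeze_zero (g := fun N : ℕ =>
    (d * ∑' n, poissonWeight m n * (n : ℝ) ^ 3) * (1 / ((N : ℝ) + 1))) (fun _ => dist_nonneg)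
    (fun N => ?_) ?_
  · rw [Real.dist_eq]
    have h := (hasSum_poissonWeight_mul_integral_chainNumber (d := d) hm N).sub
      (summable_poissonWeight_mul_BWexpect hd hm).hasSum
    rw [← h.tsum_eq, ← Real.norm_eq_abs]
    refine tsum_of_norm_bounded (f := fun n => poissonWeight m n *
      ∫ X, (chainNumber StrongLT (occupied 0 1 N (range X)) : ℝ) ∂(sampleMeasure d n)
      - poissonWeight m n * BWexpect d n)
      (((summable_poissonWeight_mul_cube hm).hasSum.mul_left (d : ℝ)).mul_right
        (1 / ((N : ℝ) + 1))) fun n => ?_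
    rw [← mul_sub, Real.norm_eq_abs, abs_mul, abs_of_nonneg (poissonWeight_nonneg hm n)]
    calc _ ≤ poissonWeight m n * (d * n ^ 3 / ((N : ℝ) + 1)) :=
          mul_le_mul_of_nonneg_left (abs_integral_chainNumber_sub_BWexpect_le hd N n)
            (poissonWeight_nonneg hm n)
      _ = _ := by ring
  · simpa using tendsto_one_div_add_atTop_nhds_zero_nat.const_mul
      (d * ∑' n, poissonWeight m n * (n : ℝ) ^ 3)

theorem abs_rpow_sub_rpow_le {α x m : ℝ} (h0 : 0 < α) (h1 : α ≤ 1) (hx : 0 ≤ x) (hm : 0 < m) :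
    |x ^ α - m ^ α| ≤ m ^ α * |x / m - 1| := by
  have key : ∀ y : ℝ, 0 ≤ y → |y ^ α - 1| ≤ |y - 1| := fun y hy => by
    rcases le_total 1 y with h | h
    · have a1 := Real.one_le_rpow h h0.le
      have a2 := Real.rpow_le_rpow_of_exponent_le h h1
      rw [Real.rpow_one] at a2
      rw [abs_of_nonneg (by linarith), abs_of_nonneg (by linarith)]
      linarith
    · have a1 := Real.rpow_le_one hy h h0.le
      have a2 := Real.rpow_le_rpow_of_exponent_ge' hy h h0.le h1
      rw [Real.rpow_one] at a2
      rw [abs_of_nonpos (by linarith), abs_of_nonpos (by linarith)]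
      linarith
  have h := key (x / m) (by positivity)
  rw [Real.div_rpow hx hm.le] at h
  have hp : 0 < m ^ α := Real.rpow_pos_of_pos hm α
  calc |x ^ α - m ^ α| = m ^ α * |x ^ α / m ^ α - 1| := by
        rw [← abs_of_pos hp, ← abs_mul, abs_of_pos hp]
        congr 1
        field_simp
    _ ≤ _ := mul_le_mul_of_nonneg_left h hp.le

theorem exists_abs_BWexpect_sub_le {c : ℝ} (hc : IsBWConstant d c) {ε : ℝ} (hε : 0 < ε) :
    ∃ C, ∀ n : ℕ, |BWexpect d n - c * (n : ℝ) ^ (1 / d : ℝ)| ≤ ε * (n : ℝ) ^ (1 / d : ℝ) + C := by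
  obtain ⟨n₀, hn₀⟩ := Metric.tendsto_atTop.1 hc.2 ε hε
  refine ⟨∑ n ∈ Finset.range (n₀ + 1), |BWexpect d n - c * (n : ℝ) ^ (1 / d : ℝ)|, fun n => ?_⟩
  have hp : 0 ≤ (n : ℝ) ^ (1 / d : ℝ) := by positivity
  rcases lt_or_ge n (n₀ + 1) with h | h
  · have := Finset.single_le_sum
      (f := fun n : ℕ => |BWexpect d n - c * (n : ℝ) ^ (1 / d : ℝ)|)
      (fun i _ => abs_nonneg _) (Finset.mem_range.2 h)
    have h2 : 0 ≤ ε * (n : ℝ) ^ (1 / d : ℝ) := by positivity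
    linarith
  · have h1 := (hn₀ n (by omega)).le
    have hn : (0 : ℝ) < n := by exact_mod_cast (by omega : 0 < n)
    have hp : 0 < (n : ℝ) ^ (1 / d : ℝ) := by positivity
    rw [Real.dist_eq, neg_div, Real.rpow_neg hn.le] at h1
    have h2 : |BWexpect d n - c * (n : ℝ) ^ (1 / d : ℝ)|
        = (n : ℝ) ^ (1 / d : ℝ) * |((n : ℝ) ^ (1 / d : ℝ))⁻¹ * BWexpect d n - c| := by
      rw [← abs_of_pos hp, ← abs_mul, abs_of_pos hp]
      congr 1
      field_simp
    rw [h2]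
    have h3 : 0 ≤ ∑ n ∈ Finset.range (n₀ + 1), |BWexpect d n - c * (n : ℝ) ^ (1 / d : ℝ)| :=
      Finset.sum_nonneg fun _ _ => abs_nonneg _
    nlinarith [mul_le_mul_of_nonneg_left h1 hp.le]

theorem eventually_abs_tsum_poissonWeight_mul_BWexpect_sub_le (hd : 0 < d) {c : ℝ}
    (hc : IsBWConstant d c) {ε : ℝ} (hε : 0 < ε) :
    ∀ᶠ m : ℝ in atTop, |∑' n, poissonWeight m n * BWexpect d n - c * m ^ (1 / d : ℝ)|
      ≤ ε * m ^ (1 / d : ℝ) := by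
  have hd' : (0 : ℝ) < d := by exact_mod_cast hd
  have hd1 : (1 : ℝ) ≤ d := by exact_mod_cast hd
  have hα0 : (0 : ℝ) < 1 / d := by positivity
  have hα1 : (1 : ℝ) / d ≤ 1 := by rw [div_le_one hd']; exact hd1
  set ε' := ε / 4 with hε'
  have hε'0 : 0 < ε' := by positivity
  obtain ⟨C, hC⟩ := exists_abs_BWexpect_sub_le hc hε'0
  have hc0 : 0 < c := hc.1
  set δ := ε' / (c + ε') with hδ
  have hδ0 : 0 < δ := by positivity
  have e1 : ∀ᶠ m : ℝ in atTop, C / ε' ≤ m ^ (1 / d : ℝ) :=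
    (tendsto_rpow_atTop hα0).eventually_ge_atTop _
  filter_upwards [e1, eventually_gt_atTop 0, eventually_ge_atTop (1 / δ ^ 2)] with m h1 h0 h2
  set α : ℝ := 1 / d with hα
  have hp : 0 < m ^ α := Real.rpow_pos_of_pos h0 α
  have hpt : ∀ n : ℕ, |BWexpect d n - c * m ^ α|
      ≤ ε' * m ^ α + C + (c + ε') * m ^ α * (δ + ((n : ℝ) - m) ^ 2 / (m ^ 2 * δ)) := fun n => by
    have a1 := hC n
    have a2 := abs_rpow_sub_rpow_le hα0 hα1 (Nat.cast_nonneg n) h0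
    have a3 : |(n : ℝ) / m - 1| ≤ δ + ((n : ℝ) - m) ^ 2 / (m ^ 2 * δ) := by
      have : ((n : ℝ) - m) ^ 2 / (m ^ 2 * δ) = |(n : ℝ) / m - 1| ^ 2 / δ := by
        rw [sq_abs]; field_simp
      rw [this]
      set y := |(n : ℝ) / m - 1|
      have hy : 0 ≤ y := abs_nonneg _
      rcases le_total y δ with h | h
      · have : 0 ≤ y ^ 2 / δ := by positivity
        linarith
      · have : y ≤ y ^ 2 / δ := by rw [le_div_iff₀ hδ0]; nlinarith
        linarith
    have a4 := mul_le_mul_of_nonneg_left a3 hp.le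
    have a5 := abs_le.1 (a2.trans a4)
    have a6 := abs_le.1 a1
    set R := m ^ α * (δ + ((n : ℝ) - m) ^ 2 / (m ^ 2 * δ))
    have a7 : (c + ε') * m ^ α * (δ + ((n : ℝ) - m) ^ 2 / (m ^ 2 * δ)) = c * R + ε' * R := by
      simp only [R]; ring
    rw [a7]
    have b1 := mul_le_mul_of_nonneg_left a5.1 hc0.le
    have b2 := mul_le_mul_of_nonneg_left a5.2 hc0.le
    have b3 := mul_le_mul_of_nonneg_left a5.2 hε'0.le
    rw [abs_le]
    constructor <;> nlinarith
  have hB := (summable_poissonWeight_mul_BWexpect hd h0.le).hasSum.sub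
    ((hasSum_poissonWeight m).mul_right (c * m ^ α))
  have hR := ((hasSum_poissonWeight m).mul_right (ε' * m ^ α + C + (c + ε') * m ^ α * δ)).add
    ((hasSum_poissonWeight_mul_sub_sq m).mul_right ((c + ε') * m ^ α / (m ^ 2 * δ)))
  rw [one_mul] at hB
  have hle : |∑' n, poissonWeight m n * BWexpect d n - c * m ^ α|
      ≤ 1 * (ε' * m ^ α + C + (c + ε') * m ^ α * δ) + m * ((c + ε') * m ^ α / (m ^ 2 * δ)) := by
    rw [← hB.tsum_eq, ← Real.norm_eq_abs]
    refine tsum_of_norm_bounded hR fun n => ?_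
    rw [← mul_sub, Real.norm_eq_abs, abs_mul, abs_of_nonneg (poissonWeight_nonneg h0.le n)]
    refine (mul_le_mul_of_nonneg_left (hpt n) (poissonWeight_nonneg h0.le n)).trans_eq ?_
    ring
  refine hle.trans ?_
  have c1 : (c + ε') * δ = ε' := by rw [hδ]; field_simp
  have c2 : (c + ε') = ε' / δ := by rw [eq_div_iff hδ0.ne', c1]
  have c3 : m * ((c + ε') * m ^ α / (m ^ 2 * δ)) ≤ ε' * m ^ α := by
    have h3 : 1 ≤ m * δ ^ 2 := by rwa [div_le_iff₀ (by positivity)] at h2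
    rw [c2]
    have : m * (ε' / δ * m ^ α / (m ^ 2 * δ)) = ε' * m ^ α / (m * δ ^ 2) := by field_simp
    rw [this]
    exact div_le_self (by positivity) h3
  have c4 : C ≤ ε' * m ^ α := by rw [div_le_iff₀ hε'0] at h1; linarith
  have c5 : (c + ε') * m ^ α * δ = ε' * m ^ α := by rw [mul_right_comm, c1]
  have c6 : ε = 4 * ε' := by rw [hε']; ring
  rw [c5, c6]
  linarith

theorem eventually_abs_subsetExp_chainNumber_sub_le (hd : 0 < d) {c : ℝ}
    (hc : IsBWConstant d c) {ε : ℝ} (hε : 0 < ε) :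
    ∀ᶠ m : ℝ in atTop, ∀ᶠ N : ℕ in atTop,
      |subsetExp (fun _ => cellProb d N m) Finset.univ
        (fun S : Finset (Fin d → Fin (N + 1)) => (chainNumber StrongLT S : ℝ))
        - c * m ^ (1 / d : ℝ)| ≤ ε * m ^ (1 / d : ℝ) := by
  filter_upwards [eventually_abs_tsum_poissonWeight_mul_BWexpect_sub_le hd hc (half_pos hε),
    eventually_gt_atTop 0] with m hm h0
  have hp : 0 < m ^ (1 / d : ℝ) := Real.rpow_pos_of_pos h0 _
  have := Metric.tendsto_nhds.1 (tendsto_subsetExp_chainNumber hd h0.le)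
    (ε / 2 * m ^ (1 / d : ℝ)) (by positivity)
  filter_upwards [this] with N hN
  rw [Real.dist_eq] at hN
  rw [abs_le] at hm ⊢
  rw [abs_lt] at hN
  constructor <;> linarith

theorem eventually_subsetExp_abs_chainNumber_sub_ge_le (hd : 0 < d) {c : ℝ}
    (hc : IsBWConstant d c) {ε : ℝ} (hε : 0 < ε) :
    ∃ K, ∀ᶠ m : ℝ in atTop, ∀ᶠ N : ℕ in atTop,
      ∀ (Q : Finset (Fin d → Fin (N + 1)) → Prop) [DecidablePred Q],
      (∀ S, Q S → ε * m ^ (1 / d : ℝ) ≤ |(chainNumber StrongLT S : ℝ) - c * m ^ (1 / d : ℝ)|) →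
      subsetExp (fun _ => cellProb d N m) Finset.univ (fun S => if Q S then 1 else 0)
        ≤ K / m ^ (1 / d : ℝ) := by
  refine ⟨(c + ε) / (ε / 2) ^ 2, ?_⟩
  filter_upwards [eventually_abs_subsetExp_chainNumber_sub_le hd hc (half_pos hε),
    eventually_gt_atTop 0] with m hm h0
  filter_upwards [hm] with N hN Q _ hQ
  have hp : 0 < m ^ (1 / d : ℝ) := Real.rpow_pos_of_pos h0 _
  set y := m ^ (1 / d : ℝ)
  have p0 : ∀ i : Fin d → Fin (N + 1), 0 ≤ (fun _ => cellProb d N m) i :=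
    fun _ => cellProb_nonneg h0.le N
  have p1 : ∀ i : Fin d → Fin (N + 1), (fun _ => cellProb d N m) i ≤ 1 :=
    fun _ => cellProb_le_one m N
  set E := subsetExp (fun _ => cellProb d N m) Finset.univ
    (fun S : Finset (Fin d → Fin (N + 1)) => (chainNumber StrongLT S : ℝ))
  refine (subsetExp_chebyshev p0 p1 (a := ε / 2 * y) (by positivity) Q
    (F := fun S => (chainNumber StrongLT S : ℝ)) fun S hS => ?_).trans ?_
  · have h1 := hQ S hS
    have h2 := abs_sub_abs_le_abs_sub ((chainNumber StrongLT S : ℝ) - c * y) (E - c * y)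
    rw [sub_sub_sub_cancel_right] at h2
    linarith
  · have h1 := subsetExp_chainNumber_variance_le (r := StrongLT) p0 p1
      (Finset.univ : Finset (Fin d → Fin (N + 1)))
    have h2 : E ≤ (c + ε) * y := by
      have := (abs_le.1 hN).2
      nlinarith
    have hc0 := hc.1
    have h4 : (c + ε) / (ε / 2) ^ 2 / y = (c + ε) * y / (ε / 2 * y) ^ 2 := by field_simp
    rw [h4]
    exact div_le_div_of_nonneg_right (h1.trans h2) (by positivity)

/-! ### Poisson point processes -/

namespace PoissonPP

variable {d : ℕ} {Ω : Type*} [MeasurableSpace Ω] {P : Measure Ω}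
  {g : (Fin d → ℝ) → ℝ} (X : PoissonPP d P g) {a b : Fin d → ℝ} {N : ℕ}

theorem measurableSet_occupied (S : Finset (Fin d → Fin (N + 1))) :
    MeasurableSet {ω | occupied a b N (X.pts ω ∩ Icc a b) = S} := by
  have h : {ω | occupied a b N (X.pts ω ∩ Icc a b) = S}
      = ⋂ i : Fin d → Fin (N + 1), if i ∈ S then
          {ω | (X.pts ω ∩ (Icc a b ∩ {z | gridIdx a b N z = i})).encard = (0 : ℕ)}ᶜ
        else {ω | (X.pts ω ∩ (Icc a b ∩ {z | gridIdx a b N z = i})).encard = (0 : ℕ)} := by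
    have key : ∀ ω i, i ∈ occupied a b N (X.pts ω ∩ Icc a b)
        ↔ ¬ (X.pts ω ∩ (Icc a b ∩ {z | gridIdx a b N z = i})).encard = (0 : ℕ) := fun ω i => by
      rw [mem_occupied, Nat.cast_zero, encard_eq_zero, ← ne_eq, ← nonempty_iff_ne_empty]
      constructor
      · rintro ⟨z, ⟨h1, h2⟩, h3⟩
        exact ⟨z, h1, h2, h3⟩
      · rintro ⟨z, h1, h2, h3⟩
        exact ⟨z, ⟨h1, h2⟩, h3⟩
    ext ω
    rw [mem_ofPred_eq, Finset.ext_iff, mem_iInter]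
    refine forall_congr' fun i => ?_
    rw [key]
    by_cases hi : i ∈ S <;> simp [hi]
  rw [h]
  refine MeasurableSet.iInter fun i => ?_
  have hm := X.measur (Icc a b ∩ {z | gridIdx a b N z = i})
    (measurableSet_Icc.inter (measurable_gridIdx (measurableSet_singleton i)))
    (Metric.isBounded_Icc a b |>.subset inter_subset_left) 0
  split_ifs
  · exact hm.compl
  · exact hm

variable [IsProbabilityMeasure P]

theorem ae_finite {A : Set (Fin d → ℝ)} (hA : MeasurableSet A) (hb : Bornology.IsBounded A)
    (h0 : 0 ≤ ∫ x in A, g x) : ∀ᵐ ω ∂P, (X.pts ω ∩ A).Finite := by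
  have hU : P (⋃ k : ℕ, {ω | (X.pts ω ∩ A).encard = k}) = 1 := by
    rw [measure_iUnion ?_ (X.measur A hA hb)]
    · simp_rw [X.poisson A hA hb]
      change ∑' n, ENNReal.ofReal (poissonWeight _ n) = 1
      rw [← ENNReal.ofReal_tsum_of_nonneg (poissonWeight_nonneg h0)
        (hasSum_poissonWeight _).summable]
      rw [(hasSum_poissonWeight _).tsum_eq, ENNReal.ofReal_one]
    · intro i j hij
      refine Set.disjoint_left.2 fun ω hi hj => hij ?_
      rw [mem_ofPred_eq] at hi hj
      exact_mod_cast hi.symm.trans hj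
  rw [← prob_compl_eq_zero_iff (MeasurableSet.iUnion (X.measur A hA hb))] at hU
  refine measure_mono_null (fun ω hω => ?_) hU
  rw [mem_compl_iff, mem_iUnion]
  rintro ⟨k, hk⟩
  exact hω (finite_of_encard_eq_coe hk)

theorem measure_not_subsingleton_le {A : Set (Fin d → ℝ)} (hA : MeasurableSet A)
    (hb : Bornology.IsBounded A) (h0 : 0 ≤ ∫ x in A, g x) :
    P {ω | ¬ (X.pts ω ∩ A).Subsingleton} ≤ ENNReal.ofReal ((∫ x in A, g x) ^ 2) := by
  set m := ∫ x in A, g x with hm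
  have hE : {ω | ¬ (X.pts ω ∩ A).Subsingleton}
      = ({ω | (X.pts ω ∩ A).encard = (0 : ℕ)} ∪ {ω | (X.pts ω ∩ A).encard = (1 : ℕ)})ᶜ := by
    ext ω
    simp only [mem_ofPred_eq, mem_compl_iff, mem_union, ← encard_le_one_iff_subsingleton]
    rw [not_iff_not]
    constructor
    · intro h
      have h2 : (X.pts ω ∩ A).encard < 2 := h.trans_lt (by norm_num)
      generalize (X.pts ω ∩ A).encard = e at h h2
      induction e using ENat.recTopCoe with
      | top => simp at h
      | coe n =>
        have : n ≤ 1 := by exact_mod_cast h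
        interval_cases n <;> simp
    · rintro (h | h) <;> simp [h]
  have hdisj : Disjoint {ω | (X.pts ω ∩ A).encard = (0 : ℕ)}
      {ω | (X.pts ω ∩ A).encard = (1 : ℕ)} := Set.disjoint_left.2 fun ω hi hj => by
    rw [mem_ofPred_eq] at hi hj
    rw [hi] at hj
    norm_num at hj
  rw [hE, prob_compl_eq_one_sub ((X.measur A hA hb 0).union (X.measur A hA hb 1)),
    measure_union hdisj (X.measur A hA hb 1), X.poisson A hA hb, X.poisson A hA hb, ← hm,
    ← ENNReal.ofReal_add (by positivity) (by positivity), ← ENNReal.ofReal_one,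
    ← ENNReal.ofReal_sub _ (by positivity)]
  apply ENNReal.ofReal_le_ofReal
  have := Real.one_sub_le_exp_neg m
  simp only [pow_zero, Nat.factorial, Nat.cast_one, pow_one]
  norm_num
  nlinarith

theorem measureReal_occupied_eq (hg : IntegrableOn g (Icc a b))
    (S : Finset (Fin d → Fin (N + 1))) :
    P.real {ω | occupied a b N (X.pts ω ∩ Icc a b) = S}
      = subsetWeight (fun i => 1 - Real.exp (-∫ x in Icc a b ∩ {z | gridIdx a b N z = i}, g x))
          Finset.univ S := by
  revert S
  refine eq_of_sum_powerset_eq fun U => ?_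
  rw [sum_powerset_subsetWeight (Finset.subset_univ U)]
  have h := sum_measureReal_preimage_singleton (μ := P) U.powerset
    (f := fun ω => occupied a b N (X.pts ω ∩ Icc a b)) fun S _ => X.measurableSet_occupied S
  have h1 : ∀ S, (fun ω => occupied a b N (X.pts ω ∩ Icc a b)) ⁻¹' {S}
      = {ω | occupied a b N (X.pts ω ∩ Icc a b) = S} := fun S => by ext; simp
  simp only [h1] at h
  rw [h]
  have hcell : ∀ i : Fin d → Fin (N + 1), MeasurableSet (Icc a b ∩ {z | gridIdx a b N z = i}) :=
    fun i => measurableSet_Icc.inter (measurable_gridIdx (measurableSet_singleton i))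
  have hset : (fun ω => occupied a b N (X.pts ω ∩ Icc a b)) ⁻¹' ↑U.powerset
      = {ω | (X.pts ω ∩ ⋃ i ∈ Finset.univ \ U, Icc a b ∩ {z | gridIdx a b N z = i}).encard
          = (0 : ℕ)} := by
    ext ω
    rw [mem_preimage, Finset.mem_coe, Finset.mem_powerset, mem_ofPred_eq, Nat.cast_zero,
      encard_eq_zero, eq_empty_iff_forall_notMem]
    constructor
    · rintro hs z ⟨hz, hz2⟩
      simp only [mem_iUnion] at hz2
      obtain ⟨i, hi, hz2, hz3⟩ := hz2
      exact (Finset.mem_sdiff.1 hi).2 (hs (mem_occupied.2 ⟨z, ⟨hz, hz2⟩, hz3⟩))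
    · intro hs i hi
      obtain ⟨z, ⟨hz, hz2⟩, hz3⟩ := mem_occupied.1 hi
      by_contra hiU
      refine hs z ⟨hz, ?_⟩
      simp only [mem_iUnion]
      exact ⟨i, by simpa using hiU, hz2, hz3⟩
  rw [hset, measureReal_def, X.poisson _ (Finset.measurableSet_biUnion _ fun i _ => hcell i)
    ((Metric.isBounded_Icc a b).subset (iUnion₂_subset fun i _ => inter_subset_left)),
    integral_biUnion_finset _ (fun i _ => hcell i) ?_ fun i _ => hg.mono_set inter_subset_left]
  · rw [ENNReal.toReal_ofReal (by positivity)]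
    simp only [pow_zero, mul_one, Nat.factorial_zero, Nat.cast_one, div_one, sub_sub_cancel]
    rw [← Finset.sum_neg_distrib, Real.exp_sum]
  · intro i _ j _ hij
    refine Set.disjoint_left.2 fun z hi hj => hij ?_
    exact hi.2.symm.trans hj.2

theorem measureReal_occupied_mem (hg : IntegrableOn g (Icc a b))
    (Q : Finset (Fin d → Fin (N + 1)) → Prop) [DecidablePred Q] :
    P.real {ω | Q (occupied a b N (X.pts ω ∩ Icc a b))}
      = subsetExp (fun i => 1 - Real.exp (-∫ x in Icc a b ∩ {z | gridIdx a b N z = i}, g x))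
          Finset.univ fun S => if Q S then 1 else 0 := by
  have h := sum_measureReal_preimage_singleton (μ := P) (Finset.univ.filter Q)
    (f := fun ω => occupied a b N (X.pts ω ∩ Icc a b)) fun S _ => X.measurableSet_occupied S
  have h1 : ∀ S, (fun ω => occupied a b N (X.pts ω ∩ Icc a b)) ⁻¹' {S}
      = {ω | occupied a b N (X.pts ω ∩ Icc a b) = S} := fun S => by ext; simp
  have h2 : (fun ω => occupied a b N (X.pts ω ∩ Icc a b)) ⁻¹' ↑(Finset.univ.filter Q)
      = {ω | Q (occupied a b N (X.pts ω ∩ Icc a b))} := by ext; simp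
  simp only [h1, h2] at h
  rw [← h, subsetExp, Finset.powerset_univ, Finset.sum_filter]
  refine Finset.sum_congr rfl fun S _ => ?_
  rw [X.measureReal_occupied_eq hg]
  split_ifs <;> simp

theorem setIntegral_le_mul {A : Set (Fin d → ℝ)} {L v : ℝ} (hA : MeasurableSet A)
    (hv : 0 ≤ v) (hvol : volume A = ENNReal.ofReal v) (hg : IntegrableOn g A)
    (h : ∀ x ∈ A, g x ≤ L) : ∫ x in A, g x ≤ L * v := by
  have := setIntegral_mono_on hg (integrableOn_const (by simp [hvol])) hA h
  rwa [setIntegral_const, measureReal_def, hvol, ENNReal.toReal_ofReal hv, smul_eq_mul,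
    mul_comm] at this

theorem mul_le_setIntegral {A : Set (Fin d → ℝ)} {L v : ℝ} (hA : MeasurableSet A)
    (hv : 0 ≤ v) (hvol : volume A = ENNReal.ofReal v) (hg : IntegrableOn g A)
    (h : ∀ x ∈ A, L ≤ g x) : L * v ≤ ∫ x in A, g x := by
  have := setIntegral_mono_on (integrableOn_const (by simp [hvol])) hg hA h
  rwa [setIntegral_const, measureReal_def, hvol, ENNReal.toReal_ofReal hv, smul_eq_mul,
    mul_comm] at this

theorem measure_le_chainLength_le (hd : 0 < d) (hab : ∀ k, a k < b k) {L x : ℝ}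
    (hg0 : ∀ z, 0 ≤ g z) (hg : IntegrableOn g (Icc a b)) (hL : ∀ z ∈ Icc a b, g z ≤ L) (N : ℕ) :
    P {ω | x ≤ chainLength d (X.pts ω ∩ Icc a b)}
      ≤ ENNReal.ofReal (subsetExp (fun _ => cellProb d N (L * ∏ k, (b k - a k))) Finset.univ
          fun S : Finset (Fin d → Fin (N + 1)) => open Classical in
            if x ≤ chainNumber StrongLT S then 1 else 0)
        + ENNReal.ofReal (d * (L * ∏ k, (b k - a k)) ^ 2 * (1 / ((N : ℝ) + 1))) := by
  classical
  set V := ∏ k, (b k - a k) with hV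
  have hV0 : 0 < V := Finset.prod_pos fun k _ => sub_pos.2 (hab k)
  have hL0 : 0 ≤ L := (hg0 a).trans (hL a ⟨le_rfl, fun k => (hab k).le⟩)
  have hcell : ∀ i : Fin d → Fin (N + 1), MeasurableSet (Icc a b ∩ {z | gridIdx a b N z = i}) :=
    fun i => measurableSet_Icc.inter (measurable_gridIdx (measurableSet_singleton i))
  have hslab : ∀ (k : Fin d) (j : Fin (N + 1)),
      MeasurableSet (Icc a b ∩ {z | gridIdx a b N z k = j}) := fun k j =>
    measurableSet_Icc.inter
      (((measurable_pi_apply k).comp measurable_gridIdx) (measurableSet_singleton j))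
  have hnn : ∀ A : Set (Fin d → ℝ), 0 ≤ ∫ x in A, g x := fun A => integral_nonneg hg0
  have hfin := X.ae_finite measurableSet_Icc (Metric.isBounded_Icc a b) (hnn _)
  set bad : Set Ω := ⋃ q ∈ (Finset.univ : Finset (Fin d × Fin (N + 1))),
    {ω | ¬ (X.pts ω ∩ (Icc a b ∩ {z | gridIdx a b N z q.1 = q.2})).Subsingleton}
  have hbad : P bad ≤ ENNReal.ofReal (d * (L * V) ^ 2 * (1 / ((N : ℝ) + 1))) := by
    refine (measure_biUnion_finset_le _ _).trans ?_
    refine (Finset.sum_le_sum (g := fun _ => ENNReal.ofReal ((L * (V / (N + 1))) ^ 2))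
      fun q _ => ?_).trans ?_
    · refine (X.measure_not_subsingleton_le (hslab _ _)
        ((Metric.isBounded_Icc a b).subset inter_subset_left) (hnn _)).trans ?_
      refine ENNReal.ofReal_le_ofReal (pow_le_pow_left₀ (hnn _) ?_ 2)
      exact setIntegral_le_mul (hslab _ _) (by positivity) (volume_grid_slab hab _ _)
        (hg.mono_set inter_subset_left) fun z hz => hL z hz.1
    · rw [Finset.sum_const, nsmul_eq_mul, ← ENNReal.ofReal_natCast,
        ← ENNReal.ofReal_mul (by positivity)]
      refine ENNReal.ofReal_le_ofReal (le_of_eq ?_)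
      simp
      field_simp
  have hsub : {ω | x ≤ chainLength d (X.pts ω ∩ Icc a b)} ⊆
      ({ω | x ≤ chainNumber StrongLT (occupied a b N (X.pts ω ∩ Icc a b))} ∪ bad)
        ∪ {ω | ¬ (X.pts ω ∩ Icc a b).Finite} := by
    intro ω hω
    by_cases hf : (X.pts ω ∩ Icc a b).Finite
    · left
      by_cases hb : ω ∈ bad
      · exact Or.inr hb
      · left
        refine le_trans (b := ((chainLength d (X.pts ω ∩ Icc a b) : ℕ) : ℝ)) hω ?_
        refine Nat.cast_le.2 (chainLength_le_chainNumber_occupied hab hd hf ?_)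
        intro y hy z hz k hyz
        simp only [bad, mem_iUnion, not_exists, mem_ofPred_eq, not_not] at hb
        exact hb (k, gridIdx a b N z k) (Finset.mem_univ _) ⟨hy.1, hy.2, hyz⟩ ⟨hz.1, hz.2, rfl⟩
    · exact Or.inr hf
  have hnull : P {ω | ¬ (X.pts ω ∩ Icc a b).Finite} = 0 := hfin
  refine (measure_mono hsub).trans ((measure_union_le _ _).trans ?_)
  rw [hnull, add_zero]
  refine (measure_union_le _ _).trans (add_le_add ?_ hbad)
  rw [← ofReal_measureReal, X.measureReal_occupied_mem hg fun S => x ≤ chainNumber StrongLT S]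
  refine ENNReal.ofReal_le_ofReal (subsetExp_le_of_monotone ?_ ?_ ?_ ?_ ?_ ?_)
  · intro i
    have : Real.exp (-∫ x in Icc a b ∩ {z | gridIdx a b N z = i}, g x) ≤ 1 :=
      Real.exp_le_one_iff.2 (by linarith [hnn (Icc a b ∩ {z | gridIdx a b N z = i})])
    linarith
  · intro i
    have := Real.exp_pos (-∫ x in Icc a b ∩ {z | gridIdx a b N z = i}, g x)
    linarith
  · exact fun _ => cellProb_nonneg (by positivity) N
  · exact fun _ => cellProb_le_one _ N
  · intro i
    refine sub_le_sub_left (Real.exp_le_exp.2 (neg_le_neg ?_)) 1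
    rw [mul_div_assoc]
    exact setIntegral_le_mul (hcell i) (by positivity) (volume_grid_cell hab i)
      (hg.mono_set inter_subset_left) fun z hz => hL z hz.1
  · intro S T hST
    have := chainNumber_mono (r := StrongLT) hST
    dsimp only
    split_ifs with h1 h2
    · rfl
    · exact absurd (h1.trans (by exact_mod_cast this)) h2
    · simp
    · rfl

theorem measure_chainLength_le_le (hab : ∀ k, a k < b k) {L x : ℝ}
    (hg0 : ∀ z, 0 ≤ g z) (hL0 : 0 ≤ L) (hg : IntegrableOn g (Icc a b))
    (hL : ∀ z ∈ Icc a b, L ≤ g z) (N : ℕ) :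
    P {ω | (chainLength d (X.pts ω ∩ Icc a b) : ℝ) ≤ x}
      ≤ ENNReal.ofReal (subsetExp (fun _ => cellProb d N (L * ∏ k, (b k - a k))) Finset.univ
          fun S : Finset (Fin d → Fin (N + 1)) => open Classical in
            if (chainNumber StrongLT S : ℝ) ≤ x then 1 else 0) := by
  classical
  set V := ∏ k, (b k - a k) with hV
  have hV0 : 0 < V := Finset.prod_pos fun k _ => sub_pos.2 (hab k)
  have hcell : ∀ i : Fin d → Fin (N + 1), MeasurableSet (Icc a b ∩ {z | gridIdx a b N z = i}) :=
    fun i => measurableSet_Icc.inter (measurable_gridIdx (measurableSet_singleton i))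
  have hnn : ∀ A : Set (Fin d → ℝ), 0 ≤ ∫ x in A, g x := fun A => integral_nonneg hg0
  have hfin := X.ae_finite measurableSet_Icc (Metric.isBounded_Icc a b) (hnn _)
  have hsub : {ω | (chainLength d (X.pts ω ∩ Icc a b) : ℝ) ≤ x} ⊆
      {ω | (chainNumber StrongLT (occupied a b N (X.pts ω ∩ Icc a b)) : ℝ) ≤ x}
        ∪ {ω | ¬ (X.pts ω ∩ Icc a b).Finite} := by
    intro ω hω
    by_cases hf : (X.pts ω ∩ Icc a b).Finite
    · left
      refine le_trans (b := ((chainLength d (X.pts ω ∩ Icc a b) : ℕ) : ℝ)) ?_ hω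
      exact Nat.cast_le.2 (chainNumber_occupied_le hab hf)
    · exact Or.inr hf
  have hnull : P {ω | ¬ (X.pts ω ∩ Icc a b).Finite} = 0 := hfin
  refine (measure_mono hsub).trans ((measure_union_le _ _).trans ?_)
  rw [hnull, add_zero, ← ofReal_measureReal,
    X.measureReal_occupied_mem hg fun S => (chainNumber StrongLT S : ℝ) ≤ x]
  refine ENNReal.ofReal_le_ofReal ?_
  rw [← neg_le_neg_iff, neg_eq_neg_one_mul, ← subsetExp_const_mul,
    neg_eq_neg_one_mul (subsetExp _ _ _),
    ← subsetExp_const_mul]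
  refine subsetExp_le_of_monotone ?_ ?_ ?_ ?_ ?_ ?_
  · exact fun _ => cellProb_nonneg (by positivity) N
  · exact fun _ => cellProb_le_one _ N
  · intro i
    have : Real.exp (-∫ x in Icc a b ∩ {z | gridIdx a b N z = i}, g x) ≤ 1 :=
      Real.exp_le_one_iff.2 (by linarith [hnn (Icc a b ∩ {z | gridIdx a b N z = i})])
    linarith
  · intro i
    have := Real.exp_pos (-∫ x in Icc a b ∩ {z | gridIdx a b N z = i}, g x)
    linarith
  · intro i
    refine sub_le_sub_left (Real.exp_le_exp.2 (neg_le_neg ?_)) 1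
    rw [mul_div_assoc]
    exact mul_le_setIntegral (hcell i) (by positivity) (volume_grid_cell hab i)
      (hg.mono_set inter_subset_left) fun z hz => hL z hz.1
  · intro S T hST
    have := chainNumber_mono (r := StrongLT) hST
    dsimp only
    split_ifs with h1 h2 h2
    · rfl
    · simp
    · exact absurd (le_trans (by exact_mod_cast this) h2) h1
    · rfl

end PoissonPP

section Tails

variable {d : ℕ} {Ω : Type*} [MeasurableSpace Ω] (P : Measure Ω) [IsProbabilityMeasure P]

theorem eventually_measure_le_chainLength_le (hd : 0 < d) {c : ℝ} (hc : IsBWConstant d c)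
    {ε : ℝ} (hε : 0 < ε) :
    ∃ K, ∀ᶠ m : ℝ in atTop, ∀ (g : (Fin d → ℝ) → ℝ) (X : PoissonPP d P g) (a b : Fin d → ℝ)
      (L : ℝ), (∀ k, a k < b k) → (∀ z, 0 ≤ g z) → IntegrableOn g (Icc a b) →
      (∀ z ∈ Icc a b, g z ≤ L) → L * ∏ k, (b k - a k) = m →
      P {ω | (c + ε) * m ^ (1 / d : ℝ) ≤ chainLength d (X.pts ω ∩ Icc a b)}
        ≤ ENNReal.ofReal (K / m ^ (1 / d : ℝ)) := by
  obtain ⟨K, hK⟩ := eventually_subsetExp_abs_chainNumber_sub_ge_le hd hc hε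
  refine ⟨K, ?_⟩
  filter_upwards [hK] with m hm g X a b L hab hg0 hg hL hLm
  have hlim : Tendsto (fun N : ℕ => ENNReal.ofReal (K / m ^ (1 / d : ℝ))
      + ENNReal.ofReal (d * m ^ 2 * (1 / ((N : ℝ) + 1)))) atTop
      (𝓝 (ENNReal.ofReal (K / m ^ (1 / d : ℝ)))) := by
    have h1 := tendsto_one_div_add_atTop_nhds_zero_nat.const_mul ((d : ℝ) * m ^ 2)
    have h2 := (ENNReal.tendsto_ofReal h1).const_add (ENNReal.ofReal (K / m ^ (1 / d : ℝ)))
    simpa using h2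
  refine ge_of_tendsto hlim ?_
  filter_upwards [hm] with N hN
  have h := X.measure_le_chainLength_le hd hab (x := (c + ε) * m ^ (1 / d : ℝ)) hg0 hg hL N
  rw [hLm] at h
  refine h.trans (add_le_add (ENNReal.ofReal_le_ofReal ?_) le_rfl)
  classical
  refine hN _ fun S hS => le_trans ?_ (le_abs_self _)
  linarith

theorem eventually_measure_chainLength_le_le (hd : 0 < d) {c : ℝ} (hc : IsBWConstant d c)
    {ε : ℝ} (hε : 0 < ε) :
    ∃ K, ∀ᶠ m : ℝ in atTop, ∀ (g : (Fin d → ℝ) → ℝ) (X : PoissonPP d P g) (a b : Fin d → ℝ)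
      (L : ℝ), (∀ k, a k < b k) → (∀ z, 0 ≤ g z) → 0 ≤ L → IntegrableOn g (Icc a b) →
      (∀ z ∈ Icc a b, L ≤ g z) → L * ∏ k, (b k - a k) = m →
      P {ω | (chainLength d (X.pts ω ∩ Icc a b) : ℝ) ≤ (c - ε) * m ^ (1 / d : ℝ)}
        ≤ ENNReal.ofReal (K / m ^ (1 / d : ℝ)) := by
  obtain ⟨K, hK⟩ := eventually_subsetExp_abs_chainNumber_sub_ge_le hd hc hε
  refine ⟨K, ?_⟩
  filter_upwards [hK] with m hm g X a b L hab hg0 hL0 hg hL hLm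
  obtain ⟨N, hN⟩ := hm.exists
  have h := X.measure_chainLength_le_le hab (x := (c - ε) * m ^ (1 / d : ℝ)) hg0 hL0 hg hL N
  rw [hLm] at h
  refine h.trans (ENNReal.ofReal_le_ofReal ?_)
  classical
  refine hN _ fun S hS => le_trans ?_ (neg_le_abs _)
  linarith

end Tails

/-! ### Almost sure chain rates -/

theorem MemB.exists_forall_le {d : ℕ} {f : (Fin d → ℝ) → ℝ} (hf : MemB d f) (a b : Fin d → ℝ) :
    ∃ L, 0 < L ∧ ∀ z ∈ Icc a b, f z ≤ L := by
  have h : BddAbove (f '' Icc a b) := by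
    refine isCompact_Icc.induction_on (p := fun s => BddAbove (f '' s)) (by simp)
      (fun s t hst ht => ht.mono (image_mono hst)) (fun s t hs ht => ?_) fun x _ => ?_
    · rw [image_union]; exact hs.union ht
    · obtain ⟨U, hU, hb⟩ := hf.2.2 x
      exact ⟨U, mem_nhdsWithin_of_mem_nhds hU, hb⟩
  obtain ⟨L, hL⟩ := h
  exact ⟨max L 1, by positivity, fun z hz => (hL (mem_image_of_mem f hz)).trans (le_max_left _ _)⟩

theorem MemB.integrableOn_const_mul {d : ℕ} {f : (Fin d → ℝ) → ℝ} (hf : MemB d f)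
    (a b : Fin d → ℝ) (t : ℝ) : IntegrableOn (fun x => t * f x) (Icc a b) := by
  obtain ⟨L, -, hL⟩ := hf.exists_forall_le a b
  refine Integrable.const_mul (Measure.integrableOn_of_bounded isCompact_Icc.measure_lt_top.ne
    hf.1.aestronglyMeasurable (M := L) ?_) t
  refine (ae_restrict_iff' measurableSet_Icc).2 (ae_of_all _ fun z hz => ?_)
  rw [Real.norm_eq_abs, abs_of_nonneg (hf.2.1 z)]
  exact hL z hz

theorem ae_eventually_notMem_of_le_div_sq {Ω : Type*} [MeasurableSpace Ω] {P : Measure Ω}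
    {s : ℕ → Set Ω} {C : ℝ}
    (h : ∀ᶠ n : ℕ in atTop, P (s n) ≤ ENNReal.ofReal (C / (n : ℝ) ^ 2)) :
    ∀ᵐ ω ∂P, ∀ᶠ n in atTop, ω ∉ s n := by
  obtain ⟨n₀, hn₀⟩ := eventually_atTop.1 h
  have hs : Summable fun n : ℕ => C / ((n + n₀ : ℕ) : ℝ) ^ 2 := by
    have h1 := (Real.summable_one_div_nat_pow (p := 2)).2 (by norm_num)
    have h2 := ((summable_nat_add_iff n₀).2 h1).mul_left C
    simpa [div_eq_mul_inv] using h2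
  have h2 : ∑' n, P (s (n + n₀)) ≠ ⊤ := by
    refine ne_top_of_le_ne_top hs.tsum_ofReal_ne_top (ENNReal.tsum_le_tsum fun n => ?_)
    exact hn₀ _ (by omega)
  filter_upwards [ae_eventually_notMem h2] with ω hω
  obtain ⟨n₁, hn₁⟩ := eventually_atTop.1 hω
  refine eventually_atTop.2 ⟨n₁ + n₀, fun n hn => ?_⟩
  have := hn₁ (n - n₀) (by omega)
  rwa [Nat.sub_add_cancel (by omega)] at this

section Interpolation

variable {d : ℕ} {F : ℝ → ℝ}

theorem eventually_le_of_forall_nat (hd : 0 < d) (hF : ∀ s t, 0 < s → s ≤ t → F s ≤ F t)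
    {B B' : ℝ} (hB : 0 ≤ B) (hBB' : B < B')
    (h : ∀ᶠ n : ℕ in atTop, F ((n : ℝ) ^ (2 * d)) ≤ B * (n : ℝ) ^ 2) :
    ∀ᶠ t : ℝ in atTop, F t ≤ B' * t ^ (1 / d : ℝ) := by
  have hd' : (0 : ℝ) < d := by exact_mod_cast hd
  have hs : Tendsto (fun t : ℝ => t ^ (1 / (2 * d) : ℝ)) atTop atTop :=
    tendsto_rpow_atTop (by positivity)
  have h2 :=
    (((tendsto_add_atTop_nat 1).comp (tendsto_nat_floor_atTop (α := ℝ))).comp hs).eventually h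
  filter_upwards [h2, eventually_gt_atTop 0, hs.eventually_ge_atTop 1,
    hs.eventually_ge_atTop (3 * B / (B' - B))] with t ht ht0 hs1 hs2
  have e1 : (t ^ (1 / (2 * d) : ℝ)) ^ (2 * d) = t := by
    rw [← Real.rpow_natCast, ← Real.rpow_mul ht0.le]
    push_cast
    rw [one_div_mul_cancel (by positivity), Real.rpow_one]
  have e2 : (t ^ (1 / (2 * d) : ℝ)) ^ 2 = t ^ (1 / d : ℝ) := by
    rw [← Real.rpow_natCast, ← Real.rpow_mul ht0.le]
    congr 1
    push_cast
    field_simp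
  rw [← e2]
  simp only [Function.comp] at ht
  set s := t ^ (1 / (2 * d) : ℝ)
  have f1 := Nat.lt_floor_add_one s
  have f2 := Nat.floor_le (zero_le_one.trans hs1)
  push_cast at ht
  have f3 : t ≤ ((⌊s⌋₊ : ℝ) + 1) ^ (2 * d) := by
    rw [← e1]; exact pow_le_pow_left₀ (by linarith) f1.le _
  have f4 : ((⌊s⌋₊ : ℝ) + 1) ^ 2 ≤ (s + 1) ^ 2 := pow_le_pow_left₀ (by positivity) (by linarith) _
  rw [div_le_iff₀ (by linarith)] at hs2
  have f5 := mul_le_mul_of_nonneg_left f4 hB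
  have f6 := mul_le_mul_of_nonneg_left hs1 hB
  calc F t ≤ _ := hF _ _ ht0 f3
    _ ≤ _ := ht
    _ ≤ _ := f5
    _ ≤ B' * s ^ 2 := by nlinarith

theorem eventually_ge_of_forall_nat (hd : 0 < d) (hF : ∀ s t, 0 < s → s ≤ t → F s ≤ F t)
    {B B' : ℝ} (hB : 0 ≤ B) (hBB' : B' < B)
    (h : ∀ᶠ n : ℕ in atTop, B * (n : ℝ) ^ 2 ≤ F ((n : ℝ) ^ (2 * d))) :
    ∀ᶠ t : ℝ in atTop, B' * t ^ (1 / d : ℝ) ≤ F t := by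
  have hd' : (0 : ℝ) < d := by exact_mod_cast hd
  have hs : Tendsto (fun t : ℝ => t ^ (1 / (2 * d) : ℝ)) atTop atTop :=
    tendsto_rpow_atTop (by positivity)
  have h2 := ((tendsto_nat_floor_atTop (α := ℝ)).comp hs).eventually h
  filter_upwards [h2, eventually_gt_atTop 0, hs.eventually_ge_atTop 1,
    hs.eventually_ge_atTop (2 * B / (B - B'))] with t ht ht0 hs1 hs2
  have e1 : (t ^ (1 / (2 * d) : ℝ)) ^ (2 * d) = t := by
    rw [← Real.rpow_natCast, ← Real.rpow_mul ht0.le]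
    push_cast
    rw [one_div_mul_cancel (by positivity), Real.rpow_one]
  have e2 : (t ^ (1 / (2 * d) : ℝ)) ^ 2 = t ^ (1 / d : ℝ) := by
    rw [← Real.rpow_natCast, ← Real.rpow_mul ht0.le]
    congr 1
    push_cast
    field_simp
  rw [← e2]
  simp only [Function.comp] at ht
  set s := t ^ (1 / (2 * d) : ℝ)
  have f1 := Nat.lt_floor_add_one s
  have f2 := Nat.floor_le (zero_le_one.trans hs1)
  have f3 : (⌊s⌋₊ : ℝ) ^ (2 * d) ≤ t := by
    conv_rhs => rw [← e1]
    exact pow_le_pow_left₀ (by positivity) f2 _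
  have f0 : 0 < (⌊s⌋₊ : ℝ) := by exact_mod_cast Nat.floor_pos.2 hs1
  have f4 : (s - 1) ^ 2 ≤ (⌊s⌋₊ : ℝ) ^ 2 := pow_le_pow_left₀ (by linarith) (by linarith) _
  rw [div_le_iff₀ (by linarith)] at hs2
  have f5 := mul_le_mul_of_nonneg_left f4 hB
  calc B' * s ^ 2 ≤ B * (s - 1) ^ 2 := by nlinarith
    _ ≤ _ := f5
    _ ≤ _ := ht
    _ ≤ F t := hF _ _ (by positivity) f3

theorem scaled_mass_rpow (hd : 0 < d) {L V : ℝ} (h : 0 ≤ L * V) (n : ℕ) :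
    ((n : ℝ) ^ (2 * d) * L * V) ^ (1 / d : ℝ) = (n : ℝ) ^ 2 * (L * V) ^ (1 / d : ℝ) := by
  have hd' : (d : ℝ) ≠ 0 := by exact_mod_cast hd.ne'
  rw [mul_assoc, Real.mul_rpow (by positivity) h, pow_mul, ← Real.rpow_natCast ((n : ℝ) ^ 2) d,
    ← Real.rpow_mul (by positivity), mul_one_div_cancel hd', Real.rpow_one]

end Interpolation

theorem exists_rat_box {d : ℕ} {a b : Fin d → ℝ} {δ : ℝ} (hδ : 0 < δ) :
    ∃ a' b' : Fin d → ℚ, ∀ k, a k < a' k ∧ a' k < a k + δ ∧ b k < b' k ∧ b' k < b k + δ := by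
  choose a' ha' using fun k => exists_rat_btwn (lt_add_of_pos_right (a k) hδ)
  choose b' hb' using fun k => exists_rat_btwn (lt_add_of_pos_right (b k) hδ)
  exact ⟨a', b', fun k => ⟨(ha' k).1, (ha' k).2, (hb' k).1, (hb' k).2⟩⟩

/-- The growing point configuration `A` has finitely many points in bounded sets, and its longest
chains in boxes grow at the rate dictated by the intensity `f`. -/
structure HasChainRates (d : ℕ) (c : ℝ) (f : (Fin d → ℝ) → ℝ) (A : ℝ → Set (Fin d → ℝ)) :
    Prop where
  finite : ∀ (t : ℝ) (a b : Fin d → ℝ), (A t ∩ Icc a b).Finite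
  upper : ∀ (a b : Fin d → ℝ), a ≤ b → ∀ L > 0, ∀ η > 0,
    (∀ z ∈ Icc (fun k => a k - η) (fun k => b k + η), f z ≤ L) → ∀ ε > 0, ∀ᶠ t : ℝ in atTop,
      (chainLength d (A t ∩ Icc a b) : ℝ)
        ≤ (c * (L * ∏ k, (b k - a k)) ^ (1 / d : ℝ) + ε) * t ^ (1 / d : ℝ)
  lower : ∀ (a b : Fin d → ℝ), (∀ k, a k < b k) → ∀ L > 0, (∀ z ∈ Icc a b, L ≤ f z) →
    ∀ ε > 0, ∀ᶠ t : ℝ in atTop,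
      (c * (L * ∏ k, (b k - a k)) ^ (1 / d : ℝ) - ε) * t ^ (1 / d : ℝ)
        ≤ chainLength d (A t ∩ Icc a b)

section Family

variable {d : ℕ} {Ω : Type*} [MeasurableSpace Ω] {P : Measure Ω}
  {f : (Fin d → ℝ) → ℝ} (PP : ∀ t : ℝ, 0 < t → PoissonPP d P fun x => t * f x)

/-- The points at time `t` of a family of point processes, with no points at times `t ≤ 0`. -/
def pointsAt (ω : Ω) (t : ℝ) : Set (Fin d → ℝ) := if ht : 0 < t then (PP t ht).pts ω else ∅

theorem pointsAt_of_pos (ω : Ω) {t : ℝ} (ht : 0 < t) : pointsAt PP ω t = (PP t ht).pts ω :=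
  dif_pos ht

variable {PP}

theorem pointsAt_mono
    (hmono : ∀ s t : ℝ, ∀ (hs : 0 < s) (ht : 0 < t), s ≤ t →
      ∀ ω, (PP s hs).pts ω ⊆ (PP t ht).pts ω)
    (ω : Ω) : Monotone (pointsAt PP ω) := fun s t hst => by
  by_cases hs : 0 < s
  · rw [pointsAt_of_pos PP ω hs, pointsAt_of_pos PP ω (hs.trans_le hst)]
    exact hmono s t hs _ hst ω
  · simp [pointsAt, hs]

theorem chainLength_pointsAt_mono
    (hmono : ∀ s t : ℝ, ∀ (hs : 0 < s) (ht : 0 < t), s ≤ t →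
      ∀ ω, (PP s hs).pts ω ⊆ (PP t ht).pts ω)
    {ω : Ω} {a b : Fin d → ℝ}
    (hfin : ∀ t, (pointsAt PP ω t ∩ Icc a b).Finite) {s t : ℝ} (hst : s ≤ t) :
    (chainLength d (pointsAt PP ω s ∩ Icc a b) : ℝ)
      ≤ chainLength d (pointsAt PP ω t ∩ Icc a b) :=
  Nat.cast_le.2 (chainLength_mono (hfin t)
    (inter_subset_inter_left _ (pointsAt_mono hmono ω hst)))

variable [IsProbabilityMeasure P]

theorem ae_finite_pointsAt
    (hmono : ∀ s t : ℝ, ∀ (hs : 0 < s) (ht : 0 < t), s ≤ t →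
      ∀ ω, (PP s hs).pts ω ⊆ (PP t ht).pts ω)
    (hf : MemB d f) :
    ∀ᵐ ω ∂P, ∀ (t : ℝ) (a b : Fin d → ℝ), (pointsAt PP ω t ∩ Icc a b).Finite := by
  have h : ∀ n : ℕ, ∀ᵐ ω ∂P, (pointsAt PP ω (n + 1)
      ∩ Icc (fun _ => -(n : ℝ)) fun _ => (n : ℝ)).Finite := fun n => by
    have hn : (0 : ℝ) < n + 1 := by positivity
    have := (PP _ hn).ae_finite (A := Icc (fun _ => -(n : ℝ)) fun _ => (n : ℝ)) measurableSet_Icc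
      (Metric.isBounded_Icc _ _) (integral_nonneg fun x => mul_nonneg hn.le (hf.2.1 x))
    simpa only [pointsAt_of_pos PP _ hn] using this
  filter_upwards [ae_all_iff.2 h] with ω hω t a b
  obtain ⟨n, hn⟩ := exists_nat_ge (|t| + ∑ k, (|a k| + |b k|))
  have hS : ∀ k, |a k| + |b k| ≤ ∑ k, (|a k| + |b k|) := fun k =>
    Finset.single_le_sum (f := fun k => |a k| + |b k|) (fun i _ => by positivity)
      (Finset.mem_univ k)
  have hS0 : 0 ≤ ∑ k, (|a k| + |b k|) := Finset.sum_nonneg fun i _ => by positivity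
  refine (hω n).subset (inter_subset_inter (pointsAt_mono hmono ω ?_) (Icc_subset_Icc ?_ ?_))
  · have := le_abs_self t
    linarith
  · intro k
    have := neg_abs_le (a k)
    have := hS k
    have := abs_nonneg t
    have := abs_nonneg (b k)
    change -(n : ℝ) ≤ a k
    linarith
  · intro k
    have := le_abs_self (b k)
    have := hS k
    have := abs_nonneg t
    have := abs_nonneg (a k)
    change b k ≤ (n : ℝ)
    linarith

theorem ae_eventually_chainLength_le
    (hmono : ∀ s t : ℝ, ∀ (hs : 0 < s) (ht : 0 < t), s ≤ t →
      ∀ ω, (PP s hs).pts ω ⊆ (PP t ht).pts ω)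
    (hd : 0 < d) {c : ℝ} (hc : IsBWConstant d c) (hf : MemB d f)
    {a b : Fin d → ℝ} (hab : ∀ k, a k < b k) {L : ℝ} (hL0 : 0 < L) (hL : ∀ z ∈ Icc a b, f z ≤ L) :
    ∀ᵐ ω ∂P, ∀ ε > 0, ∀ᶠ t : ℝ in atTop, (chainLength d (pointsAt PP ω t ∩ Icc a b) : ℝ)
      ≤ (c * (L * ∏ k, (b k - a k)) ^ (1 / d : ℝ) + ε) * t ^ (1 / d : ℝ) := by
  have hV0 : 0 < ∏ k, (b k - a k) := Finset.prod_pos fun k _ => sub_pos.2 (hab k)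
  set V := ∏ k, (b k - a k) with hV
  set y := (L * V) ^ (1 / d : ℝ) with hy
  have hy0 : 0 < y := Real.rpow_pos_of_pos (by positivity) _
  have hc0 := hc.1
  have key : ∀ j : ℕ, ∀ᵐ ω ∂P, ∀ᶠ n : ℕ in atTop,
      (chainLength d (pointsAt PP ω ((n : ℝ) ^ (2 * d)) ∩ Icc a b) : ℝ)
        ≤ (c * y + 1 / ((j : ℝ) + 1)) * (n : ℝ) ^ 2 := fun j => by
    set δ : ℝ := 1 / ((j : ℝ) + 1)
    have hδ : 0 < δ := by positivity
    obtain ⟨K, hK⟩ := eventually_measure_le_chainLength_le P hd hc (ε := δ / y) (by positivity)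
    have hlim : Tendsto (fun n : ℕ => (n : ℝ) ^ (2 * d) * L * V) atTop atTop :=
      (((tendsto_pow_atTop (by omega)).comp tendsto_natCast_atTop_atTop).atTop_mul_const
        hL0).atTop_mul_const hV0
    have h2 : ∀ᶠ n : ℕ in atTop, P {ω | (c * y + δ) * (n : ℝ) ^ 2
        ≤ chainLength d (pointsAt PP ω ((n : ℝ) ^ (2 * d)) ∩ Icc a b)}
        ≤ ENNReal.ofReal ((K / y) / (n : ℝ) ^ 2) := by
      filter_upwards [hlim.eventually hK, eventually_gt_atTop 0] with n hn hn0
      have ht : (0 : ℝ) < (n : ℝ) ^ (2 * d) := by positivity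
      have := hn _ (PP _ ht) a b ((n : ℝ) ^ (2 * d) * L) hab
        (fun z => mul_nonneg ht.le (hf.2.1 z)) (hf.integrableOn_const_mul a b _)
        (fun z hz => mul_le_mul_of_nonneg_left (hL z hz) ht.le) rfl
      rw [scaled_mass_rpow hd (by positivity)] at this
      have e1 : (c + δ / y) * ((n : ℝ) ^ 2 * y) = (c * y + δ) * (n : ℝ) ^ 2 := by field_simp
      have e2 : K / ((n : ℝ) ^ 2 * y) = (K / y) / (n : ℝ) ^ 2 := by rw [div_div, mul_comm]
      rw [← hy, e1, e2] at this
      simpa only [pointsAt_of_pos PP _ ht] using this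
    filter_upwards [ae_eventually_notMem_of_le_div_sq h2] with ω hω
    filter_upwards [hω] with n hn
    exact (not_le.1 hn).le
  filter_upwards [ae_all_iff.2 key, ae_finite_pointsAt hmono hf] with ω h1 hfin ε hε
  obtain ⟨j, hj⟩ := exists_nat_one_div_lt hε
  exact eventually_le_of_forall_nat
    (F := fun t => (chainLength d (pointsAt PP ω t ∩ Icc a b) : ℝ)) hd
    (fun s t _ hst => chainLength_pointsAt_mono hmono (fun t => hfin t a b) hst)
    (by positivity) (by linarith) (h1 j)

theorem ae_eventually_le_chainLength
    (hmono : ∀ s t : ℝ, ∀ (hs : 0 < s) (ht : 0 < t), s ≤ t →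
      ∀ ω, (PP s hs).pts ω ⊆ (PP t ht).pts ω)
    (hd : 0 < d) {c : ℝ} (hc : IsBWConstant d c) (hf : MemB d f)
    {a b : Fin d → ℝ} (hab : ∀ k, a k < b k) {L : ℝ} (hL0 : 0 < L) (hL : ∀ z ∈ Icc a b, L ≤ f z) :
    ∀ᵐ ω ∂P, ∀ ε > 0, ∀ᶠ t : ℝ in atTop,
      (c * (L * ∏ k, (b k - a k)) ^ (1 / d : ℝ) - ε) * t ^ (1 / d : ℝ)
        ≤ chainLength d (pointsAt PP ω t ∩ Icc a b) := by
  have hV0 : 0 < ∏ k, (b k - a k) := Finset.prod_pos fun k _ => sub_pos.2 (hab k)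
  set V := ∏ k, (b k - a k) with hV
  set y := (L * V) ^ (1 / d : ℝ) with hy
  have hy0 : 0 < y := Real.rpow_pos_of_pos (by positivity) _
  have hc0 := hc.1
  have key : ∀ j : ℕ, ∀ᵐ ω ∂P, ∀ᶠ n : ℕ in atTop,
      (c * y - 1 / ((j : ℝ) + 1)) * (n : ℝ) ^ 2
        ≤ (chainLength d (pointsAt PP ω ((n : ℝ) ^ (2 * d)) ∩ Icc a b) : ℝ) := fun j => by
    set δ : ℝ := 1 / ((j : ℝ) + 1)
    have hδ : 0 < δ := by positivity
    obtain ⟨K, hK⟩ := eventually_measure_chainLength_le_le P hd hc (ε := δ / y) (by positivity)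
    have hlim : Tendsto (fun n : ℕ => (n : ℝ) ^ (2 * d) * L * V) atTop atTop :=
      (((tendsto_pow_atTop (by omega)).comp tendsto_natCast_atTop_atTop).atTop_mul_const
        hL0).atTop_mul_const hV0
    have h2 : ∀ᶠ n : ℕ in atTop, P {ω |
        (chainLength d (pointsAt PP ω ((n : ℝ) ^ (2 * d)) ∩ Icc a b) : ℝ)
          ≤ (c * y - δ) * (n : ℝ) ^ 2}
        ≤ ENNReal.ofReal ((K / y) / (n : ℝ) ^ 2) := by
      filter_upwards [hlim.eventually hK, eventually_gt_atTop 0] with n hn hn0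
      have ht : (0 : ℝ) < (n : ℝ) ^ (2 * d) := by positivity
      have := hn _ (PP _ ht) a b ((n : ℝ) ^ (2 * d) * L) hab
        (fun z => mul_nonneg ht.le (hf.2.1 z)) (by positivity) (hf.integrableOn_const_mul a b _)
        (fun z hz => mul_le_mul_of_nonneg_left (hL z hz) ht.le) rfl
      rw [scaled_mass_rpow hd (by positivity)] at this
      have e1 : (c - δ / y) * ((n : ℝ) ^ 2 * y) = (c * y - δ) * (n : ℝ) ^ 2 := by field_simp
      have e2 : K / ((n : ℝ) ^ 2 * y) = (K / y) / (n : ℝ) ^ 2 := by rw [div_div, mul_comm]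
      rw [← hy, e1, e2] at this
      simpa only [pointsAt_of_pos PP _ ht] using this
    filter_upwards [ae_eventually_notMem_of_le_div_sq h2] with ω hω
    filter_upwards [hω] with n hn
    exact (not_le.1 hn).le
  filter_upwards [ae_all_iff.2 key, ae_finite_pointsAt hmono hf] with ω h1 hfin ε hε
  rcases le_or_gt (c * y) ε with hle | hlt
  · filter_upwards [eventually_gt_atTop 0] with t ht
    refine le_trans (mul_nonpos_of_nonpos_of_nonneg (by linarith) (by positivity))
      (Nat.cast_nonneg _)
  obtain ⟨j, hj⟩ := exists_nat_one_div_lt hε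
  exact eventually_ge_of_forall_nat
    (F := fun t => (chainLength d (pointsAt PP ω t ∩ Icc a b) : ℝ)) hd
    (fun s t _ hst => chainLength_pointsAt_mono hmono (fun t => hfin t a b) hst)
    (by linarith) (by linarith) (h1 j)

theorem ae_hasChainRates
    (hmono : ∀ s t : ℝ, ∀ (hs : 0 < s) (ht : 0 < t), s ≤ t →
      ∀ ω, (PP s hs).pts ω ⊆ (PP t ht).pts ω)
    (hd : 0 < d) {c : ℝ} (hc : IsBWConstant d c) (hf : MemB d f) :
    ∀ᵐ ω ∂P, HasChainRates d c f (pointsAt PP ω) := by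
  have hα : (0 : ℝ) ≤ 1 / d := by positivity
  have hU : ∀ᵐ ω ∂P, ∀ (a b : Fin d → ℚ) (L : ℚ), (∀ k, (a k : ℝ) < b k) → 0 < (L : ℝ) →
      (∀ z ∈ Icc (fun k => (a k : ℝ)) fun k => (b k : ℝ), f z ≤ L) → ∀ ε > 0,
      ∀ᶠ t : ℝ in atTop,
        (chainLength d (pointsAt PP ω t ∩ Icc (fun k => (a k : ℝ)) fun k => (b k : ℝ)) : ℝ)
        ≤ (c * (L * ∏ k, ((b k : ℝ) - a k)) ^ (1 / d : ℝ) + ε) * t ^ (1 / d : ℝ) := by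
    simp only [ae_all_iff]
    intro a b L hab hL0 hL
    exact ae_eventually_chainLength_le hmono hd hc hf hab hL0 hL
  have hD : ∀ᵐ ω ∂P, ∀ (a b : Fin d → ℚ) (L : ℚ), (∀ k, (a k : ℝ) < b k) → 0 < (L : ℝ) →
      (∀ z ∈ Icc (fun k => (a k : ℝ)) fun k => (b k : ℝ), L ≤ f z) → ∀ ε > 0,
      ∀ᶠ t : ℝ in atTop,
        (c * (L * ∏ k, ((b k : ℝ) - a k)) ^ (1 / d : ℝ) - ε) * t ^ (1 / d : ℝ)
        ≤ (chainLength d (pointsAt PP ω t ∩ Icc (fun k => (a k : ℝ)) fun k => (b k : ℝ)) : ℝ) := by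
    simp only [ae_all_iff]
    intro a b L hab hL0 hL
    exact ae_eventually_le_chainLength hmono hd hc hf hab hL0 hL
  have hsm : ∀ r : ℝ, 0 < r → ∀ᶠ δ : ℝ in 𝓝[>] 0, 0 < δ ∧ δ < r := fun r hr => Ioo_mem_nhdsGT hr
  filter_upwards [ae_finite_pointsAt hmono hf, hU, hD] with ω h1 h2 h3
  refine ⟨h1, fun a b hab L hL0 η hη hL ε hε => ?_, fun a b hab L hL0 hL ε hε => ?_⟩
  · have hcont : Continuous fun δ : ℝ =>
        c * ((L + δ) * ∏ k, (b k - a k + 2 * δ)) ^ (1 / d : ℝ) :=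
      continuous_const.mul (Continuous.rpow_const (by fun_prop) fun _ => Or.inr hα)
    have hev : ∀ᶠ δ : ℝ in 𝓝[>] 0, c * ((L + δ) * ∏ k, (b k - a k + 2 * δ)) ^ (1 / d : ℝ)
        < c * (L * ∏ k, (b k - a k)) ^ (1 / d : ℝ) + ε / 2 := by
      refine (hcont.tendsto 0).eventually_lt_const ?_ |>.filter_mono nhdsWithin_le_nhds
      simpa using hε
    obtain ⟨δ, hδ, hδ0, hδη⟩ := (hev.and (hsm η hη)).exists
    obtain ⟨a', b', hq⟩ := exists_rat_box (a := fun k => a k - δ) (b := b) hδ0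
    obtain ⟨L', hL'1, hL'2⟩ := exists_rat_btwn (lt_add_of_pos_right L hδ0)
    simp only [sub_add_cancel] at hq
    have hlt : ∀ k, (a' k : ℝ) < b' k := fun k => by
      have := hq k
      have := hab k
      linarith
    have := h2 a' b' L' hlt (hL0.trans hL'1) (fun z hz => (hL z ⟨fun k => ?_, fun k => ?_⟩).trans
      hL'1.le) (ε / 2) (half_pos hε)
    · filter_upwards [this, eventually_gt_atTop 0] with t ht ht0
      refine le_trans (Nat.cast_le.2 (chainLength_mono (h1 _ _ _)
        (inter_subset_inter_right _ (Icc_subset_Icc (fun k => (hq k).2.1.le)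
          fun k => (hq k).2.2.1.le)))) (ht.trans ?_)
      refine mul_le_mul_of_nonneg_right ?_ (by positivity)
      have hP : (L' : ℝ) * ∏ k, ((b' k : ℝ) - a' k) ≤ (L + δ) * ∏ k, (b k - a k + 2 * δ) := by
        refine mul_le_mul hL'2.le (Finset.prod_le_prod (fun k _ => (sub_pos.2 (hlt k)).le)
          fun k _ => ?_) (Finset.prod_nonneg fun k _ => (sub_pos.2 (hlt k)).le) (by positivity)
        have := hq k
        linarith
      have := mul_le_mul_of_nonneg_left (Real.rpow_le_rpow (mul_nonneg (hL0.trans hL'1).le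
        (Finset.prod_nonneg fun k _ => (sub_pos.2 (hlt k)).le)) hP hα) hc.1.le
      linarith
    · have := hz.1 k
      have := hq k
      dsimp only at *
      linarith
    · have := hz.2 k
      have := hq k
      dsimp only at *
      linarith
  · have hcont : Continuous fun δ : ℝ =>
        c * ((L - δ) * ∏ k, (b k - a k - 2 * δ)) ^ (1 / d : ℝ) :=
      continuous_const.mul (Continuous.rpow_const (by fun_prop) fun _ => Or.inr hα)
    have hev : ∀ᶠ δ : ℝ in 𝓝[>] 0, c * (L * ∏ k, (b k - a k)) ^ (1 / d : ℝ) - ε / 2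
        < c * ((L - δ) * ∏ k, (b k - a k - 2 * δ)) ^ (1 / d : ℝ) := by
      refine (hcont.tendsto 0).eventually_const_lt ?_ |>.filter_mono nhdsWithin_le_nhds
      simpa using hε
    have hev2 : ∀ᶠ δ : ℝ in 𝓝[>] 0, ∀ k, δ < (b k - a k) / 2 :=
      eventually_all.2 fun k => (hsm _ (half_pos (sub_pos.2 (hab k)))).mono fun δ h => h.2
    obtain ⟨δ, hδ, ⟨hδ0, hδL⟩, hδk⟩ := (hev.and ((hsm L hL0).and hev2)).exists
    obtain ⟨a', b', hq⟩ := exists_rat_box (a := a) (b := fun k => b k - δ) hδ0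
    obtain ⟨L', hL'1, hL'2⟩ := exists_rat_btwn (sub_lt_self L hδ0)
    simp only [sub_add_cancel] at hq
    have hlt : ∀ k, a k + δ < b k - δ := fun k => by
      have := hδk k
      linarith
    have hlt' : ∀ k, (a' k : ℝ) < b' k := fun k => by
      have := hq k
      have := hlt k
      linarith
    have := h3 a' b' L' hlt' ((sub_pos.2 hδL).trans hL'1) (fun z hz => hL'2.le.trans
      (hL z ⟨fun k => (hq k).1.le.trans (hz.1 k), fun k => (hz.2 k).trans (hq k).2.2.2.le⟩))
      (ε / 2) (half_pos hε)
    filter_upwards [this, eventually_gt_atTop 0] with t ht ht0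
    refine le_trans (le_trans ?_ ht) (Nat.cast_le.2 (chainLength_mono (h1 _ _ _)
      (inter_subset_inter_right _ (Icc_subset_Icc (fun k => (hq k).1.le)
        fun k => (hq k).2.2.2.le))))
    refine mul_le_mul_of_nonneg_right ?_ (by positivity)
    have hnn : 0 ≤ ∏ k, (b k - a k - 2 * δ) := Finset.prod_nonneg fun k _ => by
      have := hlt k
      linarith
    have hP : (L - δ) * ∏ k, (b k - a k - 2 * δ) ≤ (L' : ℝ) * ∏ k, ((b' k : ℝ) - a' k) := by
      refine mul_le_mul hL'1.le (Finset.prod_le_prod (fun k _ => ?_) fun k _ => ?_) hnn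
        ((sub_pos.2 hδL).trans hL'1).le
      · have := hlt k
        linarith
      · have := hq k
        linarith
    have := mul_le_mul_of_nonneg_left (Real.rpow_le_rpow
      (mul_nonneg (sub_pos.2 hδL).le hnn) hP hα) hc.1.le
    linarith

end Family

/-! ### Splitting chains -/

section Splitting

variable {d : ℕ} {A : Set (Fin d → ℝ)} {x y : Fin d → ℝ}

theorem chainLength_add_le (hA : ∀ a b, (A ∩ Icc a b).Finite) {w : Fin d → ℝ} (hwy : w ≤ y)
    (hyx : y ≤ x) :
    chainLength d (A ∩ Icc w y) + chainLength d (A ∩ Icc y x)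
      ≤ chainLength d (A ∩ Icc w x) + 1 := by
  classical
  obtain ⟨C, hCA, hC, hcard⟩ := exists_card_eq_chainLength (hA w y)
  obtain ⟨D, hDA, hD, hcard'⟩ := exists_card_eq_chainLength (hA y x)
  have hU : (C ∪ D).card ≤ chainLength d (A ∩ Icc w x) := by
    refine card_le_chainLength (hA w x) ?_ ?_
    · rw [Finset.coe_union]
      exact union_subset
        (hCA.trans (inter_subset_inter_right _ (Icc_subset_Icc_right hyx)))
        (hDA.trans (inter_subset_inter_right _ (Icc_subset_Icc_left hwy)))
    · have hCD : ∀ z ∈ C, ∀ z' ∈ D, z ≤ z' := fun z hz z' hz' =>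
        (hCA hz).2.2.trans (hDA hz').2.1
      intro z hz z' hz' hne
      rw [Finset.coe_union] at hz hz'
      rcases hz with hz | hz <;> rcases hz' with hz' | hz'
      · exact hC hz hz' hne
      · exact Or.inl (hCD z hz z' hz')
      · exact Or.inr (hCD z' hz' z hz)
      · exact hD hz hz' hne
  have hI : (C ∩ D).card ≤ 1 := by
    rw [Finset.card_le_one]
    have : ∀ z ∈ C ∩ D, z = y := fun z hz => by
      rw [Finset.mem_inter] at hz
      exact le_antisymm (hCA hz.1).2.2 (hDA hz.2).2.1
    intro z hz z' hz'
    rw [this z hz, this z' hz']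
  have := Finset.card_union_add_card_inter C D
  omega

theorem exists_isGreatest_of_isChain {α : Type*} [PartialOrder α] {C : Finset α}
    (hne : C.Nonempty) (hC : IsChain (· ≤ ·) (C : Set α)) : ∃ z ∈ C, ∀ w ∈ C, w ≤ z := by
  obtain ⟨z, hz⟩ := C.exists_maximal hne
  refine ⟨z, hz.1, fun w hw => ?_⟩
  rcases hC.total hw hz.1 with h | h
  · exact h
  · exact hz.2 hw h

theorem exists_isLeast_of_isChain {α : Type*} [PartialOrder α] {C : Finset α}
    (hne : C.Nonempty) (hC : IsChain (· ≤ ·) (C : Set α)) : ∃ z ∈ C, ∀ w ∈ C, z ≤ w := by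
  obtain ⟨z, hz⟩ := C.exists_minimal hne
  refine ⟨z, hz.1, fun w hw => ?_⟩
  rcases hC.total hw hz.1 with h | h
  · exact hz.2 hw h
  · exact h

/-- The length of a longest chain in `[0, x]` splits at a point of any level set
`p · (x - y) = r`. -/
theorem exists_chainLength_le_add (hA : ∀ a b, (A ∩ Icc a b).Finite) {p : Fin d → ℝ} {r : ℝ}
    (hp : ∀ k, 0 ≤ p k) (hx : 0 ≤ x) (hr : 0 ≤ r) (hrx : r ≤ ∑ k, p k * x k) :
    ∃ y ∈ Icc 0 x, ∑ k, p k * (x k - y k) = r ∧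
      chainLength d (A ∩ Icc 0 x) ≤ chainLength d (A ∩ Icc 0 y) + chainLength d (A ∩ Icc y x) := by
  classical
  obtain ⟨C, hCA, hC, hcard⟩ := exists_card_eq_chainLength (hA 0 x)
  set D : (Fin d → ℝ) → ℝ := fun z => ∑ k, p k * (x k - z k) with hD
  have hDanti : ∀ z w : Fin d → ℝ, z ≤ w → D w ≤ D z := fun z w h =>
    Finset.sum_le_sum fun k _ => mul_le_mul_of_nonneg_left (by linarith [h k]) (hp k)
  have hC0 : ∀ z ∈ C, 0 ≤ z := fun z hz => (hCA hz).2.1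
  have hCx : ∀ z ∈ C, z ≤ x := fun z hz => (hCA hz).2.2
  set C1 := C.filter fun z => r ≤ D z
  set C2 := C.filter fun z => ¬ r ≤ D z
  have hC1 : ∀ z ∈ C1, z ∈ C ∧ r ≤ D z := fun z hz => Finset.mem_filter.1 hz
  have hC2 : ∀ z ∈ C2, z ∈ C ∧ ¬ r ≤ D z := fun z hz => Finset.mem_filter.1 hz
  have hch1 : IsChain (· ≤ ·) (C1 : Set (Fin d → ℝ)) :=
    hC.mono fun z hz => (hC1 z hz).1
  have hch2 : IsChain (· ≤ ·) (C2 : Set (Fin d → ℝ)) :=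
    hC.mono fun z hz => (hC2 z hz).1
  obtain ⟨z1, hz1, hg1⟩ := exists_isGreatest_of_isChain (C := insert 0 C1)
    (Finset.insert_nonempty _ _) (by
      rw [Finset.coe_insert]
      exact hch1.insert fun b hb _ => Or.inl (hC0 b (hC1 b hb).1))
  obtain ⟨z2, hz2, hg2⟩ := exists_isLeast_of_isChain (C := insert x C2)
    (Finset.insert_nonempty _ _) (by
      rw [Finset.coe_insert]
      exact hch2.insert fun b hb _ => Or.inr (hCx b (hC2 b hb).1))
  have hg2' : ∀ w ∈ C2, z2 ≤ w := fun w hw => hg2 w (Finset.mem_insert_of_mem hw)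
  have hg1' : ∀ w ∈ C1, w ≤ z1 := fun w hw => hg1 w (Finset.mem_insert_of_mem hw)
  have hz1' : 0 ≤ z1 ∧ z1 ≤ x ∧ r ≤ D z1 := by
    rcases Finset.mem_insert.1 hz1 with h | h
    · rw [h]; exact ⟨le_rfl, hx, by simpa [hD] using hrx⟩
    · exact ⟨hC0 _ (hC1 _ h).1, hCx _ (hC1 _ h).1, (hC1 _ h).2⟩
  have hz2' : 0 ≤ z2 ∧ z2 ≤ x ∧ D z2 ≤ r := by
    rcases Finset.mem_insert.1 hz2 with h | h
    · rw [h]; exact ⟨hx, le_rfl, by simpa [hD] using hr⟩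
    · exact ⟨hC0 _ (hC2 _ h).1, hCx _ (hC2 _ h).1, (not_le.1 (hC2 _ h).2).le⟩
  have hz12 : z1 ≤ z2 := by
    rcases Finset.mem_insert.1 hz1 with h | h
    · rw [h]; exact hz2'.1
    rcases Finset.mem_insert.1 hz2 with h' | h'
    · rw [h']; exact hz1'.2.1
    rcases hC.total (hC1 _ h).1 (hC2 _ h').1 with h3 | h3
    · exact h3
    · exact absurd ((hC1 _ h).2.trans (hDanti _ _ h3)) (hC2 _ h').2
  obtain ⟨y, hy1, hy2, hyr⟩ : ∃ y, z1 ≤ y ∧ y ≤ z2 ∧ D y = r := by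
    have hcont : ContinuousOn (fun s : ℝ => D (fun k => z1 k + s * (z2 k - z1 k))) (Icc 0 1) := by
      simp only [hD]
      fun_prop
    obtain ⟨s, hs, hsr⟩ := intermediate_value_Icc' zero_le_one hcont
      (show r ∈ Icc _ _ from ⟨by simpa using hz2'.2.2, by simpa using hz1'.2.2⟩)
    refine ⟨_, fun k => ?_, fun k => ?_, hsr⟩
    · have := mul_nonneg hs.1 (sub_nonneg.2 (hz12 k))
      dsimp only
      linarith
    · have := mul_le_mul_of_nonneg_right hs.2 (sub_nonneg.2 (hz12 k))
      dsimp only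
      linarith
  refine ⟨y, ⟨hz1'.1.trans hy1, hy2.trans hz2'.2.1⟩, hyr, ?_⟩
  have e1 : C1.card ≤ chainLength d (A ∩ Icc 0 y) := card_le_chainLength (hA _ _)
    (fun z hz => ⟨(hCA (hC1 z hz).1).1, hC0 z (hC1 z hz).1, (hg1' z hz).trans hy1⟩) hch1
  have e2 : C2.card ≤ chainLength d (A ∩ Icc y x) := card_le_chainLength (hA _ _)
    (fun z hz => ⟨(hCA (hC2 z hz).1).1, hy2.trans (hg2' z hz), hCx z (hC2 z hz).1⟩) hch2
  have e3 : C1.card + C2.card = C.card := Finset.card_filter_add_card_filter_not _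
  omega

theorem chainLength_Icc_le_add_sum (hA : ∀ a b, (A ∩ Icc a b).Finite) :
    chainLength d (A ∩ Icc 0 y) ≤ chainLength d (A ∩ Icc 0 x)
      + ∑ k, chainLength d (A ∩ Icc (Function.update 0 k (x k)) y) := by
  refine chainLength_le_add_sum _ _ (hA _ _) (fun k _ => hA _ _) ?_
  rintro z ⟨hz, hz0, hzy⟩
  by_cases h : z ≤ x
  · exact Or.inl ⟨hz, hz0, h⟩
  · rw [Pi.le_def, not_forall] at h
    obtain ⟨k, hk⟩ := h
    refine Or.inr (mem_biUnion (x := k) (Finset.mem_coe.2 (Finset.mem_univ k)) ⟨hz, ?_, hzy⟩)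
    rw [update_le_iff]
    exact ⟨(not_le.1 hk).le, fun j _ => hz0 j⟩

end Splitting

/-! ### Limit profiles of rescaled chain lengths -/

section LimitProfile

/-- `v` is the pointwise limit along `𝒰` of the rescaled chain lengths of `A t ∩ [0, x]`. -/
def IsLimitProfile (d : ℕ) (A : ℝ → Set (Fin d → ℝ)) (𝒰 : Filter ℝ) (v : (Fin d → ℝ) → ℝ) :
    Prop :=
  ∀ x, Tendsto (fun t => (chainLength d (A t ∩ Icc 0 x) : ℝ) / t ^ ((1 : ℝ) / d)) 𝒰 (𝓝 (v x))

variable {d : ℕ} {c : ℝ} {f : (Fin d → ℝ) → ℝ} {A : ℝ → Set (Fin d → ℝ)} {𝒰 : Ultrafilter ℝ}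
  {v : (Fin d → ℝ) → ℝ} {x y : Fin d → ℝ}

theorem HasChainRates.exists_isLimitProfile (hA : HasChainRates d c f A) (hf : MemB d f)
    (h𝒰 : (𝒰 : Filter ℝ) ≤ atTop) : ∃ v, IsLimitProfile d A 𝒰 v := by
  have key : ∀ x, ∃ l, Tendsto
      (fun t => (chainLength d (A t ∩ Icc 0 x) : ℝ) / t ^ ((1 : ℝ) / d)) 𝒰 (𝓝 l) := by
    intro x
    obtain ⟨K, hK⟩ : ∃ K : ℝ, ∀ᶠ t in (𝒰 : Filter ℝ),
        (chainLength d (A t ∩ Icc 0 x) : ℝ) / t ^ ((1 : ℝ) / d) ∈ Icc 0 K := by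
      by_cases hx : 0 ≤ x
      · obtain ⟨L, hL, hfL⟩ := hf.exists_forall_le (fun k => (0 : Fin d → ℝ) k - 1)
          (fun k => x k + 1)
        refine ⟨c * (L * ∏ k, (x k - (0 : Fin d → ℝ) k)) ^ ((1 : ℝ) / d) + 1, h𝒰 ?_⟩
        filter_upwards [hA.upper 0 x hx L hL 1 one_pos hfL 1 one_pos, eventually_gt_atTop 0]
          with t ht ht0
        have := Real.rpow_pos_of_pos ht0 ((1 : ℝ) / d)
        exact ⟨by positivity, (div_le_iff₀ this).2 ht⟩
      · refine ⟨0, Eventually.of_forall fun t => ?_⟩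
        rw [Icc_eq_empty hx, inter_empty, chainLength_empty]
        simp
    obtain ⟨l, -, hl⟩ := (isCompact_Icc (a := (0 : ℝ)) (b := K)).ultrafilter_le_nhds'
      (𝒰.map fun t => (chainLength d (A t ∩ Icc 0 x) : ℝ) / t ^ ((1 : ℝ) / d)) hK
    exact ⟨l, hl⟩
  choose v hv using key
  exact ⟨v, hv⟩

theorem IsLimitProfile.nonneg (hv : IsLimitProfile d A 𝒰 v) (h𝒰 : (𝒰 : Filter ℝ) ≤ atTop)
    (x : Fin d → ℝ) : 0 ≤ v x := by
  refine ge_of_tendsto (hv x) (h𝒰 ?_)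
  filter_upwards [eventually_gt_atTop 0] with t ht
  positivity

theorem IsLimitProfile.monotone (hv : IsLimitProfile d A 𝒰 v) (hA : HasChainRates d c f A)
    (h𝒰 : (𝒰 : Filter ℝ) ≤ atTop) : Monotone v := by
  intro x y hxy
  refine le_of_tendsto_of_tendsto (hv x) (hv y) (h𝒰 ?_)
  filter_upwards [eventually_gt_atTop 0] with t ht
  have : chainLength d (A t ∩ Icc 0 x) ≤ chainLength d (A t ∩ Icc 0 y) :=
    chainLength_mono (hA.finite t 0 y)
      (inter_subset_inter_right (A t) (Icc_subset_Icc_right hxy))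
  gcongr

theorem tendsto_rpow_one_div_atTop (hd : 0 < d) :
    Tendsto (fun t : ℝ => t ^ ((1 : ℝ) / d)) atTop atTop :=
  tendsto_rpow_atTop (by positivity)

theorem IsLimitProfile.add_le (hv : IsLimitProfile d A 𝒰 v) (hA : HasChainRates d c f A)
    (hd : 0 < d) (h𝒰 : (𝒰 : Filter ℝ) ≤ atTop) (hy : 0 ≤ y) (hyx : ∀ k, y k < x k) {L : ℝ}
    (hL : 0 < L) (hfL : ∀ z ∈ Icc y x, L ≤ f z) :
    v y + c * (L * ∏ k, (x k - y k)) ^ ((1 : ℝ) / d) ≤ v x := by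
  refine le_of_forall_pos_sub_le fun ε hε => ?_
  have h1 : Tendsto (fun t : ℝ => (t ^ ((1 : ℝ) / d))⁻¹) 𝒰 (𝓝 0) :=
    (tendsto_inv_atTop_zero.comp (tendsto_rpow_one_div_atTop hd)).mono_left h𝒰
  have h2 := (hv y).add_const (c * (L * ∏ k, (x k - y k)) ^ ((1 : ℝ) / d) - ε)
  have h3 := (hv x).add h1
  rw [add_zero] at h3
  rw [add_sub_assoc]
  refine le_of_tendsto_of_tendsto h2 h3 (h𝒰 ?_)
  filter_upwards [hA.lower y x hyx L hL hfL ε hε, eventually_gt_atTop 0] with t ht ht0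
  have hpos := Real.rpow_pos_of_pos ht0 ((1 : ℝ) / d)
  have h4 : (chainLength d (A t ∩ Icc 0 y) : ℝ) + chainLength d (A t ∩ Icc y x)
      ≤ chainLength d (A t ∩ Icc 0 x) + 1 := by
    exact_mod_cast chainLength_add_le (hA.finite t) hy fun k => (hyx k).le
  rw [← one_div, ← add_div, div_add' _ _ _ hpos.ne']
  rw [div_le_div_iff_of_pos_right hpos]
  linarith

theorem IsLimitProfile.le_add_sum (hv : IsLimitProfile d A 𝒰 v) (hA : HasChainRates d c f A)
    (h𝒰 : (𝒰 : Filter ℝ) ≤ atTop) (hx : 0 ≤ x) (hxy : x ≤ y) {L : ℝ}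
    (hL : 0 < L) (hfL : ∀ z ∈ Icc (fun _ => -1) (fun k => y k + 1), f z ≤ L) :
    v y ≤ v x
      + ∑ k, c * (L * ∏ j, (y j - Function.update (0 : Fin d → ℝ) k (x k) j)) ^ ((1 : ℝ) / d) := by
  have hle : ∀ k, Function.update (0 : Fin d → ℝ) k (x k) ≤ y := fun k => by
    rw [update_le_iff]
    exact ⟨hxy k, fun j _ => (hx j).trans (hxy j)⟩
  have hnn : ∀ k, 0 ≤ Function.update (0 : Fin d → ℝ) k (x k) := fun k => by
    rw [le_update_iff]
    exact ⟨hx k, fun j _ => le_rfl⟩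
  have main : ∀ ε > 0, v y ≤ v x + ∑ k,
      (c * (L * ∏ j, (y j - Function.update (0 : Fin d → ℝ) k (x k) j)) ^ ((1 : ℝ) / d) + ε) := by
    intro ε hε
    refine le_of_tendsto_of_tendsto (hv y) ((hv x).add_const _) (h𝒰 ?_)
    have hk : ∀ᶠ t in atTop, ∀ k,
        (chainLength d (A t ∩ Icc (Function.update (0 : Fin d → ℝ) k (x k)) y) : ℝ)
        ≤ (c * (L * ∏ j, (y j - Function.update (0 : Fin d → ℝ) k (x k) j)) ^ ((1 : ℝ) / d) + ε)
          * t ^ ((1 : ℝ) / d) := by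
      rw [eventually_all]
      intro k
      refine hA.upper _ _ (hle k) L hL 1 one_pos (fun z hz => hfL z ⟨fun j => ?_, hz.2⟩) ε hε
      have h1 := hz.1 j
      have h2 := hnn k j
      simp only [Pi.zero_apply] at h1 h2
      linarith
    filter_upwards [hk, eventually_gt_atTop 0] with t ht ht0
    have hpos := Real.rpow_pos_of_pos ht0 ((1 : ℝ) / d)
    have h4 : (chainLength d (A t ∩ Icc 0 y) : ℝ) ≤ chainLength d (A t ∩ Icc 0 x)
        + ∑ k, (chainLength d (A t ∩ Icc (Function.update (0 : Fin d → ℝ) k (x k)) y) : ℝ) := by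
      exact_mod_cast chainLength_Icc_le_add_sum (hA.finite t)
    have h5 := Finset.sum_le_sum fun k (_ : k ∈ Finset.univ) => ht k
    rw [← Finset.sum_mul] at h5
    rw [div_add' _ _ _ hpos.ne']
    rw [div_le_div_iff_of_pos_right hpos]
    linarith
  have hlim : Tendsto (fun ε : ℝ => v x + ∑ k,
      (c * (L * ∏ j, (y j - Function.update (0 : Fin d → ℝ) k (x k) j)) ^ ((1 : ℝ) / d) + ε))
      (𝓝[>] 0)
      (𝓝 (v x + ∑ k,
      (c * (L * ∏ j, (y j - Function.update (0 : Fin d → ℝ) k (x k) j)) ^ ((1 : ℝ) / d) + 0))) := by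
    refine tendsto_nhdsWithin_of_tendsto_nhds (Continuous.tendsto ?_ 0)
    fun_prop
  simp only [add_zero] at hlim
  exact ge_of_tendsto hlim (eventually_mem_nhdsWithin.mono fun ε hε => main ε hε)

theorem IsLimitProfile.eq_zero (hv : IsLimitProfile d A 𝒰 v) (hA : HasChainRates d c f A)
    (hd : 0 < d) (hf : MemB d f) (h𝒰 : (𝒰 : Filter ℝ) ≤ atTop) (hx : 0 ≤ x)
    {i : Fin d} (hi : x i = 0) : v x = 0 := by
  refine le_antisymm ?_ (hv.nonneg h𝒰 x)
  obtain ⟨L, hL, hfL⟩ := hf.exists_forall_le (fun k => (0 : Fin d → ℝ) k - 1)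
    (fun k => x k + 1)
  refine le_of_forall_pos_le_add fun ε hε => ?_
  refine le_of_tendsto (hv x) (h𝒰 ?_)
  filter_upwards [hA.upper 0 x hx L hL 1 one_pos hfL ε hε, eventually_gt_atTop 0] with t ht ht0
  have hpos := Real.rpow_pos_of_pos ht0 ((1 : ℝ) / d)
  rw [Finset.prod_eq_zero (Finset.mem_univ i) (by simp [hi]), mul_zero,
    Real.zero_rpow (by positivity), mul_zero] at ht
  exact (div_le_iff₀ hpos).2 ht

theorem IsLimitProfile.continuousOn (hv : IsLimitProfile d A 𝒰 v) (hA : HasChainRates d c f A)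
    (hd : 0 < d) (hf : MemB d f) (h𝒰 : (𝒰 : Filter ℝ) ≤ atTop) :
    ContinuousOn v (Ici 0) := by
  intro x hx
  obtain ⟨L, hL, hfL⟩ := hf.exists_forall_le (fun _ => -1) (fun k => x k + 2)
  set g : (Fin d → ℝ) → ℝ := fun y =>
    ∑ k, c * (L * ∏ j, ((x ⊔ y) j - Function.update (0 : Fin d → ℝ) k ((x ⊓ y) k) j))
      ^ ((1 : ℝ) / d) with hg
  have hgc : Continuous g := by
    refine continuous_finsetSum _ fun k _ => continuous_const.mul ?_
    refine Continuous.rpow_const ?_ fun y => Or.inr (by positivity)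
    refine continuous_const.mul (continuous_finsetProd _ fun j _ => ?_)
    refine Continuous.sub ?_ ?_
    · simp only [Pi.sup_apply]
      fun_prop
    · by_cases hjk : j = k
      · subst hjk
        simp only [Function.update_self, Pi.inf_apply]
        fun_prop
      · simp only [Function.update_of_ne hjk]
        fun_prop
  have hgx : g x = 0 := by
    refine Finset.sum_eq_zero fun k _ => ?_
    rw [Finset.prod_eq_zero (Finset.mem_univ k) (by simp), mul_zero,
      Real.zero_rpow (by positivity), mul_zero]
  have hbound : ∀ᶠ y in 𝓝[Ici 0] x, dist (v y) (v x) ≤ g y := by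
    have hnear : ∀ᶠ y in 𝓝[Ici 0] x, ∀ k, y k < x k + 1 := by
      rw [eventually_all]
      intro k
      exact ((continuous_apply k).tendsto x).mono_left nhdsWithin_le_nhds
        (Iio_mem_nhds (lt_add_one _))
    filter_upwards [hnear, self_mem_nhdsWithin] with y hy hy0
    have h1 := hv.le_add_sum hA h𝒰 (x := x ⊓ y) (y := x ⊔ y) (le_inf hx hy0)
      (inf_le_left.trans le_sup_left) hL (fun z hz => hfL z ⟨hz.1, fun k => ?_⟩)
    · have hm := hv.monotone hA h𝒰
      have e1 := hm (inf_le_left : x ⊓ y ≤ x)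
      have e2 := hm (inf_le_right : x ⊓ y ≤ y)
      have e3 := hm (le_sup_left : x ≤ x ⊔ y)
      have e4 := hm (le_sup_right : y ≤ x ⊔ y)
      rw [Real.dist_eq, abs_le]
      simp only [hg]
      constructor <;> linarith
    · have h2 := hz.2 k
      have h3 : (x ⊔ y) k ≤ x k + 1 := sup_le (by linarith) (hy k).le
      simp only at h2
      linarith
  rw [ContinuousWithinAt, tendsto_iff_dist_tendsto_zero]
  refine squeeze_zero' (Eventually.of_forall fun _ => dist_nonneg) hbound ?_
  rw [← hgx]
  exact hgc.tendsto x |>.mono_left nhdsWithin_le_nhds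

/-- Dynamic programming: the limit profile increases from some point of the level set
`p · (x - y) = r` to `x` by at most the constant-intensity rate. -/
theorem IsLimitProfile.exists_le_add (hv : IsLimitProfile d A 𝒰 v) (hA : HasChainRates d c f A)
    (hd : 0 < d) (hf : MemB d f) (h𝒰 : (𝒰 : Filter ℝ) ≤ atTop) {p : Fin d → ℝ} {r : ℝ}
    (hp : ∀ k, 0 ≤ p k) (hx : 0 ≤ x) (hr : 0 ≤ r) (hrx : r ≤ ∑ k, p k * x k) {L η : ℝ}
    (hL : 0 < L) (hη : 0 < η)
    (hfL : ∀ y ∈ Icc 0 x, ∑ k, p k * (x k - y k) = r →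
      ∀ z ∈ Icc (fun k => y k - η) (fun k => x k + η), f z ≤ L) :
    ∃ y ∈ Icc 0 x, ∑ k, p k * (x k - y k) = r ∧
      v x ≤ v y + c * (L * ∏ k, (x k - y k)) ^ ((1 : ℝ) / d) := by
  choose Y hY hYr hYl using fun t => exists_chainLength_le_add (hA.finite t) hp hx hr hrx
  have hK : IsCompact (Icc 0 x ∩ {y | ∑ k, p k * (x k - y k) = r}) :=
    isCompact_Icc.inter_right (isClosed_eq (by fun_prop) continuous_const)
  obtain ⟨y, ⟨hy, hyr⟩, hlim⟩ := hK.ultrafilter_le_nhds' (𝒰.map Y)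
    (Filter.mem_map.2 (Eventually.of_forall fun t => ⟨hY t, hYr t⟩))
  replace hlim : Tendsto Y 𝒰 (𝓝 y) := hlim
  refine ⟨y, hy, hyr, ?_⟩
  have main : ∀ h ∈ Ioo 0 (η / 2),
      v x ≤ v (fun k => y k + h) + (c * (L * ∏ k, (x k - (y k - h))) ^ ((1 : ℝ) / d) + h) := by
    intro h hh
    refine le_of_tendsto_of_tendsto (hv x) ((hv _).add_const _) ?_
    have hnear : ∀ᶠ t in (𝒰 : Filter ℝ), ∀ k, Y t k ∈ Ioo (y k - h) (y k + h) := by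
      rw [eventually_all]
      intro k
      exact ((continuous_apply k).tendsto y).comp hlim
        (Ioo_mem_nhds (by linarith [hh.1]) (by linarith [hh.1]))
    have hup := hA.upper (fun k => y k - h) x (fun k => by linarith [hy.2 k, hh.1]) L hL (η / 2)
      (by positivity) (fun z hz => hfL y hy hyr z ⟨fun k => ?_, fun k => ?_⟩) h hh.1
    · filter_upwards [hnear, h𝒰 hup, h𝒰 (eventually_gt_atTop 0)] with t ht1 ht2 ht0
      have hpos := Real.rpow_pos_of_pos ht0 ((1 : ℝ) / d)
      have e1 : (chainLength d (A t ∩ Icc 0 (Y t)) : ℝ)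
          ≤ chainLength d (A t ∩ Icc 0 fun k => y k + h) := by
        exact_mod_cast chainLength_mono (hA.finite t _ _)
          (inter_subset_inter_right (A t) (Icc_subset_Icc_right fun k => (ht1 k).2.le))
      have e2 : (chainLength d (A t ∩ Icc (Y t) x) : ℝ)
          ≤ chainLength d (A t ∩ Icc (fun k => y k - h) x) := by
        exact_mod_cast chainLength_mono (hA.finite t _ _)
          (inter_subset_inter_right (A t) (Icc_subset_Icc_left fun k => (ht1 k).1.le))
      have e3 : (chainLength d (A t ∩ Icc 0 x) : ℝ)
          ≤ chainLength d (A t ∩ Icc 0 (Y t)) + chainLength d (A t ∩ Icc (Y t) x) := by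
        exact_mod_cast hYl t
      rw [div_add' _ _ _ hpos.ne']
      rw [div_le_div_iff_of_pos_right hpos]
      linarith
    · have := hz.1 k
      simp only at this
      linarith [hh.2]
    · have := hz.2 k
      simp only at this
      linarith
  have hc1 : Tendsto (fun h : ℝ => v fun k => y k + h) (𝓝[>] 0) (𝓝 (v y)) := by
    refine (hv.continuousOn hA hd hf h𝒰 y hy.1).tendsto.comp ?_
    refine tendsto_nhdsWithin_of_tendsto_nhds_of_eventually_within _ ?_ ?_
    · have : Continuous fun (h : ℝ) (k : Fin d) => y k + h := by fun_prop
      simpa using (this.tendsto 0).mono_left nhdsWithin_le_nhds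
    · filter_upwards [self_mem_nhdsWithin] with h hh k
      exact add_nonneg (hy.1 k) (le_of_lt hh)
  have hc2 : Tendsto (fun h : ℝ => c * (L * ∏ k, (x k - (y k - h))) ^ ((1 : ℝ) / d) + h)
      (𝓝[>] 0) (𝓝 (c * (L * ∏ k, (x k - y k)) ^ ((1 : ℝ) / d))) := by
    have : Continuous fun h : ℝ => c * (L * ∏ k, (x k - (y k - h))) ^ ((1 : ℝ) / d) + h := by
      refine Continuous.add (continuous_const.mul (Continuous.rpow_const ?_
        fun _ => Or.inr (by positivity))) continuous_id
      fun_prop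
    simpa using (this.tendsto 0).mono_left nhdsWithin_le_nhds
  exact ge_of_tendsto (hc1.add hc2)
    (mem_of_superset (Ioo_mem_nhdsGT (half_pos hη)) fun h hh => main h hh)

end LimitProfile

/-! ### Limit profiles are viscosity solutions -/

section Viscosity

theorem HasFDerivAt.tendsto_sub_div {E : Type*} [NormedAddCommGroup E] [NormedSpace ℝ E]
    {φ : E → ℝ} {φ' : E →L[ℝ] ℝ} {x : E} (hφ : HasFDerivAt φ φ' x) (w : E) :
    Tendsto (fun h : ℝ => (φ x - φ (x - h • w)) / h) (𝓝[>] 0) (𝓝 (φ' w)) := by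
  have h := (HasDerivAt.tendsto_slope_zero_right (hφ.hasLineDerivAt (-w))).neg
  rw [map_neg, neg_neg] at h
  refine h.congr fun t => ?_
  simp only [zero_add, zero_smul, sub_zero, smul_neg, smul_eq_mul, ← sub_eq_add_neg]
  ring

theorem ContinuousLinearMap.apply_eq_sum_mul_single {d : ℕ} (L : (Fin d → ℝ) →L[ℝ] ℝ)
    (w : Fin d → ℝ) : L w = ∑ k, L (Pi.single k 1) * w k := by
  conv_lhs => rw [← Finset.univ_sum_single w, map_sum]
  refine Finset.sum_congr rfl fun k _ => ?_
  have : Pi.single k (w k) = w k • (Pi.single k 1 : Fin d → ℝ) := by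
    rw [← Pi.single_smul', smul_eq_mul, mul_one]
  rw [this, map_smul, smul_eq_mul, mul_comm]

/-- The inequality of arithmetic and geometric means, for `d` numbers. -/
theorem prod_le_sum_div_pow {d : ℕ} (hd : 0 < d) {z : Fin d → ℝ} (hz : ∀ k, 0 ≤ z k) :
    ∏ k, z k ≤ ((∑ k, z k) / d) ^ d := by
  have h := Real.geom_mean_le_arith_mean Finset.univ (fun _ => 1) z (fun _ _ => zero_le_one)
    (by simpa using hd) fun k _ => hz k
  simp only [Real.rpow_one, Finset.sum_const, Finset.card_univ, Fintype.card_fin, one_mul,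
    nsmul_eq_mul, mul_one] at h
  rwa [Real.rpow_inv_le_iff_of_pos (Finset.prod_nonneg fun k _ => hz k)
    (div_nonneg (Finset.sum_nonneg fun k _ => hz k) (by positivity)) (by positivity),
    Real.rpow_natCast] at h

variable {d : ℕ} {c : ℝ} {f : (Fin d → ℝ) → ℝ} {A : ℝ → Set (Fin d → ℝ)} {𝒰 : Ultrafilter ℝ}
  {v : (Fin d → ℝ) → ℝ} {x : Fin d → ℝ} {φ : (Fin d → ℝ) → ℝ} {φ' : (Fin d → ℝ) →L[ℝ] ℝ}

theorem MemB.eventually_lt_of_upperEnv_lt (hf : MemB d f) {l : ℝ} (h : upperEnv d f x < l) :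
    ∀ᶠ z in 𝓝 x, f z < l := by
  refine eventually_lt_of_limsup_lt h ?_
  obtain ⟨U, hU, B, hB⟩ := hf.2.2 x
  exact isBoundedUnder_of_eventually_le
    (mem_of_superset hU fun z hz => hB (mem_image_of_mem f hz))

theorem MemB.eventually_lt_of_lt_lowerEnv (hf : MemB d f) {l : ℝ} (h : l < lowerEnv d f x) :
    ∀ᶠ z in 𝓝 x, l < f z :=
  eventually_lt_of_lt_liminf h
    (isBoundedUnder_of_eventually_ge (Eventually.of_forall fun z => hf.2.1 z))

theorem tendsto_sub_smul_nhdsGT (x w : Fin d → ℝ) :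
    Tendsto (fun h : ℝ => x - h • w) (𝓝[>] 0) (𝓝 x) := by
  have : Continuous fun h : ℝ => x - h • w := by fun_prop
  simpa using (this.tendsto 0).mono_left nhdsWithin_le_nhds

theorem fderiv_single_nonneg_of_isLocalMin (hv : Monotone v) (hφ : HasFDerivAt φ φ' x)
    (h : IsLocalMin (fun y => v y - φ y) x) (k : Fin d) : 0 ≤ φ' (Pi.single k 1) := by
  refine ge_of_tendsto (hφ.tendsto_sub_div (Pi.single k 1)) ?_
  filter_upwards [(tendsto_sub_smul_nhdsGT x (Pi.single k 1)).eventually h,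
    self_mem_nhdsWithin] with t ht (ht0 : 0 < t)
  have h1 : v (x - t • Pi.single k 1) ≤ v x := hv (sub_le_self _
    (smul_nonneg ht0.le (Pi.single_nonneg.2 zero_le_one)))
  exact div_nonneg (by linarith) ht0.le

theorem fderiv_single_nonneg_of_isLocalMax (hv : Monotone v) (hφ : HasFDerivAt φ φ' x)
    (h : IsLocalMax (fun y => v y - φ y) x) (k : Fin d) : 0 ≤ φ' (Pi.single k 1) := by
  have h0 := hφ.tendsto_sub_div (-Pi.single k 1)
  rw [map_neg] at h0
  refine neg_nonpos.1 (le_of_tendsto h0 ?_)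
  filter_upwards [(tendsto_sub_smul_nhdsGT x (-Pi.single k 1)).eventually h,
    self_mem_nhdsWithin] with t ht (ht0 : 0 < t)
  have h1 : v x ≤ v (x - t • -Pi.single k 1) := by
    rw [smul_neg, sub_neg_eq_add]
    exact hv (le_add_of_nonneg_right (smul_nonneg ht0.le (Pi.single_nonneg.2 zero_le_one)))
  exact div_nonpos_of_nonpos_of_nonneg (by linarith) ht0.le

theorem IsLimitProfile.le_prod_of_isLocalMin (hv : IsLimitProfile d A 𝒰 v)
    (hA : HasChainRates d c f A) (hd : 0 < d) (hc : 0 < c) (hf : MemB d f)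
    (h𝒰 : (𝒰 : Filter ℝ) ≤ atTop) (hx : ∀ k, 0 < x k) (hφ : HasFDerivAt φ φ' x)
    (h : IsLocalMin (fun y => v y - φ y) x) :
    (c / d) ^ d * lowerEnv d f x ≤ ∏ k, φ' (Pi.single k 1) := by
  have hp := fderiv_single_nonneg_of_isLocalMin (hv.monotone hA h𝒰) hφ h
  have hd' : (0 : ℝ) < d := by exact_mod_cast hd
  rw [← le_div_iff₀' (by positivity)]
  refine le_of_forall_lt_imp_le_of_dense fun l hl => ?_
  rcases le_or_gt l 0 with hl0 | hl0
  · exact hl0.trans (div_nonneg (Finset.prod_nonneg fun k _ => hp k) (by positivity))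
  rw [le_div_iff₀' (by positivity)]
  have hdir : ∀ w : Fin d → ℝ, (∀ k, 0 < w k) →
      c * (l * ∏ k, w k) ^ ((1 : ℝ) / d) ≤ ∑ k, φ' (Pi.single k 1) * w k := by
    intro w hw
    rw [← ContinuousLinearMap.apply_eq_sum_mul_single]
    refine ge_of_tendsto (hφ.tendsto_sub_div w) ?_
    obtain ⟨ρ, hρ, hball⟩ := Metric.eventually_nhds_iff_ball.1 (hf.eventually_lt_of_lt_lowerEnv hl)
    have hpos : ∀ᶠ t in 𝓝[>] (0 : ℝ), ∀ k, 0 < (x - t • w) k := by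
      rw [eventually_all]
      intro k
      exact ((continuous_apply k).tendsto x).comp (tendsto_sub_smul_nhdsGT x w)
        (Ioi_mem_nhds (hx k))
    filter_upwards [(tendsto_sub_smul_nhdsGT x w).eventually h, self_mem_nhdsWithin, hpos,
      (tendsto_sub_smul_nhdsGT x w).eventually (Metric.ball_mem_nhds x hρ)]
      with t ht (ht0 : 0 < t) htpos htρ
    have hsub : ∀ z ∈ Icc (x - t • w) x, l ≤ f z := fun z hz => by
      refine (hball z ?_).le
      rw [Metric.mem_ball, dist_pi_lt_iff hρ]
      rw [dist_pi_lt_iff hρ] at htρ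
      intro k
      refine lt_of_le_of_lt ?_ (htρ k)
      rw [Real.dist_eq, Real.dist_eq, abs_of_nonpos (sub_nonpos.2 (hz.2 k)),
        abs_of_nonpos (sub_nonpos.2 ((hz.1.trans hz.2) k))]
      linarith [hz.1 k]
    have h1 := hv.add_le hA hd h𝒰 (fun k => (htpos k).le)
      (fun k => sub_lt_self _ (mul_pos ht0 (hw k))) hl0 hsub
    have h2 : (l * ∏ k, (x k - (x - t • w) k)) ^ ((1 : ℝ) / d)
        = t * (l * ∏ k, w k) ^ ((1 : ℝ) / d) := by
      have : l * ∏ k, (x k - (x - t • w) k) = t ^ d * (l * ∏ k, w k) := by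
        simp only [Pi.sub_apply, Pi.smul_apply, smul_eq_mul, sub_sub_cancel,
          Finset.prod_mul_distrib, Finset.prod_const, Finset.card_univ, Fintype.card_fin]
        ring
      rw [this, Real.mul_rpow (by positivity)
        (mul_nonneg hl0.le (Finset.prod_nonneg fun k _ => (hw k).le)), one_div,
        Real.pow_rpow_inv_natCast ht0.le hd.ne']
    rw [h2] at h1
    rw [le_div_iff₀ ht0]
    linarith
  have hε : ∀ ε > 0, (c / d) ^ d * l ≤ ∏ k, (φ' (Pi.single k 1) + ε) := by
    intro ε hε
    have hpe : ∀ k, 0 < φ' (Pi.single k 1) + ε := fun k => by linarith [hp k]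
    have hprod : 0 < ∏ k, (φ' (Pi.single k 1) + ε) := Finset.prod_pos fun k _ => hpe k
    have h1 := hdir (fun k => (φ' (Pi.single k 1) + ε)⁻¹) fun k => inv_pos.2 (hpe k)
    have h2 : ∑ k, φ' (Pi.single k 1) * (φ' (Pi.single k 1) + ε)⁻¹ ≤ d := by
      calc _ ≤ ∑ _k : Fin d, (1 : ℝ) := Finset.sum_le_sum fun k _ => by
            rw [← div_eq_mul_inv]
            exact div_le_one_of_le₀ (by linarith) (hpe k).le
        _ = d := by simp
    have h3 := h1.trans h2
    rw [Finset.prod_inv_distrib, ← le_div_iff₀' hc, one_div,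
      Real.rpow_inv_le_iff_of_pos (by positivity) (by positivity) hd',
      Real.rpow_natCast, ← div_eq_mul_inv, div_le_iff₀ hprod] at h3
    calc (c / d) ^ d * l ≤ (c / d) ^ d * ((d / c) ^ d * ∏ k, (φ' (Pi.single k 1) + ε)) := by
          gcongr
      _ = ∏ k, (φ' (Pi.single k 1) + ε) := by
          rw [← mul_assoc, ← mul_pow, div_mul_div_cancel₀ hd'.ne', div_self hc.ne', one_pow,
            one_mul]
  have hlim : Tendsto (fun ε : ℝ => ∏ k, (φ' (Pi.single k 1) + ε)) (𝓝[>] 0)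
      (𝓝 (∏ k, φ' (Pi.single k 1))) := by
    have : Continuous fun ε : ℝ => ∏ k, (φ' (Pi.single k 1) + ε) := by fun_prop
    simpa using (this.tendsto 0).mono_left nhdsWithin_le_nhds
  exact ge_of_tendsto hlim (eventually_mem_nhdsWithin.mono fun ε h => hε ε h)

theorem IsLimitProfile.prod_le_of_isLocalMax (hv : IsLimitProfile d A 𝒰 v)
    (hA : HasChainRates d c f A) (hd : 0 < d) (hc : 0 < c) (hf : MemB d f)
    (h𝒰 : (𝒰 : Filter ℝ) ≤ atTop) (hx : ∀ k, 0 < x k) (hφ : HasFDerivAt φ φ' x)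
    (h : IsLocalMax (fun y => v y - φ y) x) :
    ∏ k, φ' (Pi.single k 1) ≤ (c / d) ^ d * upperEnv d f x := by
  have hp := fderiv_single_nonneg_of_isLocalMax (hv.monotone hA h𝒰) hφ h
  have hd' : (0 : ℝ) < d := by exact_mod_cast hd
  have : Nonempty (Fin d) := ⟨⟨0, hd⟩⟩
  rw [← div_le_iff₀' (by positivity)]
  refine le_of_forall_gt_imp_ge_of_dense fun l hl => ?_
  have hfl := hf.eventually_lt_of_upperEnv_lt hl
  have hl0 : 0 < l := (hf.2.1 x).trans_lt hfl.self_of_nhds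
  rw [div_le_iff₀' (by positivity)]
  by_cases hp0 : ∃ k, φ' (Pi.single k 1) = 0
  · obtain ⟨k, hk⟩ := hp0
    rw [Finset.prod_eq_zero (Finset.mem_univ k) hk]
    positivity
  push Not at hp0
  set p : Fin d → ℝ := fun k => φ' (Pi.single k 1) with hpdef
  have hppos : ∀ k, 0 < p k := fun k => lt_of_le_of_ne (hp k) (hp0 k).symm
  obtain ⟨k₀, hk₀⟩ := Finite.exists_min p
  set m := p k₀
  have hm : 0 < m := hppos k₀
  have hε : ∀ ε ∈ Ioo (0 : ℝ) 1, (1 - ε) ^ d * ∏ k, p k ≤ (c / d) ^ d * l := by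
    intro ε hε
    obtain ⟨δ, hδ, hball⟩ := Metric.eventually_nhds_iff_ball.1
      ((hfl.and h).and (hφ.isLittleO.def (mul_pos hε.1 hm)))
    have hsum : 0 < ∑ k, p k * x k :=
      Finset.sum_pos (fun k _ => mul_pos (hppos k) (hx k)) Finset.univ_nonempty
    obtain ⟨r, hr0, hr⟩ := exists_between (lt_min hsum (mul_pos hm (half_pos hδ)))
    obtain ⟨hr1, hr2⟩ := lt_min_iff.1 hr
    have hclose : ∀ y ∈ Icc 0 x, ∑ k, p k * (x k - y k) = r → ∀ k, x k - y k ≤ r / m := by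
      intro y hy hyr k
      rw [le_div_iff₀' hm, ← hyr]
      calc m * (x k - y k) ≤ p k * (x k - y k) :=
            mul_le_mul_of_nonneg_right (hk₀ k) (sub_nonneg.2 (hy.2 k))
        _ ≤ _ := Finset.single_le_sum (f := fun k => p k * (x k - y k))
            (fun j _ => mul_nonneg (hp j) (sub_nonneg.2 (hy.2 j))) (Finset.mem_univ k)
    have hrm : r / m < δ / 2 := by rwa [div_lt_iff₀' hm]
    obtain ⟨y, hy, hyr, hle⟩ := hv.exists_le_add hA hd hf h𝒰 hp (fun k => (hx k).le) hr0.le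
      hr1.le hl0 (half_pos hδ) (fun y hy hyr z hz => (hball z (by
        rw [Metric.mem_ball, dist_pi_lt_iff hδ]
        intro k
        have h1 := hz.1 k
        have h2 := hz.2 k
        have h3 := hclose y hy hyr k
        simp only at h1 h2
        rw [Real.dist_eq, abs_lt]
        constructor <;> linarith)).1.1.le)
    have hnorm : ‖y - x‖ ≤ r / m := by
      rw [pi_norm_le_iff_of_nonneg (by positivity)]
      intro k
      rw [Pi.sub_apply, Real.norm_eq_abs, abs_sub_comm, abs_of_nonneg (sub_nonneg.2 (hy.2 k))]
      exact hclose y hy hyr k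
    obtain ⟨⟨-, hmax⟩, hlo⟩ := hball y (by
      rw [Metric.mem_ball, dist_eq_norm]
      linarith)
    have hlin : φ' (y - x) = -r := by
      rw [ContinuousLinearMap.apply_eq_sum_mul_single, ← hyr, ← Finset.sum_neg_distrib]
      refine Finset.sum_congr rfl fun k _ => ?_
      rw [Pi.sub_apply]
      ring
    rw [hlin, Real.norm_eq_abs] at hlo
    have hlo' : ε * m * ‖y - x‖ ≤ ε * r := by
      calc ε * m * ‖y - x‖ ≤ ε * m * (r / m) :=
            mul_le_mul_of_nonneg_left hnorm (mul_pos hε.1 hm).le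
        _ = ε * r := by field_simp
    have hxy : ∀ k, 0 ≤ x k - y k := fun k => sub_nonneg.2 (hy.2 k)
    have hprod : 0 ≤ ∏ k, (x k - y k) := Finset.prod_nonneg fun k _ => hxy k
    have h1 : (1 - ε) * r ≤ c * (l * ∏ k, (x k - y k)) ^ ((1 : ℝ) / d) := by
      have := (abs_le.1 (hlo.trans hlo')).2
      simp only at hmax
      linarith
    have h2 : ((1 - ε) * r) ^ d ≤ c ^ d * (l * ∏ k, (x k - y k)) := by
      have := pow_le_pow_left₀ (mul_nonneg (by linarith [hε.2]) hr0.le) h1 d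
      rwa [mul_pow c, one_div, Real.rpow_inv_natCast_pow (by positivity) hd.ne'] at this
    have h3 := prod_le_sum_div_pow hd fun k => mul_nonneg (hp k) (hxy k)
    rw [Finset.prod_mul_distrib] at h3
    change (∏ k, p k) * _ ≤ ((∑ k, p k * (x k - y k)) / d) ^ d at h3
    rw [hyr] at h3
    have hpp : 0 ≤ ∏ k, p k := Finset.prod_nonneg fun k _ => hp k
    refine le_of_mul_le_mul_right ?_ (pow_pos hr0 d)
    calc (1 - ε) ^ d * (∏ k, p k) * r ^ d = ((1 - ε) * r) ^ d * ∏ k, p k := by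
          rw [mul_pow]; ring
      _ ≤ c ^ d * (l * ∏ k, (x k - y k)) * ∏ k, p k := by gcongr
      _ = c ^ d * l * ((∏ k, p k) * ∏ k, (x k - y k)) := by ring
      _ ≤ c ^ d * l * (r / d) ^ d := by gcongr
      _ = (c / d) ^ d * l * r ^ d := by rw [div_pow, div_pow]; ring
  have hlim : Tendsto (fun ε : ℝ => (1 - ε) ^ d * ∏ k, p k) (𝓝[>] 0) (𝓝 (∏ k, p k)) := by
    have : Continuous fun ε : ℝ => (1 - ε) ^ d * ∏ k, p k := by fun_prop
    simpa using (this.tendsto 0).mono_left nhdsWithin_le_nhds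
  exact le_of_tendsto hlim (mem_of_superset (Ioo_mem_nhdsGT one_pos) fun ε h => hε ε h)

theorem Ici_zero_mem_nhds (hx : ∀ k, 0 < x k) : Ici 0 ∈ 𝓝 x := by
  have : ∀ᶠ z in 𝓝 x, ∀ k, 0 < z k := by
    rw [eventually_all]
    exact fun k => (continuous_apply k).tendsto x (Ioi_mem_nhds (hx k))
  filter_upwards [this] with z hz k using (hz k).le

theorem IsLimitProfile.isNDViscSol (hv : IsLimitProfile d A 𝒰 v)
    (hA : HasChainRates d c f A) (hd : 0 < d) (hc : 0 < c) (hf : MemB d f)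
    (h𝒰 : (𝒰 : Filter ℝ) ≤ atTop) : IsNDViscSol d c f v := by
  refine ⟨hv.continuousOn hA hd hf h𝒰, fun x y _ hxy => hv.monotone hA h𝒰 hxy,
    fun x hx ⟨i, hi⟩ => hv.eq_zero hA hd hf h𝒰 hx hi, fun x hx φ hφ h => ?_,
    fun x hx φ hφ h => ?_⟩
  · exact hv.prod_le_of_isLocalMax hA hd hc hf h𝒰 hx
      (hφ.differentiable (by simp)).differentiableAt.hasFDerivAt
      (h.isLocalMax (Ici_zero_mem_nhds hx))
  · exact hv.le_prod_of_isLocalMin hA hd hc hf h𝒰 hx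
      (hφ.differentiable (by simp)).differentiableAt.hasFDerivAt
      (h.isLocalMin (Ici_zero_mem_nhds hx))

end Viscosity

/-! ### Convergence -/

section Convergence

variable {d : ℕ}

/-- Pointwise convergence of nondecreasing functions to a continuous function on the orthant is
uniform on boxes. -/
theorem tendstoUniformlyOn_Icc_of_monotone {F : ℝ → (Fin d → ℝ) → ℝ} {u : (Fin d → ℝ) → ℝ}
    (hF : ∀ᶠ t in atTop, Monotone (F t)) (hu : ContinuousOn u (Ici 0))
    (hlim : ∀ x, 0 ≤ x → Tendsto (fun t => F t x) atTop (𝓝 (u x))) (b : Fin d → ℝ) :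
    TendstoUniformlyOn F u atTop (Icc 0 b) := by
  rw [← tendstoLocallyUniformlyOn_iff_tendstoUniformlyOn_of_compact isCompact_Icc,
    Metric.tendstoLocallyUniformlyOn_iff]
  intro ε hε x hx
  obtain ⟨δ, hδ, hδu⟩ := Metric.continuousOn_iff.1 hu x hx.1 (ε / 3) (by positivity)
  set lo : Fin d → ℝ := fun k => max (x k - δ / 2) 0
  set hi : Fin d → ℝ := fun k => x k + δ / 2
  have hlo0 : 0 ≤ lo := fun k => le_max_right _ _
  have hhi0 : 0 ≤ hi := fun k => add_nonneg (hx.1 k) (by positivity)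
  have hlo : dist (u lo) (u x) < ε / 3 := by
    refine hδu lo hlo0 ((dist_pi_le_iff (half_pos hδ).le).2 (fun k => ?_) |>.trans_lt
      (half_lt_self hδ))
    have h0 : 0 ≤ x k := hx.1 k
    have h1 : lo k ≤ x k := max_le (by linarith) h0
    have h2 : x k - δ / 2 ≤ lo k := le_max_left _ _
    rw [Real.dist_eq, abs_le]
    constructor <;> linarith
  have hhi : dist (u hi) (u x) < ε / 3 := by
    refine hδu hi hhi0 ((dist_pi_le_iff (half_pos hδ).le).2 (fun k => ?_) |>.trans_lt
      (half_lt_self hδ))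
    simp only [hi, Real.dist_eq, add_sub_cancel_left]
    rw [abs_of_pos (half_pos hδ)]
  refine ⟨Icc 0 b ∩ Metric.ball x (δ / 2),
    inter_mem_nhdsWithin _ (Metric.ball_mem_nhds x (half_pos hδ)), ?_⟩
  filter_upwards [hF, Metric.tendsto_nhds.1 (hlim lo hlo0) (ε / 3) (by positivity),
    Metric.tendsto_nhds.1 (hlim hi hhi0) (ε / 3) (by positivity)] with t hm h1 h2
  rintro y ⟨hy, hyx⟩
  have hyu := hδu y hy.1 (lt_trans hyx (half_lt_self hδ))
  rw [Metric.mem_ball, dist_pi_lt_iff (half_pos hδ)] at hyx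
  have e1 : F t lo ≤ F t y := hm fun k => max_le
    (by have := (abs_lt.1 (Real.dist_eq (y k) (x k) ▸ hyx k)).1; linarith) (hy.1 k)
  have e2 : F t y ≤ F t hi := hm fun k => by
    have := (abs_lt.1 (Real.dist_eq (y k) (x k) ▸ hyx k)).2
    simp only [hi]
    linarith
  rw [Real.dist_eq, abs_lt] at *
  constructor <;> linarith [h1.1, h2.2, hlo.1, hhi.2, hyu.1, hyu.2]

theorem HasChainRates.tendsto_of_unique {c : ℝ} {f u : (Fin d → ℝ) → ℝ}
    {A : ℝ → Set (Fin d → ℝ)} (hA : HasChainRates d c f A) (hd : 0 < d) (hc : 0 < c)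
    (hf : MemB d f) (huniq : ∀ v, IsNDViscSol d c f v → EqOn v u (Ici 0)) {x : Fin d → ℝ}
    (hx : 0 ≤ x) :
    Tendsto (fun t => (chainLength d (A t ∩ Icc 0 x) : ℝ) / t ^ ((1 : ℝ) / d)) atTop
      (𝓝 (u x)) := by
  rw [tendsto_iff_ultrafilter]
  intro 𝒰 h𝒰
  obtain ⟨v, hv⟩ := hA.exists_isLimitProfile hf h𝒰
  rw [← huniq v (hv.isNDViscSol hA hd hc hf h𝒰) hx]
  exact hv x

end Convergence

/-- For a monotone family `{𝒫_{tf}}_{t>0}` of Poisson point processes on a common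
probability space, if (P) has a unique nondecreasing viscosity solution `u`, then with
probability one `t^{-1/d} U_t → u` locally uniformly on `[0,∞)^d` as `t → ∞`. -/
theorem nondominated_sorting_continuum_limit_continuous_time
    {d : ℕ} (hd : 0 < d) (c : ℝ) (hc : IsBWConstant d c)
    (f : (Fin d → ℝ) → ℝ) (hf : MemB d f)
    (u : (Fin d → ℝ) → ℝ) (hu : IsNDViscSol d c f u)
    (huniq : ∀ v : (Fin d → ℝ) → ℝ, IsNDViscSol d c f v →
      Set.EqOn v u (Set.Ici (0 : Fin d → ℝ)))
    {Ω : Type*} [MeasurableSpace Ω] (P : Measure Ω) [IsProbabilityMeasure P]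
    (PP : ∀ t : ℝ, 0 < t → PoissonPP d P fun x => t * f x)
    (hmono : ∀ s t : ℝ, ∀ (hs : 0 < s) (ht : 0 < t), s ≤ t →
      ∀ ω, (PP s hs).pts ω ⊆ (PP t ht).pts ω) :
    P {ω | ∀ M : ℝ, 0 < M →
      TendstoUniformlyOn
        (fun (t : ℝ) (x : Fin d → ℝ) =>
          if ht : 0 < t then
            t ^ (-(1 : ℝ) / d) * (chainLength d ((PP t ht).pts ω ∩ Set.Icc 0 x) : ℝ)
          else 0)
        u atTop (Set.Icc (0 : Fin d → ℝ) fun _ => M)} = 1 := by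
  rw [← measure_univ (μ := P)]
  refine measure_congr (eventuallyEq_univ.2 ?_)
  filter_upwards [ae_hasChainRates hmono hd hc hf] with ω hA M _
  have heq : ∀ t, 0 < t → ∀ x : Fin d → ℝ,
      (if ht : 0 < t then
        t ^ (-(1 : ℝ) / d) * (chainLength d ((PP t ht).pts ω ∩ Set.Icc 0 x) : ℝ) else 0)
      = (chainLength d (pointsAt PP ω t ∩ Icc 0 x) : ℝ) / t ^ ((1 : ℝ) / d) := by
    intro t ht x
    rw [dif_pos ht, pointsAt_of_pos PP ω ht, neg_div, Real.rpow_neg ht.le, mul_comm,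
      div_eq_mul_inv _ (t ^ _)]
  refine tendstoUniformlyOn_Icc_of_monotone ?_ hu.1 (fun x hx => ?_) _
  · filter_upwards [eventually_gt_atTop 0] with t ht x y hxy
    beta_reduce
    rw [heq t ht, heq t ht]
    have : chainLength d (pointsAt PP ω t ∩ Icc 0 x)
        ≤ chainLength d (pointsAt PP ω t ∩ Icc 0 y) :=
      chainLength_mono (hA.finite t 0 y)
        (inter_subset_inter_right _ (Icc_subset_Icc_right hxy))
    gcongr
  · refine (hA.tendsto_of_unique hd hc.1 hf huniq hx).congr' ?_
    filter_upwards [eventually_gt_atTop 0] with t ht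
    exact (heq t ht x).symm

end
end

section
/- Let d ≥ 1 and let (ℓ_n)_{n≥1} be nonnegative integrable real-valued random variables, and for each n let M_n be a median of ℓ_n. Suppose there are constants 0 < C₁ < C₂ such that C₁ n^{1/d} ≤ E[ℓ_n] ≤ C₂ n^{1/d} for all n ≥ 1, and suppose that for every n ≥ 1 and every λ > 0, P(ℓ_n ≤ M_n − λ) ≤ 2 exp(−λ²/(4(M_n + λ))) and P(ℓ_n ≥ M_n + λ) ≤ 2 exp(−λ²/(4(M_n + λ))). Then there exists a constant C > 0, depending only on C₁, C₂ and d, such that |E[ℓ_n] − M_n| ≤ C log(n) n^{1/(2d)} for all n ≥ 2. -/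
open MeasureTheory Filter Set Topology

noncomputable section

/-- A random variable with exponential tails `P(|f| ≥ t) ≤ K e^{-bt}` has `|E f| ≤ K / b`. -/
theorem abs_integral_le_of_exp_tail {Ω : Type*} [MeasurableSpace Ω] {P : Measure Ω} {f : Ω → ℝ}
    (hf : Integrable f P) {K b : ℝ} (hK : 0 ≤ K) (hb : 0 < b)
    (htail : ∀ t : ℝ, 0 < t → P {ω | t ≤ |f ω|} ≤ ENNReal.ofReal (K * Real.exp (-b * t))) :
    |∫ ω, f ω ∂P| ≤ K / b := by
  refine abs_integral_le_integral_abs.trans ?_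
  rw [← ENNReal.ofReal_le_ofReal_iff (by positivity),
    ofReal_integral_eq_lintegral_ofReal hf.abs (ae_of_all _ fun _ => abs_nonneg _),
    lintegral_eq_lintegral_meas_le P (ae_of_all _ fun _ => abs_nonneg _) hf.abs.aemeasurable]
  calc ∫⁻ t in Ioi 0, P {ω | t ≤ |f ω|}
      ≤ ∫⁻ t in Ioi (0 : ℝ), ENNReal.ofReal (K * Real.exp (-b * t)) :=
        setLIntegral_mono' measurableSet_Ioi htail
    _ = ENNReal.ofReal (∫ t in Ioi (0 : ℝ), K * Real.exp (-b * t)) :=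
        (ofReal_integral_eq_lintegral_ofReal
          ((integrableOn_exp_mul_Ioi (neg_lt_zero.2 hb) 0).const_mul K)
          (ae_of_all _ fun t => by positivity)).symm
    _ = ENNReal.ofReal (K / b) := by
        rw [integral_const_mul, integral_exp_mul_Ioi (neg_lt_zero.2 hb)]
        congr 1
        simp [div_eq_mul_inv]

/-- On the scale `s ≥ max(1, √M)`, the Bernstein-type tail at the level `M` is dominated by an
exponential one. -/
theorem exp_neg_sq_div_le {M s t : ℝ} (hM : 0 ≤ M) (hs : 1 ≤ s) (hMs : M ≤ s ^ 2) (ht : 0 < t) :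
    Real.exp (-t ^ 2 / (4 * (M + t))) ≤ Real.exp (1 / 4) * Real.exp (-(1 / (4 * s)) * t) := by
  rw [← Real.exp_add, Real.exp_le_exp]
  have hs0 : 0 < s := one_pos.trans_le hs
  have hrhs : 1 / 4 + -(1 / (4 * s)) * t = (s - t) / (4 * s) := by
    field_simp
    ring
  rw [hrhs, div_le_div_iff₀ (by positivity) (by positivity)]
  have h : (t - s) * (M + t) ≤ t ^ 2 * s := by
    rcases le_total t s with hts | hts
    · exact (mul_nonpos_of_nonpos_of_nonneg (by linarith) (by positivity)).trans (by positivity)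
    · nlinarith [mul_le_mul_of_nonneg_left hMs (sub_nonneg.2 hts),
        mul_nonneg (sub_nonneg.2 hts) (mul_nonneg ht.le (sub_nonneg.2 hs)), pow_pos hs0 3]
  linarith

/-- A median of a nonnegative integrable random variable is nonnegative and at most twice the
mean. -/
theorem median_mem_Icc {Ω : Type*} [MeasurableSpace Ω] {P : Measure Ω} [IsProbabilityMeasure P]
    {X : Ω → ℝ} {M : ℝ} (hX : ∀ ω, 0 ≤ X ω) (hint : Integrable X P)
    (hle : (1 : ENNReal) / 2 ≤ P {ω | X ω ≤ M}) (hge : (1 : ENNReal) / 2 ≤ P {ω | M ≤ X ω}) :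
    M ∈ Icc 0 (2 * ∫ ω, X ω ∂P) := by
  have hM : 0 ≤ M := by
    by_contra! hneg
    have hempty : {ω | X ω ≤ M} = ∅ :=
      eq_empty_of_forall_notMem fun ω hω => (hneg.trans_le (hX ω)).not_ge hω
    simp [hempty] at hle
  have hhalf : (1 : ℝ) / 2 ≤ P.real {ω | M ≤ X ω} := by
    simpa [measureReal_def] using ENNReal.toReal_mono (measure_ne_top P _) hge
  have hmarkov := mul_meas_ge_le_integral_of_nonneg (ae_of_all P hX) hint M
  exact ⟨hM, by nlinarith⟩

/-- Bernstein-type concentration around the median `M` bounds the distance from the mean to `M`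
by a multiple of any scale `s ≥ max(1, √M)`. -/
theorem abs_integral_sub_median_le {Ω : Type*} [MeasurableSpace Ω] {P : Measure Ω}
    [IsProbabilityMeasure P] {X : Ω → ℝ} {M s : ℝ} (hint : Integrable X P) (hM : 0 ≤ M)
    (hs : 1 ≤ s) (hMs : M ≤ s ^ 2)
    (htail : ∀ t : ℝ, 0 < t →
      P {ω | X ω ≤ M - t} ≤ ENNReal.ofReal (2 * Real.exp (-t ^ 2 / (4 * (M + t)))) ∧
      P {ω | M + t ≤ X ω} ≤ ENNReal.ofReal (2 * Real.exp (-t ^ 2 / (4 * (M + t))))) :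
    |(∫ ω, X ω ∂P) - M| ≤ 16 * Real.exp (1 / 4) * s := by
  have hs0 : 0 < s := one_pos.trans_le hs
  have hsub : (∫ ω, X ω ∂P) - M = ∫ ω, (X ω - M) ∂P := by
    simp [integral_sub hint (integrable_const M)]
  have hbound : 16 * Real.exp (1 / 4) * s = 4 * Real.exp (1 / 4) / (1 / (4 * s)) := by
    field_simp
    norm_num
  rw [hsub, hbound]
  refine abs_integral_le_of_exp_tail (hint.sub (integrable_const M)) (by positivity)
    (by positivity) fun t ht => ?_
  calc P {ω | t ≤ |X ω - M|}
      ≤ P ({ω | X ω ≤ M - t} ∪ {ω | M + t ≤ X ω}) := by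
        refine measure_mono fun ω hω => ?_
        rcases le_abs.1 (show t ≤ |X ω - M| from hω) with h | h
        · exact Or.inr (show M + t ≤ X ω by linarith)
        · exact Or.inl (show X ω ≤ M - t by linarith)
    _ ≤ P {ω | X ω ≤ M - t} + P {ω | M + t ≤ X ω} := measure_union_le _ _
    _ ≤ _ := add_le_add (htail t ht).1 (htail t ht).2
    _ = ENNReal.ofReal (4 * Real.exp (-t ^ 2 / (4 * (M + t)))) := by
        rw [← ENNReal.ofReal_add (by positivity) (by positivity)]
        congr 1
        ring
    _ ≤ _ := ENNReal.ofReal_le_ofReal (by linarith [exp_neg_sq_div_le hM hs hMs ht])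

/-- Under the growth bounds `C₁ n^{1/d} ≤ E[ℓ_n] ≤ C₂ n^{1/d}` and the
concentration inequalities around the median `M_n`, there is a constant `C > 0` depending only
on `C₁`, `C₂` and `d` such that `|E[ℓ_n] - M_n| ≤ C log(n) n^{1/(2d)}` for all `n ≥ 2`. -/
theorem mean_median_estimate
    (d : ℕ) (hd : 1 ≤ d) (C₁ C₂ : ℝ) (hC₁ : 0 < C₁) (hC₁₂ : C₁ < C₂) :
    ∃ C : ℝ, 0 < C ∧
      ∀ (Ω : Type) (_ : MeasurableSpace Ω) (P : Measure Ω), IsProbabilityMeasure P →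
      ∀ (ℓ : ℕ → Ω → ℝ) (Med : ℕ → ℝ),
      (∀ n : ℕ, 1 ≤ n → ∀ ω, 0 ≤ ℓ n ω) →
      (∀ n : ℕ, 1 ≤ n → Integrable (ℓ n) P) →
      (∀ n : ℕ, 1 ≤ n → (1 : ENNReal) / 2 ≤ P {ω | ℓ n ω ≤ Med n} ∧
        (1 : ENNReal) / 2 ≤ P {ω | Med n ≤ ℓ n ω}) →
      (∀ n : ℕ, 1 ≤ n → C₁ * (n : ℝ) ^ ((1 : ℝ) / d) ≤ ∫ ω, ℓ n ω ∂P ∧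
        ∫ ω, ℓ n ω ∂P ≤ C₂ * (n : ℝ) ^ ((1 : ℝ) / d)) →
      (∀ n : ℕ, 1 ≤ n → ∀ lam : ℝ, 0 < lam →
        P {ω | ℓ n ω ≤ Med n - lam}
          ≤ ENNReal.ofReal (2 * Real.exp (-lam ^ 2 / (4 * (Med n + lam)))) ∧
        P {ω | Med n + lam ≤ ℓ n ω}
          ≤ ENNReal.ofReal (2 * Real.exp (-lam ^ 2 / (4 * (Med n + lam))))) →
      ∀ n : ℕ, 2 ≤ n →
        |(∫ ω, ℓ n ω ∂P) - Med n| ≤ C * Real.log n * (n : ℝ) ^ ((1 : ℝ) / (2 * d)) := by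
  have hC₂ : 0 < C₂ := hC₁.trans hC₁₂
  have hlog2 : 0 < Real.log 2 := Real.log_pos one_lt_two
  refine ⟨16 * Real.exp (1 / 4) * √(2 * C₂ + 1) / Real.log 2, by positivity, ?_⟩
  intro Ω _ P _ ℓ Med hnonneg hint hmed hgrowth htail n hn
  have hn1 : 1 ≤ n := by omega
  have hnR : (1 : ℝ) ≤ n := by exact_mod_cast hn1
  have hN : (1 : ℝ) ≤ (n : ℝ) ^ ((1 : ℝ) / d) := Real.one_le_rpow hnR (by positivity)
  have hsq : ((n : ℝ) ^ ((1 : ℝ) / (2 * d))) ^ 2 = (n : ℝ) ^ ((1 : ℝ) / d) := by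
    rw [← Real.rpow_mul_natCast (by positivity)]
    congr 1
    push_cast
    field_simp
  obtain ⟨hM0, hM2⟩ := median_mem_Icc (hnonneg n hn1) (hint n hn1) (hmed n hn1).1 (hmed n hn1).2
  have hs : 1 ≤ √(2 * C₂ + 1) * (n : ℝ) ^ ((1 : ℝ) / (2 * d)) :=
    one_le_mul_of_one_le_of_one_le (Real.one_le_sqrt.2 (by linarith))
      (Real.one_le_rpow hnR (by positivity))
  have hMs : Med n ≤ (√(2 * C₂ + 1) * (n : ℝ) ^ ((1 : ℝ) / (2 * d))) ^ 2 := by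
    rw [mul_pow, hsq, Real.sq_sqrt (by positivity)]
    linarith [(hgrowth n hn1).2]
  refine (abs_integral_sub_median_le (hint n hn1) hM0 hs hMs (htail n hn1)).trans ?_
  have hlog : 1 ≤ Real.log n / Real.log 2 :=
    (one_le_div hlog2).2 (Real.log_le_log two_pos (by exact_mod_cast hn))
  calc _ ≤ 16 * Real.exp (1 / 4) * (√(2 * C₂ + 1) * (n : ℝ) ^ ((1 : ℝ) / (2 * d))) *
        (Real.log n / Real.log 2) := le_mul_of_one_le_right (by positivity) hlog
    _ = _ := by ring

end
end
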